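/- For every integer k ≥ 1 and every u ∈ (0,4), the determinant of the (2k−1)×(2k−1) Wrońskian matrix Ω̆_{2k−1}(u) := ( (d/du)^{i−1} μ̆¹_{k,j}(u) )_{1≤i≤2k−1, 1≤j≤2k−1} (entries given by iterated derivatives with respect to u) equals Λ_{2k−1} / ( u^k · ∏_{j=1}^{k} ((2j)² − u) )^{k−1/2}, where Λ_{2k−1} := (k/(2k+1)) · ((−1)^{(k−1)(k−2)/2} / 2^{k(2k−3)}) · ((2k)!)^{2k−1} / ∏_{n=1}^{2k} n^n. -/

import Mathlib

open scoped BigOperators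
open Matrix Polynomial Filter

/-- The modified Bessel function `I₀`. -/
noncomputable def besselI0 (t : ℝ) : ℝ :=
  (1 / Real.pi) * ∫ θ in (0:ℝ)..Real.pi, Real.exp (t * Real.cos θ)

/-- The modified Bessel function `K₀`. -/
noncomputable def besselK0 (t : ℝ) : ℝ :=
  ∫ v in Set.Ioi (0:ℝ), Real.exp (-(t * Real.cosh v))

/-- Off-shell Bessel moment `IvKM(a,b;n|u)`. -/
noncomputable def IvKM (a b n : ℕ) (u : ℝ) : ℝ :=
  ∫ t in Set.Ioi (0:ℝ),
    besselI0 (Real.sqrt u * t) * besselI0 t ^ (a - 1) * besselK0 t ^ b * t ^ n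

/-- Off-shell Bessel moment `IKvM(a,b;n|u)`. -/
noncomputable def IKvM (a b n : ℕ) (u : ℝ) : ℝ :=
  ∫ t in Set.Ioi (0:ℝ),
    besselK0 (Real.sqrt u * t) * besselI0 t ^ a * besselK0 t ^ (b - 1) * t ^ n

/-- The normalized off-shell Bessel moments `μ̆ℓ_{k,j}(u)` (for `1 ≤ j ≤ 3k-1`). -/
noncomputable def muS (k l j : ℕ) (u : ℝ) : ℝ :=
  if j = 1 then
    Real.pi ^ (-(k : ℤ)) *
      ((IvKM 1 (2 * k) (2 * l - 1) u + (2 * k : ℝ) * IKvM 1 (2 * k) (2 * l - 1) u) / (2 * k + 1))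
  else if j ≤ k then
    Real.pi ^ ((j : ℤ) - k - 1) * IvKM j (2 * k + 1 - j) (2 * l - 1) u
  else
    Real.pi ^ ((j : ℤ) - 2 * k) * IKvM (j - k + 1) (3 * k - j) (2 * l - 1) u


open MeasureTheory Topology

/-- The modified Bessel function `I₁`, in integral form. -/
noncomputable def bI1 (t : ℝ) : ℝ :=
  (1 / Real.pi) * ∫ θ in (0:ℝ)..Real.pi, Real.cos θ * Real.exp (t * Real.cos θ)

theorem deriv_cos_int (p : ℕ) (t : ℝ) :
    HasDerivAt (fun t : ℝ => ∫ θ in (0:ℝ)..Real.pi, Real.cos θ ^ p * Real.exp (t * Real.cos θ))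
      (∫ θ in (0:ℝ)..Real.pi, Real.cos θ ^ (p + 1) * Real.exp (t * Real.cos θ)) t := by
  refine (intervalIntegral.hasDerivAt_integral_of_dominated_loc_of_deriv_le
    (F := fun t θ => Real.cos θ ^ p * Real.exp (t * Real.cos θ))
    (F' := fun t θ => Real.cos θ ^ (p + 1) * Real.exp (t * Real.cos θ))
    (bound := fun _ => Real.exp (|t| + 1))
    (Metric.ball_mem_nhds t one_pos) ?_ ?_ ?_ ?_ ?_ ?_).2
  · exact Eventually.of_forall fun x => (Continuous.aestronglyMeasurable (by fun_prop))
  · exact Continuous.intervalIntegrable (by fun_prop) _ _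
  · exact (Continuous.aestronglyMeasurable (by fun_prop))
  · refine Eventually.of_forall fun θ _ x hx => ?_
    have h1 : |Real.cos θ| ≤ 1 := Real.abs_cos_le_one θ
    have h2 : |x| ≤ |t| + 1 := by
      have := abs_sub_abs_le_abs_sub x t
      rw [Metric.mem_ball, Real.dist_eq] at hx
      linarith
    rw [norm_mul, norm_pow, Real.norm_eq_abs, Real.norm_eq_abs, Real.abs_exp]
    have h3 : x * Real.cos θ ≤ |t| + 1 := by
      calc x * Real.cos θ ≤ |x * Real.cos θ| := le_abs_self _
        _ = |x| * |Real.cos θ| := abs_mul _ _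
        _ ≤ |x| * 1 := by gcongr
        _ ≤ _ := by linarith
    calc |Real.cos θ| ^ (p + 1) * Real.exp (x * Real.cos θ) ≤ 1 * Real.exp (|t| + 1) := by
          gcongr
          exact pow_le_one₀ (abs_nonneg _) h1
      _ = _ := one_mul _
  · exact intervalIntegrable_const
  · refine Eventually.of_forall fun θ _ x hx => ?_
    have : HasDerivAt (fun x => Real.exp (x * Real.cos θ))
        (Real.exp (x * Real.cos θ) * (1 * Real.cos θ)) x :=
      ((hasDerivAt_id x).mul_const _).exp
    exact (this.const_mul (Real.cos θ ^ p)).congr_deriv (by ring)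

theorem hasDerivAt_I0 (t : ℝ) : HasDerivAt besselI0 (bI1 t) t := by
  have := (deriv_cos_int 0 t).const_mul (1 / Real.pi)
  simp only [pow_zero, one_mul, zero_add, pow_one] at this
  exact this

theorem I1_aux (t : ℝ) :
    t * ∫ θ in (0:ℝ)..Real.pi, Real.sin θ ^ 2 * Real.exp (t * Real.cos θ) =
      ∫ θ in (0:ℝ)..Real.pi, Real.cos θ * Real.exp (t * Real.cos θ) := by
  have h : ∀ θ ∈ Set.uIcc 0 Real.pi, HasDerivAt
      (fun θ => Real.sin θ * Real.exp (t * Real.cos θ))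
      (Real.cos θ * Real.exp (t * Real.cos θ)
        - t * (Real.sin θ ^ 2 * Real.exp (t * Real.cos θ))) θ := by
    intro θ _
    have h1 := (((Real.hasDerivAt_cos θ).const_mul t).exp)
    exact ((Real.hasDerivAt_sin θ).mul h1).congr_deriv (by ring)
  have := intervalIntegral.integral_eq_sub_of_hasDerivAt h
    (Continuous.intervalIntegrable (by fun_prop) _ _)
  rw [intervalIntegral.integral_sub (Continuous.intervalIntegrable (by fun_prop) _ _)
    (Continuous.intervalIntegrable (by fun_prop) _ _), intervalIntegral.integral_const_mul] at this
  simp at this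
  linarith

theorem hasDerivAt_I1 {t : ℝ} (ht : 0 < t) : HasDerivAt bI1 (besselI0 t - bI1 t / t) t := by
  have := (deriv_cos_int 1 t).const_mul (1 / Real.pi)
  have e : (1 / Real.pi) * (∫ θ in (0:ℝ)..Real.pi, Real.cos θ ^ (1 + 1) * Real.exp (t * Real.cos θ))
      = besselI0 t - bI1 t / t := by
    have h2 : (∫ θ in (0:ℝ)..Real.pi, Real.cos θ ^ (1 + 1) * Real.exp (t * Real.cos θ))
      = (∫ θ in (0:ℝ)..Real.pi, Real.exp (t * Real.cos θ)) -
        ∫ θ in (0:ℝ)..Real.pi, Real.sin θ ^ 2 * Real.exp (t * Real.cos θ) := by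
      rw [← intervalIntegral.integral_sub (Continuous.intervalIntegrable (by fun_prop) _ _)
        (Continuous.intervalIntegrable (by fun_prop) _ _)]
      congr 1; ext θ
      have := Real.sin_sq_add_cos_sq θ
      rw [show Real.sin θ ^ 2 = 1 - Real.cos θ ^ 2 by linarith]; ring
    have h3 := I1_aux t
    rw [h2, besselI0, bI1, ← h3]
    field_simp
  rw [e] at this
  simp only [pow_one] at this
  exact this

theorem I0_nonneg (t : ℝ) : 0 ≤ besselI0 t := by
  unfold besselI0
  have : 0 ≤ ∫ θ in (0:ℝ)..Real.pi, Real.exp (t * Real.cos θ) :=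
    intervalIntegral.integral_nonneg Real.pi_pos.le fun _ _ => (Real.exp_pos _).le
  have := Real.pi_pos
  positivity

theorem I1_abs_le {t : ℝ} : |bI1 t| ≤ besselI0 t := by
  unfold bI1 besselI0
  rw [abs_mul, abs_of_pos (by have := Real.pi_pos; positivity : 0 < 1 / Real.pi)]
  have := Real.pi_pos
  gcongr
  rw [← Real.norm_eq_abs]
  refine intervalIntegral.norm_integral_le_of_norm_le Real.pi_pos.le
    (Eventually.of_forall fun θ _ => ?_) (Continuous.intervalIntegrable (by fun_prop) _ _)
  rw [norm_mul, Real.norm_eq_abs, Real.norm_eq_abs, Real.abs_exp]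
  exact mul_le_of_le_one_left (Real.exp_pos _).le (Real.abs_cos_le_one θ)

theorem I0_le {t : ℝ} (ht : 0 ≤ t) : besselI0 t ≤ Real.exp t := by
  unfold besselI0
  have : (∫ θ in (0:ℝ)..Real.pi, Real.exp (t * Real.cos θ)) ≤
      ∫ θ in (0:ℝ)..Real.pi, Real.exp t := by
    refine intervalIntegral.integral_mono_on Real.pi_pos.le
      (Continuous.intervalIntegrable (by fun_prop) _ _) intervalIntegrable_const fun θ _ => ?_
    gcongr
    exact mul_le_of_le_one_right ht (Real.cos_le_one θ)
  have hp := Real.pi_pos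
  simp at this
  calc _ ≤ (1 / Real.pi) * (Real.pi * Real.exp t) := by gcongr
    _ = _ := by field_simp

theorem I0_zero : besselI0 0 = 1 := by
  simp [besselI0, Real.pi_ne_zero]

theorem I0_continuous : Continuous besselI0 :=
  continuous_iff_continuousAt.2 fun t => (hasDerivAt_I0 t).continuousAt

theorem ftc_Ioi {f f' : ℝ → ℝ} {l m : ℝ} (hd : ∀ x ∈ Set.Ioi (0:ℝ), HasDerivAt f (f' x) x)
    (hi : IntegrableOn f' (Set.Ioi 0)) (h0 : Tendsto f (𝓝[>] 0) (𝓝 l))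
    (h1 : Tendsto f atTop (𝓝 m)) : ∫ x in Set.Ioi (0:ℝ), f' x = m - l := by
  have := integral_Ioi_deriv_mul_eq_sub (a := (0:ℝ)) (u := f) (u' := f') (v := fun _ => (1:ℝ))
    (v' := fun _ => 0) (a' := l) (b' := m) hd (fun x _ => hasDerivAt_const x (1:ℝ))
    (by convert hi using 1; ext x; simp) (by convert h0 using 1; ext x; simp)
    (by convert h1 using 1; ext x; simp)
  simpa using this

theorem pow_le_exp_bound (p : ℕ) {δ : ℝ} (hδ : 0 < δ) :
    ∃ C : ℝ, 0 < C ∧ ∀ x : ℝ, 0 ≤ x → x ^ p ≤ C * Real.exp (δ * x) := by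
  refine ⟨p.factorial / δ ^ p, by positivity, fun x hx => ?_⟩
  have := Real.pow_div_factorial_le_exp (δ * x) (by positivity) p
  rw [mul_pow, div_le_iff₀ (by positivity)] at this
  rw [div_mul_eq_mul_div, le_div_iff₀ (by positivity)]
  linarith

theorem le_cosh (v : ℝ) (hv : 0 ≤ v) : v ≤ Real.cosh v :=
  (Real.self_le_sinh_iff.2 hv).trans (Real.sinh_lt_cosh v).le

theorem cosh_int (p : ℕ) {t : ℝ} (ht : 0 < t) :
    IntegrableOn (fun v => Real.cosh v ^ p * Real.exp (-(t * Real.cosh v))) (Set.Ioi 0) := by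
  obtain ⟨C, hC, h⟩ := pow_le_exp_bound p (half_pos ht)
  have hi : IntegrableOn (fun v => C * Real.exp (-(t / 2) * v)) (Set.Ioi 0) :=
    (exp_neg_integrableOn_Ioi 0 (half_pos ht)).const_mul C
  refine Integrable.mono' hi (Continuous.aestronglyMeasurable (by fun_prop)) ?_
  refine (ae_restrict_iff' measurableSet_Ioi).2 (Eventually.of_forall fun v hv => ?_)
  have hv : (0:ℝ) < v := hv
  have hc := Real.cosh_pos v
  rw [Real.norm_eq_abs, abs_of_pos (by positivity)]
  calc Real.cosh v ^ p * Real.exp (-(t * Real.cosh v))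
      ≤ C * Real.exp (t / 2 * Real.cosh v) * Real.exp (-(t * Real.cosh v)) := by
        gcongr; exact h _ hc.le
    _ = C * Real.exp (-(t / 2) * Real.cosh v) := by
        rw [mul_assoc, ← Real.exp_add]; ring_nf
    _ ≤ C * Real.exp (-(t / 2) * v) := by
        have := le_cosh v hv.le
        gcongr C * Real.exp ?_
        nlinarith

theorem deriv_cosh_int (p : ℕ) {t : ℝ} (ht : 0 < t) :
    HasDerivAt (fun t : ℝ => ∫ v in Set.Ioi (0:ℝ), Real.cosh v ^ p * Real.exp (-(t * Real.cosh v)))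
      (-∫ v in Set.Ioi (0:ℝ), Real.cosh v ^ (p + 1) * Real.exp (-(t * Real.cosh v))) t := by
  rw [← integral_neg]
  refine (hasDerivAt_integral_of_dominated_loc_of_deriv_le
    (F := fun t v => Real.cosh v ^ p * Real.exp (-(t * Real.cosh v)))
    (F' := fun t v => -(Real.cosh v ^ (p + 1) * Real.exp (-(t * Real.cosh v))))
    (bound := fun v => Real.cosh v ^ (p + 1) * Real.exp (-(t / 2 * Real.cosh v)))
    (s := Set.Ioi (t / 2)) (Ioi_mem_nhds (by linarith)) ?_ ?_ ?_ ?_ ?_ ?_).2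
  · exact Eventually.of_forall fun x => (Continuous.aestronglyMeasurable (by fun_prop))
  · exact cosh_int p ht
  · exact (Continuous.aestronglyMeasurable (by fun_prop))
  · refine Eventually.of_forall fun v x hx => ?_
    have hx : t / 2 < x := hx
    have hc := Real.cosh_pos v
    rw [norm_neg, Real.norm_eq_abs, abs_of_pos (by positivity)]
    gcongr
  · exact cosh_int (p + 1) (half_pos ht)
  · refine Eventually.of_forall fun v x hx => ?_
    have : HasDerivAt (fun x => Real.exp (-(x * Real.cosh v)))
        (Real.exp (-(x * Real.cosh v)) * (-(1 * Real.cosh v))) x :=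
      (((hasDerivAt_id x).mul_const _).neg).exp
    exact (this.const_mul (Real.cosh v ^ p)).congr_deriv (by ring)

/-- The modified Bessel function `K₁`, in integral form. -/
noncomputable def bK1 (t : ℝ) : ℝ :=
  ∫ v in Set.Ioi (0:ℝ), Real.cosh v * Real.exp (-(t * Real.cosh v))

theorem hasDerivAt_K0 {t : ℝ} (ht : 0 < t) : HasDerivAt besselK0 (-bK1 t) t := by
  have := deriv_cosh_int 0 ht
  simp only [pow_zero, one_mul, zero_add, pow_one] at this
  exact this

theorem exp_cosh_tendsto {t : ℝ} (ht : 0 < t) (p : ℕ) :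
    Tendsto (fun v => Real.cosh v ^ p * Real.exp (-(t * Real.cosh v))) atTop (𝓝 0) := by
  obtain ⟨C, hC, h⟩ := pow_le_exp_bound p (half_pos ht)
  have h1 : Tendsto (fun v : ℝ => C * Real.exp (-(t / 2 * v))) atTop (𝓝 (C * 0)) := by
    refine Tendsto.const_mul _ (Real.tendsto_exp_neg_atTop_nhds_zero.comp ?_)
    exact tendsto_id.const_mul_atTop (half_pos ht)
  rw [mul_zero] at h1
  refine tendsto_of_tendsto_of_tendsto_of_le_of_le' tendsto_const_nhds h1 ?_ ?_
  · exact Eventually.of_forall fun v => by have := Real.cosh_pos v; positivity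
  · filter_upwards [eventually_ge_atTop 0] with v hv
    have hc := Real.cosh_pos v
    calc Real.cosh v ^ p * Real.exp (-(t * Real.cosh v))
        ≤ C * Real.exp (t / 2 * Real.cosh v) * Real.exp (-(t * Real.cosh v)) := by
          gcongr; exact h _ hc.le
      _ = C * Real.exp (-(t / 2 * Real.cosh v)) := by
          rw [mul_assoc, ← Real.exp_add]; ring_nf
      _ ≤ C * Real.exp (-(t / 2 * v)) := by
          have := le_cosh v hv
          gcongr

theorem K1_aux {t : ℝ} (ht : 0 < t) :
    ∫ v in Set.Ioi (0:ℝ), (Real.cosh v * Real.exp (-(t * Real.cosh v)) -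
      t * (Real.sinh v ^ 2 * Real.exp (-(t * Real.cosh v)))) = 0 - 0 := by
  refine ftc_Ioi (f := fun v => Real.sinh v * Real.exp (-(t * Real.cosh v))) ?_ ?_ ?_ ?_
  · intro v _
    have h1 := (((Real.hasDerivAt_cosh v).const_mul t).neg).exp
    exact ((Real.hasDerivAt_sinh v).mul h1).congr_deriv (by simp only [Pi.neg_apply]; ring)
  · have h1 := (cosh_int 1 ht).sub (((cosh_int 2 ht).sub (cosh_int 0 ht)).const_mul t)
    refine h1.congr (Eventually.of_forall fun v => ?_)
    simp only [Pi.sub_apply, Real.sinh_sq]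
    ring
  · have : Continuous (fun v => Real.sinh v * Real.exp (-(t * Real.cosh v))) := by fun_prop
    have := (this.tendsto 0).mono_left (nhdsWithin_le_nhds (s := Set.Ioi 0))
    simpa using this
  · refine squeeze_zero_norm' ?_ (exp_cosh_tendsto ht 1)
    filter_upwards [eventually_ge_atTop 0] with v hv
    rw [Real.norm_eq_abs, abs_mul, Real.abs_exp, pow_one, abs_of_nonneg (Real.sinh_nonneg_iff.2 hv)]
    gcongr
    exact (Real.sinh_lt_cosh v).le

theorem hasDerivAt_K1 {t : ℝ} (ht : 0 < t) : HasDerivAt bK1 (-besselK0 t - bK1 t / t) t := by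
  have := deriv_cosh_int 1 ht
  simp only [pow_one] at this
  refine this.congr_deriv ?_
  have h1 := K1_aux ht
  have h2 : IntegrableOn (fun v => Real.sinh v ^ 2 * Real.exp (-(t * Real.cosh v))) (Set.Ioi 0) := by
    refine ((cosh_int 2 ht).sub (cosh_int 0 ht)).congr (Eventually.of_forall fun v => ?_)
    simp only [Pi.sub_apply, Real.sinh_sq]
    ring
  have i1 := cosh_int 1 ht
  have i0 := cosh_int 0 ht
  simp only [pow_one, pow_zero, one_mul] at i1 i0
  rw [integral_sub i1 (h2.const_mul t), integral_const_mul] at h1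
  have h3 : ∫ v in Set.Ioi (0:ℝ), Real.cosh v ^ (1 + 1) * Real.exp (-(t * Real.cosh v)) =
      besselK0 t + ∫ v in Set.Ioi (0:ℝ), Real.sinh v ^ 2 * Real.exp (-(t * Real.cosh v)) := by
    rw [besselK0, ← integral_add i0 h2]
    congr 1; ext v
    rw [Real.sinh_sq]; ring
  rw [h3]
  have h4 : bK1 t = t * ∫ v in Set.Ioi (0:ℝ), Real.sinh v ^ 2 * Real.exp (-(t * Real.cosh v)) := by
    unfold bK1; linarith
  rw [h4]; field_simp; ring

/-- `e^{-t} ≤ t K₁(t) ≤ e^{-t}(1+t)` -/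
theorem tK1_bounds {t : ℝ} (ht : 0 < t) :
    Real.exp (-t) ≤ t * bK1 t ∧ t * bK1 t ≤ Real.exp (-t) * (1 + t) := by
  have i1 := cosh_int 1 ht
  simp only [pow_one] at i1
  have is : IntegrableOn (fun v => Real.sinh v * Real.exp (-(t * Real.cosh v))) (Set.Ioi 0) := by
    refine Integrable.mono' i1 (Continuous.aestronglyMeasurable (by fun_prop)) ?_
    refine (ae_restrict_iff' measurableSet_Ioi).2 (Eventually.of_forall fun v hv => ?_)
    have hv : (0:ℝ) < v := hv
    rw [Real.norm_eq_abs, abs_mul, Real.abs_exp, abs_of_nonneg (Real.sinh_nonneg_iff.2 hv.le)]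
    gcongr
    exact (Real.sinh_lt_cosh v).le
  have hs : ∫ v in Set.Ioi (0:ℝ), t * (Real.sinh v * Real.exp (-(t * Real.cosh v))) =
      0 - (-Real.exp (-t)) := by
    refine ftc_Ioi (f := fun v => -Real.exp (-(t * Real.cosh v))) ?_ (is.const_mul t) ?_ ?_
    · intro v _
      have h1 := ((((Real.hasDerivAt_cosh v).const_mul t).neg).exp).neg
      exact h1.congr_deriv (by simp only [Pi.neg_apply]; ring)
    · have : Continuous (fun v => -Real.exp (-(t * Real.cosh v))) := by fun_prop
      have := (this.tendsto 0).mono_left (nhdsWithin_le_nhds (s := Set.Ioi 0))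
      simpa using this
    · simpa using (exp_cosh_tendsto ht 0).neg
  rw [integral_const_mul] at hs
  have hdiff : bK1 t = (∫ v in Set.Ioi (0:ℝ), Real.sinh v * Real.exp (-(t * Real.cosh v))) +
      ∫ v in Set.Ioi (0:ℝ), (Real.cosh v * Real.exp (-(t * Real.cosh v)) -
        Real.sinh v * Real.exp (-(t * Real.cosh v))) := by
    rw [integral_sub i1 is, bK1]; ring
  have e1 : ∀ v : ℝ, Real.cosh v * Real.exp (-(t * Real.cosh v)) -
        Real.sinh v * Real.exp (-(t * Real.cosh v)) =
        Real.exp (-v) * Real.exp (-(t * Real.cosh v)) := by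
    intro v; rw [← Real.cosh_sub_sinh v]; ring
  have hlow : 0 ≤ ∫ v in Set.Ioi (0:ℝ), (Real.cosh v * Real.exp (-(t * Real.cosh v)) -
        Real.sinh v * Real.exp (-(t * Real.cosh v))) := by
    refine integral_nonneg fun v => ?_
    simp only [e1, Pi.zero_apply]; positivity
  have hup : ∫ v in Set.Ioi (0:ℝ), (Real.cosh v * Real.exp (-(t * Real.cosh v)) -
        Real.sinh v * Real.exp (-(t * Real.cosh v))) ≤ Real.exp (-t) := by
    have : ∫ v in Set.Ioi (0:ℝ), Real.exp (-t) * Real.exp (-1 * v) = Real.exp (-t) := by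
      rw [integral_const_mul, integral_exp_mul_Ioi (by norm_num)]; simp
    rw [← this]
    refine integral_mono (i1.sub is) ((exp_neg_integrableOn_Ioi 0 one_pos).const_mul _) fun v => ?_
    simp only [e1]
    rw [mul_comm, neg_one_mul]
    gcongr
    nlinarith [Real.one_le_cosh v]
  rw [hdiff]
  constructor <;> nlinarith

theorem K0_nonneg (t : ℝ) : 0 ≤ besselK0 t :=
  integral_nonneg fun _ => (Real.exp_pos _).le

theorem K1_nonneg (t : ℝ) : 0 ≤ bK1 t :=
  integral_nonneg fun v => by have := Real.cosh_pos v; simp only [Pi.zero_apply]; positivity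

theorem K0_le_small {t : ℝ} (ht : 0 < t) (h1 : t ≤ 1) : besselK0 t ≤ besselK0 1 - Real.log t := by
  have hm : MonotoneOn (fun t => besselK0 t + Real.log t) (Set.Ioi 0) := by
    have hd : ∀ x ∈ Set.Ioi (0:ℝ), HasDerivAt (fun t => besselK0 t + Real.log t)
        (-bK1 x + x⁻¹) x := fun x hx => (hasDerivAt_K0 hx).add (Real.hasDerivAt_log (ne_of_gt hx))
    refine monotoneOn_of_deriv_nonneg (convex_Ioi 0)
      (fun x hx => (hd x hx).continuousAt.continuousWithinAt) ?_ ?_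
    · rw [interior_Ioi]; exact fun x hx => (hd x hx).differentiableAt.differentiableWithinAt
    · rw [interior_Ioi]; intro x hx
      have hx' : (0:ℝ) < x := hx
      rw [(hd x hx).deriv]
      have h2 := (tK1_bounds hx').2
      have h3 : Real.exp (-x) * (1 + x) ≤ 1 := by
        have := Real.add_one_le_exp x
        rw [Real.exp_neg, inv_mul_le_iff₀ (Real.exp_pos _)]; linarith
      have h4 : bK1 x ≤ x⁻¹ := by
        rw [← one_div, le_div_iff₀ hx']; linarith
      linarith
  have := hm (Set.mem_Ioi.2 ht) (Set.mem_Ioi.2 one_pos) h1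
  simp only [Real.log_one] at this
  linarith

theorem K0_le_large {t : ℝ} (ht : 1 ≤ t) : besselK0 t ≤ Real.exp 1 * besselK0 1 * Real.exp (-t) := by
  have i0 := cosh_int 0 (lt_of_lt_of_le one_pos ht)
  have i1 := cosh_int 0 (one_pos)
  simp only [pow_zero, one_mul] at i0 i1
  unfold besselK0
  rw [mul_assoc, mul_comm _ (Real.exp (-t)), ← mul_assoc, ← Real.exp_add, ← integral_const_mul]
  refine integral_mono i0 ((by simpa using i1.const_mul _)) fun v => ?_
  simp only [← Real.exp_add]
  gcongr
  nlinarith [Real.one_le_cosh v]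

theorem cosh_sub_one_eq (y : ℝ) : Real.cosh y - 1 = 2 * Real.sinh (y / 2) ^ 2 := by
  have := Real.cosh_two_mul (y / 2)
  rw [show 2 * (y / 2) = y by ring, Real.cosh_sq] at this
  linarith

theorem cosh_sub_one_ge {y : ℝ} (hy : 0 ≤ y) : y ^ 2 / 2 ≤ Real.cosh y - 1 := by
  rw [cosh_sub_one_eq]
  have := Real.self_le_sinh_iff.2 (by positivity : 0 ≤ y / 2)
  nlinarith [mul_self_le_mul_self (by positivity : 0 ≤ y / 2) this]

theorem one_sub_cos_eq (y : ℝ) : 1 - Real.cos y = 2 * Real.sin (y / 2) ^ 2 := by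
  have := Real.cos_two_mul (y / 2)
  rw [show 2 * (y / 2) = y by ring] at this
  have h2 := Real.sin_sq_add_cos_sq (y / 2)
  linarith

theorem scaled_limit {f : ℝ → ℝ} (hf : HasDerivAt f 1 0) (hf0 : f 0 = 0) (x : ℝ) :
    Tendsto (fun t : ℝ => t * (2 * f ((Real.sqrt t)⁻¹ * x / 2) ^ 2)) atTop (𝓝 (x ^ 2 / 2)) := by
  have hy : Tendsto (fun t : ℝ => (Real.sqrt t)⁻¹) atTop (𝓝[≠] 0) := by
    refine tendsto_nhdsWithin_iff.2 ⟨tendsto_inv_atTop_zero.comp Real.tendsto_sqrt_atTop, ?_⟩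
    filter_upwards [eventually_gt_atTop 0] with t ht
    have := Real.sqrt_pos.2 ht
    simp [this.ne']
  have hg : HasDerivAt (fun y => f (y * (x / 2))) (x / 2) 0 := by
    have h1 : HasDerivAt (fun y : ℝ => y * (x / 2)) (1 * (x / 2)) 0 :=
      (hasDerivAt_id 0).mul_const _
    have h2 : HasDerivAt f 1 (0 * (x / 2)) := by simpa using hf
    exact (h2.comp 0 h1).congr_deriv (by ring)
  have h3 := (hasDerivAt_iff_tendsto_slope.1 hg).comp hy
  have h4 : Tendsto (fun t : ℝ => 2 * (slope (fun y => f (y * (x / 2))) 0 (Real.sqrt t)⁻¹) ^ 2)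
      atTop (𝓝 (2 * (x / 2) ^ 2)) := (h3.pow 2).const_mul 2
  rw [show x ^ 2 / 2 = 2 * (x / 2) ^ 2 by ring]
  refine h4.congr' ?_
  filter_upwards [eventually_gt_atTop 0] with t ht
  have hs := Real.sq_sqrt ht.le
  simp only [slope_def_field, zero_mul, hf0, sub_zero, div_inv_eq_mul]
  rw [mul_pow, hs, ← mul_div_assoc]; ring

theorem gauss_half : ∫ x in Set.Ioi (0:ℝ), Real.exp (-(x ^ 2 / 2)) = Real.sqrt (Real.pi / 2) := by
  have := integral_gaussian_Ioi (1 / 2)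
  rw [show (fun x : ℝ => Real.exp (-(x ^ 2 / 2))) = fun x => Real.exp (-(1 / 2) * x ^ 2) by
    ext x; ring_nf, this]
  rw [show Real.pi / (1 / 2) = 2 ^ 2 * (Real.pi / 2) by ring, Real.sqrt_mul (by positivity),
    Real.sqrt_sq (by norm_num)]
  ring

theorem gauss_int {b : ℝ} (hb : 0 < b) :
    IntegrableOn (fun x : ℝ => Real.exp (-(b * x ^ 2))) (Set.Ioi 0) := by
  have := (integrable_exp_neg_mul_sq hb).integrableOn (s := Set.Ioi 0)
  simpa using this

theorem AK_eq {t : ℝ} (ht : 0 < t) : Real.sqrt t * Real.exp t * besselK0 t =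
    ∫ x in Set.Ioi (0:ℝ), Real.exp (-(t * (Real.cosh ((Real.sqrt t)⁻¹ * x) - 1))) := by
  have hs := Real.sqrt_pos.2 ht
  have := integral_comp_mul_left_Ioi (fun v => Real.exp (-(t * (Real.cosh v - 1)))) 0 (inv_pos.2 hs)
  rw [this, mul_zero, inv_inv, smul_eq_mul, besselK0, mul_assoc, ← integral_const_mul]
  congr 2
  ext v
  rw [← Real.exp_add]; ring_nf

theorem AK_dom {t x : ℝ} (ht : 0 < t) (hx : 0 < x) :
    Real.exp (-(t * (Real.cosh ((Real.sqrt t)⁻¹ * x) - 1))) ≤ Real.exp (-(1 / 2 * x ^ 2)) := by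
  have hs := Real.sqrt_pos.2 ht
  have h := cosh_sub_one_ge (y := (Real.sqrt t)⁻¹ * x) (by positivity)
  have h2 : t * (((Real.sqrt t)⁻¹ * x) ^ 2 / 2) = 1 / 2 * x ^ 2 := by
    rw [mul_pow, inv_pow, Real.sq_sqrt ht.le]; field_simp
  refine Real.exp_le_exp.2 (neg_le_neg ?_)
  rw [← h2]
  exact mul_le_mul_of_nonneg_left h ht.le

theorem AK_tendsto : Tendsto (fun t => Real.sqrt t * Real.exp t * besselK0 t) atTop
    (𝓝 (Real.sqrt (Real.pi / 2))) := by
  rw [← gauss_half]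
  have h : Tendsto (fun t : ℝ => ∫ x in Set.Ioi (0:ℝ),
      Real.exp (-(t * (Real.cosh ((Real.sqrt t)⁻¹ * x) - 1)))) atTop
      (𝓝 (∫ x in Set.Ioi (0:ℝ), Real.exp (-(x ^ 2 / 2)))) := by
    refine tendsto_integral_filter_of_dominated_convergence
      (fun x => Real.exp (-(1 / 2 * x ^ 2))) ?_ ?_ (gauss_int (by norm_num)) ?_
    · exact Eventually.of_forall fun t => Continuous.aestronglyMeasurable (by fun_prop)
    · filter_upwards [eventually_gt_atTop 0] with t ht
      refine (ae_restrict_iff' measurableSet_Ioi).2 (Eventually.of_forall fun x hx => ?_)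
      rw [Real.norm_eq_abs, Real.abs_exp]
      exact AK_dom ht hx
    · refine Eventually.of_forall fun x => ?_
      have := scaled_limit (Real.cosh_zero ▸ Real.hasDerivAt_sinh 0) Real.sinh_zero x
      refine ((Real.continuous_exp.tendsto _).comp this.neg).congr fun t => ?_
      simp only [Function.comp, cosh_sub_one_eq]
  refine h.congr' ?_
  filter_upwards [eventually_gt_atTop 0] with t ht
  rw [AK_eq ht]

theorem AK_le {t : ℝ} (ht : 0 < t) :
    Real.sqrt t * Real.exp t * besselK0 t ≤ Real.sqrt (Real.pi / 2) := by
  rw [AK_eq ht, ← gauss_half]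
  have hi : IntegrableOn (fun x : ℝ => Real.exp (-(x ^ 2 / 2))) (Set.Ioi 0) := by
    refine (gauss_int (b := 1 / 2) (by norm_num)).congr (Eventually.of_forall fun x => ?_)
    ring_nf
  refine integral_mono_of_nonneg (Eventually.of_forall fun x => (Real.exp_pos _).le) hi ?_
  refine (ae_restrict_iff' measurableSet_Ioi).2 (Eventually.of_forall fun x hx => ?_)
  have := AK_dom ht hx
  simpa [div_eq_inv_mul] using this

theorem AI_eq {t : ℝ} (ht : 0 < t) : Real.sqrt t * Real.exp (-t) * besselI0 t =
    (1 / Real.pi) * ∫ x in Set.Ioi (0:ℝ), (Set.Ioc 0 Real.pi).indicator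
      (fun θ => Real.exp (-(t * (1 - Real.cos θ)))) ((Real.sqrt t)⁻¹ * x) := by
  have hs := Real.sqrt_pos.2 ht
  have := integral_comp_mul_left_Ioi ((Set.Ioc 0 Real.pi).indicator
      (fun θ => Real.exp (-(t * (1 - Real.cos θ))))) 0 (inv_pos.2 hs)
  rw [this, mul_zero, inv_inv, smul_eq_mul, besselI0,
    intervalIntegral.integral_of_le Real.pi_pos.le, setIntegral_indicator measurableSet_Ioc]
  rw [Set.inter_eq_right.2 Set.Ioc_subset_Ioi_self]
  have e : ∀ θ : ℝ, Real.exp (-(t * (1 - Real.cos θ))) =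
      Real.exp (-t) * Real.exp (t * Real.cos θ) := by
    intro θ; rw [← Real.exp_add]; ring_nf
  simp only [e]
  rw [integral_const_mul]
  ring

theorem AI_dom {t x : ℝ} (ht : 0 < t) (hx : 0 < x) :
    (Set.Ioc 0 Real.pi).indicator
      (fun θ => Real.exp (-(t * (1 - Real.cos θ)))) ((Real.sqrt t)⁻¹ * x)
      ≤ Real.exp (-(2 / Real.pi ^ 2 * x ^ 2)) := by
  have hs := Real.sqrt_pos.2 ht
  by_cases h : (Real.sqrt t)⁻¹ * x ∈ Set.Ioc 0 Real.pi
  · rw [Set.indicator_of_mem h]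
    have h1 := Real.cos_le_one_sub_mul_cos_sq (x := (Real.sqrt t)⁻¹ * x)
      (by rw [abs_of_pos h.1]; exact h.2)
    have h2 : t * (2 / Real.pi ^ 2 * ((Real.sqrt t)⁻¹ * x) ^ 2) = 2 / Real.pi ^ 2 * x ^ 2 := by
      rw [mul_pow, inv_pow, Real.sq_sqrt ht.le]; field_simp
    refine Real.exp_le_exp.2 (neg_le_neg ?_)
    rw [← h2]
    exact mul_le_mul_of_nonneg_left (by linarith) ht.le
  · rw [Set.indicator_of_notMem h]; positivity

theorem AI_nonneg {t x : ℝ} : 0 ≤ (Set.Ioc 0 Real.pi).indicator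
      (fun θ => Real.exp (-(t * (1 - Real.cos θ)))) ((Real.sqrt t)⁻¹ * x) :=
  Set.indicator_nonneg (fun _ _ => (Real.exp_pos _).le) _

theorem AI_meas {t : ℝ} : Measurable fun x => (Set.Ioc 0 Real.pi).indicator
      (fun θ => Real.exp (-(t * (1 - Real.cos θ)))) ((Real.sqrt t)⁻¹ * x) := by
  have : Measurable ((Set.Ioc 0 Real.pi).indicator
      (fun θ => Real.exp (-(t * (1 - Real.cos θ))))) :=
    Measurable.indicator (by fun_prop) measurableSet_Ioc
  exact this.comp (measurable_const_mul _)

theorem AI_tendsto : Tendsto (fun t => Real.sqrt t * Real.exp (-t) * besselI0 t) atTop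
    (𝓝 ((1 / Real.pi) * Real.sqrt (Real.pi / 2))) := by
  rw [← gauss_half]
  have h : Tendsto (fun t : ℝ => ∫ x in Set.Ioi (0:ℝ), (Set.Ioc 0 Real.pi).indicator
      (fun θ => Real.exp (-(t * (1 - Real.cos θ)))) ((Real.sqrt t)⁻¹ * x)) atTop
      (𝓝 (∫ x in Set.Ioi (0:ℝ), Real.exp (-(x ^ 2 / 2)))) := by
    have hp : 0 < 2 / Real.pi ^ 2 := by have := Real.pi_pos; positivity
    refine tendsto_integral_filter_of_dominated_convergence
      (fun x => Real.exp (-(2 / Real.pi ^ 2 * x ^ 2))) ?_ ?_ (gauss_int hp) ?_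
    · exact Eventually.of_forall fun t => AI_meas.aestronglyMeasurable
    · filter_upwards [eventually_gt_atTop 0] with t ht
      refine (ae_restrict_iff' measurableSet_Ioi).2 (Eventually.of_forall fun x hx => ?_)
      rw [Real.norm_eq_abs, abs_of_nonneg AI_nonneg]
      exact AI_dom ht hx
    · refine (ae_restrict_iff' measurableSet_Ioi).2 (Eventually.of_forall fun x hx => ?_)
      have hx' : (0:ℝ) < x := hx
      have := scaled_limit (Real.cos_zero ▸ Real.hasDerivAt_sin 0) Real.sin_zero x
      refine ((Real.continuous_exp.tendsto _).comp this.neg).congr' ?_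
      have hsm : Tendsto (fun t : ℝ => (Real.sqrt t)⁻¹ * x) atTop (𝓝 (0 * x)) :=
        (tendsto_inv_atTop_zero.comp Real.tendsto_sqrt_atTop).mul_const x
      rw [zero_mul] at hsm
      filter_upwards [eventually_gt_atTop 0, hsm.eventually_lt_const Real.pi_pos] with t ht h2
      have hs := Real.sqrt_pos.2 ht
      have hm : (Real.sqrt t)⁻¹ * x ∈ Set.Ioc 0 Real.pi := ⟨by positivity, h2.le⟩
      rw [Set.indicator_of_mem hm]
      simp only [Function.comp, one_sub_cos_eq]
  refine (h.const_mul (1 / Real.pi)).congr' ?_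
  filter_upwards [eventually_gt_atTop 0] with t ht
  rw [AI_eq ht]

theorem AI_le : ∃ C : ℝ, ∀ t : ℝ, 0 < t → Real.sqrt t * Real.exp (-t) * besselI0 t ≤ C := by
  have hp : 0 < 2 / Real.pi ^ 2 := by have := Real.pi_pos; positivity
  refine ⟨(1 / Real.pi) * ∫ x in Set.Ioi (0:ℝ), Real.exp (-(2 / Real.pi ^ 2 * x ^ 2)),
    fun t ht => ?_⟩
  rw [AI_eq ht]
  have := Real.pi_pos
  refine mul_le_mul_of_nonneg_left ?_ (by positivity)
  refine integral_mono_of_nonneg (Eventually.of_forall fun x => AI_nonneg) (gauss_int hp) ?_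
  exact (ae_restrict_iff' measurableSet_Ioi).2 (Eventually.of_forall fun x hx => AI_dom ht hx)

noncomputable def B0 (b : Bool) : ℝ → ℝ := if b then besselI0 else besselK0
noncomputable def B1 (b : Bool) (t : ℝ) : ℝ := if b then t * bI1 t else -(t * bK1 t)
noncomputable def sg (b : Bool) : ℝ := if b then -1 else 1

theorem hasDerivAt_B0 (b : Bool) {t : ℝ} (ht : 0 < t) : HasDerivAt (B0 b) (B1 b t / t) t := by
  cases b
  · refine (hasDerivAt_K0 ht).congr_deriv ?_
    simp only [B1]; simp; field_simp
  · refine (hasDerivAt_I0 t).congr_deriv ?_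
    simp only [B1]; simp; field_simp

theorem hasDerivAt_B1 (b : Bool) {t : ℝ} (ht : 0 < t) : HasDerivAt (B1 b) (t * B0 b t) t := by
  cases b
  · have := ((hasDerivAt_id t).mul (hasDerivAt_K1 ht)).neg
    refine (this.congr_deriv ?_)
    simp [B0]; field_simp; ring
  · have := ((hasDerivAt_id t).mul (hasDerivAt_I1 ht))
    refine (this.congr_deriv ?_)
    simp [B0]; field_simp; ring

noncomputable def om (t : ℝ) : ℝ := 1 + |Real.log t| + t

theorem om_ge {t : ℝ} (ht : 0 < t) : 1 ≤ om t := by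
  unfold om; have := abs_nonneg (Real.log t); linarith

theorem om_pos {t : ℝ} (ht : 0 < t) : 0 < om t := lt_of_lt_of_le one_pos (om_ge ht)

theorem om_mul {x t : ℝ} (hx : 0 < x) (ht : 0 < t) : om (x * t) ≤ om x * om t := by
  unfold om
  rw [Real.log_mul hx.ne' ht.ne']
  have h := abs_add_le (Real.log x) (Real.log t)
  have h1 := abs_nonneg (Real.log x)
  have h2 := abs_nonneg (Real.log t)
  have : 0 ≤ |Real.log x| * |Real.log t| := by positivity
  have : 0 ≤ |Real.log x| * t := by positivity
  have : 0 ≤ x * |Real.log t| := by positivity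
  nlinarith

theorem t_om_bound (p : ℕ) {δ : ℝ} (hδ : 0 < δ) :
    ∃ C : ℝ, 0 < C ∧ ∀ t : ℝ, 0 < t → t * om t ^ p ≤ C * Real.exp (δ * t) := by
  obtain ⟨C, hC, h⟩ := pow_le_exp_bound (p + 1) (half_pos hδ)
  refine ⟨p.factorial * Real.exp 2 + C * Real.exp (δ / 2), by positivity, fun t ht => ?_⟩
  rcases le_total t 1 with h1 | h1
  · have hl : Real.log t ≤ 0 := Real.log_nonpos ht.le h1
    have ho : om t ≤ 2 - Real.log t := by unfold om; rw [abs_of_nonpos hl]; linarith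
    have h3 := Real.pow_div_factorial_le_exp (2 - Real.log t) (by linarith) p
    rw [div_le_iff₀ (by positivity), Real.exp_sub, Real.exp_log ht] at h3
    have h4 : om t ^ p ≤ (2 - Real.log t) ^ p := pow_le_pow_left₀ (om_pos ht).le ho p
    have h5 : t * om t ^ p ≤ p.factorial * Real.exp 2 := by
      calc t * om t ^ p ≤ t * (Real.exp 2 / t * p.factorial) := by gcongr; exact h4.trans h3
        _ = _ := by field_simp
    have h6 : 1 ≤ Real.exp (δ * t) := Real.one_le_exp (by positivity)
    have : 0 ≤ C * Real.exp (δ / 2) := by positivity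
    have : 0 ≤ p.factorial * Real.exp 2 := by positivity
    nlinarith
  · have hl : 0 ≤ Real.log t := Real.log_nonneg h1
    have hl2 := Real.log_le_sub_one_of_pos ht
    have ho : om t ≤ 1 + 2 * t := by unfold om; rw [abs_of_nonneg hl]; linarith
    have h2 := h (1 + 2 * t) (by positivity)
    have : t * om t ^ p ≤ (1 + 2 * t) ^ (p + 1) := by
      rw [pow_succ, mul_comm]
      have := pow_le_pow_left₀ (om_pos ht).le ho p
      have h0 := om_pos ht
      gcongr
      linarith
    have h3 : Real.exp (δ / 2 * (1 + 2 * t)) = Real.exp (δ / 2) * Real.exp (δ * t) := by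
      rw [← Real.exp_add]; ring_nf
    rw [h3] at h2
    have : 0 ≤ p.factorial * Real.exp 2 * Real.exp (δ * t) := by positivity
    nlinarith

def Cls (c : ℝ) (h : ℝ → ℝ) : Prop :=
  ContinuousOn h (Set.Ioi 0) ∧ ∃ C : ℝ, ∃ p : ℕ, 0 ≤ C ∧
    ∀ t : ℝ, 0 < t → |h t| ≤ C * om t ^ p * Real.exp (-(c * t))

theorem Cls.mul {c d : ℝ} {f h : ℝ → ℝ} (hf : Cls c f) (hh : Cls d h) :
    Cls (c + d) (fun t => f t * h t) := by
  obtain ⟨f1, C, p, hC, f2⟩ := hf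
  obtain ⟨h1, D, q, hD, h2⟩ := hh
  refine ⟨f1.mul h1, C * D, p + q, by positivity, fun t ht => ?_⟩
  rw [abs_mul]
  have := om_pos ht
  calc |f t| * |h t| ≤ (C * om t ^ p * Real.exp (-(c * t))) * (D * om t ^ q * Real.exp (-(d * t))) :=
        mul_le_mul (f2 t ht) (h2 t ht) (abs_nonneg _) (by positivity)
    _ = _ := by
        rw [show -((c + d) * t) = -(c * t) + -(d * t) by ring, Real.exp_add, pow_add]; ring

theorem Cls.mul0 {c : ℝ} {f h : ℝ → ℝ} (hf : Cls 0 f) (hh : Cls c h) :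
    Cls c (fun t => f t * h t) := by
  have := hf.mul hh; rwa [zero_add] at this

theorem Cls.add {c : ℝ} {f h : ℝ → ℝ} (hf : Cls c f) (hh : Cls c h) :
    Cls c (fun t => f t + h t) := by
  obtain ⟨f1, C, p, hC, f2⟩ := hf
  obtain ⟨h1, D, q, hD, h2⟩ := hh
  refine ⟨f1.add h1, C + D, p + q, by positivity, fun t ht => (abs_add_le _ _).trans ?_⟩
  have h0 := om_ge ht
  have a1 : om t ^ p ≤ om t ^ (p + q) := pow_le_pow_right₀ h0 (by omega)
  have a2 : om t ^ q ≤ om t ^ (p + q) := pow_le_pow_right₀ h0 (by omega)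
  calc |f t| + |h t| ≤ (C * om t ^ p * Real.exp (-(c * t))) + (D * om t ^ q * Real.exp (-(c * t))) :=
        add_le_add (f2 t ht) (h2 t ht)
    _ ≤ (C * om t ^ (p + q) * Real.exp (-(c * t))) + (D * om t ^ (p + q) * Real.exp (-(c * t))) := by
        gcongr
    _ = _ := by ring

theorem Cls_const (a : ℝ) : Cls 0 (fun _ => a) :=
  ⟨continuousOn_const, |a|, 0, abs_nonneg _, fun t ht => by simp⟩

theorem Cls_id : Cls 0 (fun t => t) :=
  ⟨continuousOn_id, 1, 1, by norm_num, fun t ht => by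
    rw [abs_of_pos ht]; simp [om]; have := abs_nonneg (Real.log t); linarith⟩

theorem Cls.smul {c : ℝ} {h : ℝ → ℝ} (a : ℝ) (hh : Cls c h) : Cls c (fun t => a * h t) :=
  (Cls_const a).mul0 hh

theorem Cls.tmul {c : ℝ} {h : ℝ → ℝ} (hh : Cls c h) : Cls c (fun t => t * h t) :=
  Cls_id.mul0 hh

theorem Cls.sqmul {c : ℝ} {h : ℝ → ℝ} (hh : Cls c h) : Cls c (fun t => t ^ 2 * h t) := by
  have := hh.tmul.tmul
  have e : (fun t => t * (t * h t)) = fun t => t ^ 2 * h t := by funext t; ring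
  rwa [e] at this

theorem Cls.pow0 {h : ℝ → ℝ} {c : ℝ} (hh : Cls c h) (n : ℕ) : Cls (n * c) (fun t => h t ^ n) := by
  induction n with
  | zero => simpa using Cls_const 1
  | succ n ih =>
    have := ih.mul hh
    simp only [pow_succ]
    convert this using 1
    push_cast; ring

theorem Cls_B0 (b : Bool) : Cls (sg b) (B0 b) := by
  refine ⟨fun t ht => (hasDerivAt_B0 b ht).continuousAt.continuousWithinAt, ?_⟩
  cases b
  · refine ⟨(besselK0 1 + 1) * Real.exp 1, 1, mul_nonneg (add_nonneg (K0_nonneg _) zero_le_one) (Real.exp_pos _).le, fun t ht => ?_⟩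
    simp only [B0, sg]
    have hK := K0_nonneg 1
    rw [if_neg (by simp), if_neg (by simp), abs_of_nonneg (K0_nonneg t), one_mul, pow_one]
    rcases le_total t 1 with h1 | h1
    · have a := K0_le_small ht h1
      have hl : Real.log t ≤ 0 := Real.log_nonpos ht.le h1
      have e : 1 ≤ Real.exp 1 * Real.exp (-t) := by
        rw [← Real.exp_add]; exact Real.one_le_exp (by linarith)
      have : besselK0 1 - Real.log t ≤ (besselK0 1 + 1) * om t := by
        unfold om; rw [abs_of_nonpos hl]; nlinarith
      have h0 : 0 ≤ (besselK0 1 + 1) * om t := by have := om_pos ht; positivity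
      nlinarith
    · have a := K0_le_large h1
      have := om_ge ht
      have h0 : 0 < Real.exp 1 * Real.exp (-t) := by positivity
      have h2 : besselK0 1 ≤ (besselK0 1 + 1) * om t := by nlinarith
      nlinarith
  · refine ⟨1, 0, by norm_num, fun t ht => ?_⟩
    simp only [B0, sg]
    rw [if_pos trivial, if_pos trivial, abs_of_nonneg (I0_nonneg t)]
    simpa using I0_le ht.le

theorem Cls_B1 (b : Bool) : Cls (sg b) (B1 b) := by
  refine ⟨fun t ht => (hasDerivAt_B1 b ht).continuousAt.continuousWithinAt, 1, 1, by norm_num,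
    fun t ht => ?_⟩
  have ho : 1 + t ≤ om t := by unfold om; have := abs_nonneg (Real.log t); linarith
  cases b
  · simp only [B1, sg, Bool.false_eq_true, if_false, abs_neg, one_mul, pow_one]
    rw [abs_of_nonneg (mul_nonneg ht.le (K1_nonneg t)), mul_comm (om t)]
    refine (tK1_bounds ht).2.trans ?_
    gcongr
  · simp only [B1, sg, if_true, one_mul, pow_one, abs_mul, abs_of_pos ht, neg_mul, neg_neg]
    have := (I1_abs_le (t := t)).trans (I0_le ht.le)
    have h0 := om_pos ht
    gcongr
    linarith

theorem Cls.scale {s : ℝ} {F : ℝ → ℝ} (hF : Cls s F) {x : ℝ} (hx : 0 < x) :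
    Cls (s * x) (fun t => F (x * t)) := by
  obtain ⟨f1, C, p, hC, f2⟩ := hF
  refine ⟨f1.comp (by fun_prop) (fun t ht => mul_pos hx ht), C * om x ^ p, p,
    by have := om_pos hx; positivity, fun t ht => (f2 _ (mul_pos hx ht)).trans ?_⟩
  have h := om_mul hx ht
  have h0 := om_pos (mul_pos hx ht)
  calc C * om (x * t) ^ p * Real.exp (-(s * (x * t))) ≤
      C * (om x * om t) ^ p * Real.exp (-(s * (x * t))) := by gcongr
    _ = _ := by rw [mul_pow]; ring_nf

theorem Cls.bound {c : ℝ} {h : ℝ → ℝ} (hh : Cls c h) (hc : 0 < c) :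
    ∃ C δ : ℝ, 0 < δ ∧ 0 ≤ C ∧ ∀ t : ℝ, 0 < t → |h t * t| ≤ C * Real.exp (-(δ * t)) := by
  obtain ⟨h1, C, p, hC, h2⟩ := hh
  obtain ⟨D, hD, hb⟩ := t_om_bound p (half_pos hc)
  refine ⟨C * D, c / 2, half_pos hc, by positivity, fun t ht => ?_⟩
  rw [abs_mul, abs_of_pos ht]
  calc |h t| * t ≤ C * om t ^ p * Real.exp (-(c * t)) * t := by
        gcongr; exact h2 t ht
    _ = C * (t * om t ^ p) * Real.exp (-(c * t)) := by ring
    _ ≤ C * (D * Real.exp (c / 2 * t)) * Real.exp (-(c * t)) := by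
        gcongr C * ?_ * _; exact hb t ht
    _ = C * D * (Real.exp (c / 2 * t) * Real.exp (-(c * t))) := by ring
    _ = _ := by rw [← Real.exp_add]; ring_nf

theorem exp_int {δ : ℝ} (hδ : 0 < δ) (C : ℝ) :
    IntegrableOn (fun t => C * Real.exp (-(δ * t))) (Set.Ioi 0) := by
  have := (integrableOn_exp_mul_Ioi (a := -δ) (by linarith) 0).const_mul C
  simpa [IntegrableOn] using this

theorem Cls.integrable {c : ℝ} {h : ℝ → ℝ} (hh : Cls c h) (hc : 0 < c) :
    IntegrableOn (fun t => h t * t) (Set.Ioi 0) := by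
  obtain ⟨C, δ, hδ, hC, hb⟩ := hh.bound hc
  refine Integrable.mono' (exp_int hδ C) ?_ ?_
  · exact (hh.1.mul continuousOn_id).aestronglyMeasurable measurableSet_Ioi
  · refine (ae_restrict_iff' measurableSet_Ioi).2 (Eventually.of_forall fun t ht => ?_)
    exact hb t ht

theorem Cls.lim_zero {c : ℝ} {h : ℝ → ℝ} (hh : Cls c h) :
    Tendsto (fun t => h t * t ^ 2) (𝓝[>] 0) (𝓝 0) := by
  obtain ⟨h1, C, p, hC, h2⟩ := hh
  obtain ⟨D, hD, hb⟩ := t_om_bound p one_pos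
  have : Tendsto (fun t : ℝ => C * D * Real.exp (1 * t) * Real.exp (-(c * t)) * t) (𝓝[>] 0) (𝓝 0) := by
    have h : Continuous (fun t : ℝ => C * D * Real.exp (1 * t) * Real.exp (-(c * t)) * t) := by fun_prop
    have := h.tendsto 0
    simp only [mul_zero] at this
    exact this.mono_left nhdsWithin_le_nhds
  refine squeeze_zero_norm' ?_ this
  filter_upwards [self_mem_nhdsWithin] with t ht
  have ht : 0 < t := ht
  rw [Real.norm_eq_abs, abs_mul, abs_of_pos (by positivity : 0 < t ^ 2)]
  calc |h t| * t ^ 2 ≤ C * om t ^ p * Real.exp (-(c * t)) * t ^ 2 := by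
        gcongr; exact h2 t ht
    _ = C * (t * om t ^ p) * Real.exp (-(c * t)) * t := by ring
    _ ≤ C * (D * Real.exp (1 * t)) * Real.exp (-(c * t)) * t := by
        gcongr C * ?_ * _ * _; exact hb t ht
    _ = _ := by ring

theorem Cls.lim_zero1 {c : ℝ} {h : ℝ → ℝ} (hh : Cls c h) :
    Tendsto (fun t => t * h t) (𝓝[>] 0) (𝓝 0) := by
  obtain ⟨h1, C, p, hC, h2⟩ := hh
  have key : Tendsto (fun t : ℝ => (t * om t ^ (2 * p)) * t) (𝓝[>] 0) (𝓝 0) := by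
    obtain ⟨D, hD, hb⟩ := t_om_bound (2 * p) one_pos
    have : Tendsto (fun t : ℝ => D * Real.exp (1 * t) * t) (𝓝[>] 0) (𝓝 0) := by
      have h : Continuous (fun t : ℝ => D * Real.exp (1 * t) * t) := by fun_prop
      have := h.tendsto 0
      simp only [mul_zero] at this
      exact this.mono_left nhdsWithin_le_nhds
    refine squeeze_zero_norm' ?_ this
    filter_upwards [self_mem_nhdsWithin] with t ht
    have ht : 0 < t := ht
    have := om_pos ht
    rw [Real.norm_eq_abs, abs_of_pos (by positivity)]
    exact mul_le_mul_of_nonneg_right (hb t ht) ht.le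
  have key2 : Tendsto (fun t : ℝ => C * Real.sqrt ((t * om t ^ (2 * p)) * t) * Real.exp (-(c * t)))
      (𝓝[>] 0) (𝓝 0) := by
    have e : Tendsto (fun t : ℝ => Real.exp (-(c * t))) (𝓝[>] 0) (𝓝 (Real.exp (-(c * 0)))) :=
      ((by fun_prop : Continuous fun t : ℝ => Real.exp (-(c * t))).tendsto 0).mono_left nhdsWithin_le_nhds
    have := ((((Real.continuous_sqrt.tendsto _).comp key).const_mul C).mul e)
    simpa using this
  refine squeeze_zero_norm' ?_ key2
  filter_upwards [self_mem_nhdsWithin] with t ht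
  have ht : 0 < t := ht
  have := om_pos ht
  rw [show t * om t ^ (2 * p) * t = (t * om t ^ p) ^ 2 by ring, Real.sqrt_sq (by positivity),
    Real.norm_eq_abs, abs_mul, abs_of_pos ht]
  have := h2 t ht
  nlinarith

theorem Cls.lim_top {c : ℝ} {h : ℝ → ℝ} (hh : Cls c h) (hc : 0 < c) :
    Tendsto (fun t => h t * t ^ 2) atTop (𝓝 0) := by
  obtain ⟨C, δ, hδ, hC, hb⟩ := hh.tmul.bound hc
  have : Tendsto (fun t : ℝ => C * Real.exp (-(δ * t))) atTop (𝓝 (C * 0)) := by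
    refine Tendsto.const_mul C (Real.tendsto_exp_atBot.comp ?_)
    exact tendsto_neg_atTop_atBot.comp (tendsto_id.const_mul_atTop hδ)
  rw [mul_zero] at this
  refine squeeze_zero_norm' ?_ this
  filter_upwards [eventually_gt_atTop 0] with t ht
  refine le_of_eq_of_le ?_ (hb t ht)
  rw [Real.norm_eq_abs]; ring_nf

noncomputable def JJ (F h : ℝ → ℝ) (u : ℝ) : ℝ :=
  ∫ t in Set.Ioi (0:ℝ), F (Real.sqrt u * t) * h t * t

theorem JJ_cls {s c u : ℝ} {F h : ℝ → ℝ} (hF : Cls s F) (hh : Cls c h) (hu : 0 < u) :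
    Cls (s * Real.sqrt u + c) (fun t => F (Real.sqrt u * t) * h t) :=
  (hF.scale (Real.sqrt_pos.2 hu)).mul hh

theorem unif_bound {s c x0 : ℝ} {F h : ℝ → ℝ} (hF : Cls s F) (hh : Cls c h) (hx : 0 < x0)
    (hc : 0 < c + s * x0) : ∃ ε C δ : ℝ, 0 < ε ∧ ε < x0 ∧ 0 < δ ∧ 0 ≤ C ∧
      ∀ x ∈ Metric.ball x0 ε, ∀ t : ℝ, 0 < t → |F (x * t) * h t * t| ≤ C * Real.exp (-(δ * t)) := by
  obtain ⟨f1, C, p, hC, f2⟩ := hF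
  obtain ⟨h1, D, q, hD, h2⟩ := hh
  set e := c + s * x0 with he
  obtain ⟨E, hE, hb⟩ := t_om_bound (p + q) (δ := e / 4) (by positivity)
  set ε := min (x0 / 2) (e / (4 * (|s| + 1))) with hε
  have hs : 0 ≤ |s| := abs_nonneg s
  have hε0 : 0 < ε := by rw [hε]; exact lt_min (by positivity) (by positivity)
  have hεx : ε ≤ x0 / 2 := min_le_left _ _
  have hεs : |s| * ε ≤ e / 4 := by
    have h1 : ε ≤ e / (4 * (|s| + 1)) := min_le_right _ _
    rw [le_div_iff₀ (by positivity)] at h1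
    nlinarith
  have hcpt : ∃ M : ℝ, 0 ≤ M ∧ ∀ x ∈ Metric.ball x0 ε, om x ≤ M := by
    have hcont : ContinuousOn om (Set.Icc (x0 / 2) (2 * x0)) := by
      unfold om
      refine (continuousOn_const.add (ContinuousOn.abs ?_)).add continuousOn_id
      exact Real.continuousOn_log.mono fun x hx' => by
        have := hx'.1; simp; rintro rfl; linarith
    obtain ⟨M, hM⟩ := (isCompact_Icc.bddAbove_image hcont)
    refine ⟨max M 0, le_max_right _ _, fun x hx' => le_max_of_le_left (hM ⟨x, ?_, rfl⟩)⟩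
    rw [Metric.mem_ball, Real.dist_eq, abs_lt] at hx'
    constructor <;> linarith [hx'.1, hx'.2]
  obtain ⟨M, hM0, hM⟩ := hcpt
  refine ⟨ε, C * M ^ p * D * E, e / 2, hε0, by linarith, by positivity, by positivity,
    fun x hx' t ht => ?_⟩
  have hMx := hM x hx'
  rw [Metric.mem_ball, Real.dist_eq] at hx'
  have hx0 : 0 < x := by have := (abs_lt.1 hx').1; linarith
  have hot := om_pos ht
  have hox := om_pos hx0
  have hoxt := om_pos (mul_pos hx0 ht)
  rw [abs_mul, abs_mul, abs_of_pos ht]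
  have b1 : |F (x * t)| ≤ C * (M * om t) ^ p * Real.exp (-(s * (x * t))) := by
    refine (f2 _ (mul_pos hx0 ht)).trans ?_
    have := om_mul hx0 ht
    have : om (x * t) ≤ M * om t := this.trans (by gcongr)
    gcongr
  have hexp : Real.exp (-(s * (x * t))) * Real.exp (-(c * t)) ≤ Real.exp (-(3 * e / 4 * t)) := by
    rw [← Real.exp_add]
    apply Real.exp_le_exp.2
    have : |s * (x - x0)| ≤ e / 4 := by
      rw [abs_mul]; exact (mul_le_mul_of_nonneg_left hx'.le hs).trans hεs
    have h3 := (abs_le.1 this).1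
    have : 0 ≤ (s * (x - x0) + e / 4) * t := mul_nonneg (by linarith) ht.le
    nlinarith
  calc |F (x * t)| * |h t| * t
      ≤ (C * (M * om t) ^ p * Real.exp (-(s * (x * t)))) * (D * om t ^ q * Real.exp (-(c * t))) * t := by
        gcongr
        exact h2 t ht
    _ = C * M ^ p * D * (t * om t ^ (p + q)) * (Real.exp (-(s * (x * t))) * Real.exp (-(c * t))) := by
        rw [mul_pow, pow_add]; ring
    _ ≤ C * M ^ p * D * (E * Real.exp (e / 4 * t)) * Real.exp (-(3 * e / 4 * t)) := by
        gcongr C * M ^ p * D * ?_ * ?_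
        exact hb t ht
    _ = C * M ^ p * D * E * (Real.exp (e / 4 * t) * Real.exp (-(3 * e / 4 * t))) := by ring
    _ = _ := by rw [← Real.exp_add]; ring_nf

theorem JJ_deriv_x {s c x0 : ℝ} {F DF h : ℝ → ℝ} (hF : Cls s F) (hDF : Cls s DF)
    (hd : ∀ z, 0 < z → HasDerivAt F (DF z / z) z) (hh : Cls c h) (hx : 0 < x0)
    (hc : 0 < c + s * x0) :
    HasDerivAt (fun x => ∫ t in Set.Ioi (0:ℝ), F (x * t) * h t * t)
      ((∫ t in Set.Ioi (0:ℝ), DF (x0 * t) * h t * t) / x0) x0 := by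
  obtain ⟨ε, C, δ, hε, hεx, hδ, hC, hb⟩ := unif_bound hDF hh hx hc
  have hpos : ∀ x ∈ Metric.ball x0 ε, x0 - ε < x := fun x hx' => by
    rw [Metric.mem_ball, Real.dist_eq, abs_lt] at hx'; linarith [hx'.1]
  have hm : ∀ {G : ℝ → ℝ}, Cls s G → ∀ x, 0 < x → AEStronglyMeasurable
      (fun t => G (x * t) * h t * t) (volume.restrict (Set.Ioi 0)) := fun hG x hx' =>
    (((hG.scale hx').mul hh).1.mul continuousOn_id).aestronglyMeasurable measurableSet_Ioi
  have key := hasDerivAt_integral_of_dominated_loc_of_deriv_le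
    (μ := volume.restrict (Set.Ioi (0:ℝ))) (s := Metric.ball x0 ε) (x₀ := x0)
    (F := fun x t => F (x * t) * h t * t) (F' := fun x t => (DF (x * t) * h t * t) / x)
    (bound := fun t => (C / (x0 - ε)) * Real.exp (-(δ * t))) (Metric.ball_mem_nhds _ hε) ?_ ?_ ?_ ?_ ?_ ?_
  · refine key.2.congr_deriv ?_
    exact integral_div _ _
  · filter_upwards [lt_mem_nhds hx] with x hx'
    exact hm hF x hx'
  · exact ((hF.scale hx).mul hh).integrable (by linarith)
  · exact (hm hDF x0 hx).mul_const _
  · refine (ae_restrict_iff' measurableSet_Ioi).2 (Eventually.of_forall fun t ht x hx' => ?_)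
    have h1 := hpos x hx'
    rw [Real.norm_eq_abs, abs_div, abs_of_pos (by linarith : 0 < x), div_mul_eq_mul_div]
    have := hb x hx' t ht
    have h2 : 0 < x0 - ε := by linarith
    gcongr
  · exact exp_int hδ _
  · refine (ae_restrict_iff' measurableSet_Ioi).2 (Eventually.of_forall fun t ht x hx' => ?_)
    have h1 := hpos x hx'
    have hx0 : 0 < x := by linarith
    have ht : 0 < t := ht
    have h3 : HasDerivAt (fun x => x * t) (1 * t) x := (hasDerivAt_id x).mul_const t
    have h2 := (((hd (x * t) (mul_pos hx0 ht)).comp x h3).mul_const (h t)).mul_const t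
    refine h2.congr_deriv ?_
    field_simp

theorem JJ_deriv {s c u : ℝ} {F DF h : ℝ → ℝ} (hF : Cls s F) (hDF : Cls s DF)
    (hd : ∀ z, 0 < z → HasDerivAt F (DF z / z) z) (hh : Cls c h) (hu : 0 < u)
    (hc : 0 < c + s * Real.sqrt u) :
    HasDerivAt (JJ F h) (JJ DF h u / (2 * u)) u := by
  have hs := Real.sqrt_pos.2 hu
  have h1 := JJ_deriv_x hF hDF hd hh hs hc
  have h2 := h1.comp u (Real.hasDerivAt_sqrt hu.ne')
  refine h2.congr_deriv ?_
  unfold JJ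
  rw [div_mul_eq_mul_div, mul_one_div, div_div]
  congr 1
  linear_combination 2 * Real.mul_self_sqrt hu.le

def DCls (c : ℝ) (h Dh : ℝ → ℝ) : Prop :=
  Cls c h ∧ Cls c Dh ∧ ∀ t, 0 < t → HasDerivAt h (Dh t / t) t

theorem JJ_ibp {s c u : ℝ} {F DF h Dh : ℝ → ℝ} (hF : DCls s F DF) (hh : DCls c h Dh) (hu : 0 < u)
    (hc : 0 < c + s * Real.sqrt u) :
    JJ DF h u = -JJ F (fun t => Dh t + 2 * h t) u := by
  have hs := Real.sqrt_pos.2 hu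
  have i1 := (JJ_cls hF.2.1 hh.1 hu).integrable (by linarith)
  have i2 := (JJ_cls hF.1 (hh.2.1.add (hh.1.smul 2)) hu).integrable (by linarith)
  have key := ftc_Ioi (f := fun t => F (Real.sqrt u * t) * h t * t ^ 2)
    (f' := fun t => DF (Real.sqrt u * t) * h t * t + F (Real.sqrt u * t) * (Dh t + 2 * h t) * t)
    (l := 0) (m := 0) ?_ (i1.add i2) (JJ_cls hF.1 hh.1 hu).lim_zero
    ((JJ_cls hF.1 hh.1 hu).lim_top (by linarith))
  · rw [integral_add i1 i2] at key
    unfold JJ; linarith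
  · intro t ht
    have ht : 0 < t := ht
    have h3 : HasDerivAt (fun t => Real.sqrt u * t) (Real.sqrt u * 1) t := (hasDerivAt_id t).const_mul _
    have h2 := (((hF.2.2 _ (mul_pos hs ht)).comp t h3).mul (hh.2.2 t ht)).mul (hasDerivAt_pow 2 t)
    refine h2.congr_deriv ?_
    simp [Function.comp]
    field_simp
    ring

theorem DCls_B0 (b : Bool) : DCls (sg b) (B0 b) (B1 b) :=
  ⟨Cls_B0 b, Cls_B1 b, fun _ ht => hasDerivAt_B0 b ht⟩

theorem DCls_B1 (b : Bool) : DCls (sg b) (B1 b) (fun t => t ^ 2 * B0 b t) :=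
  ⟨Cls_B1 b, (Cls_B0 b).sqmul, fun t ht => (hasDerivAt_B1 b ht).congr_deriv (by field_simp)⟩

noncomputable def J0 (b : Bool) (h : ℝ → ℝ) : ℝ → ℝ := JJ (B0 b) h
noncomputable def J1 (b : Bool) (h : ℝ → ℝ) : ℝ → ℝ := JJ (B1 b) h

def Reg (b : Bool) (c : ℝ) : Set ℝ := {u | 0 < u ∧ 0 < c + sg b * Real.sqrt u}

theorem Reg_open (b : Bool) (c : ℝ) : IsOpen (Reg b c) :=
  (isOpen_lt continuous_const continuous_id).inter
    (isOpen_lt continuous_const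
      (continuous_const.add (continuous_const.mul Real.continuous_sqrt)))

theorem JJ_sq (b : Bool) (h : ℝ → ℝ) {u : ℝ} (hu : 0 < u) :
    JJ (fun t => t ^ 2 * B0 b t) h u = u * J0 b (fun t => t ^ 2 * h t) u := by
  unfold J0 JJ
  rw [← integral_const_mul]
  congr 1
  ext t
  beta_reduce
  rw [mul_pow, Real.sq_sqrt hu.le]; ring

theorem J0_deriv {b : Bool} {c u : ℝ} {h : ℝ → ℝ} (hh : Cls c h) (hu : u ∈ Reg b c) :
    HasDerivAt (J0 b h) (J1 b h u / (2 * u)) u :=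
  JJ_deriv (Cls_B0 b) (Cls_B1 b) (DCls_B0 b).2.2 hh hu.1 hu.2

theorem J1_deriv {b : Bool} {c u : ℝ} {h : ℝ → ℝ} (hh : Cls c h) (hu : u ∈ Reg b c) :
    HasDerivAt (J1 b h) (J0 b (fun t => t ^ 2 * h t) u / 2) u := by
  refine (JJ_deriv (Cls_B1 b) (Cls_B0 b).sqmul (DCls_B1 b).2.2 hh hu.1 hu.2).congr_deriv ?_
  rw [JJ_sq b h hu.1]
  have := hu.1
  field_simp

theorem J_ibp {b : Bool} {c u : ℝ} {h Dh : ℝ → ℝ} (hh : DCls c h Dh) (hu : u ∈ Reg b c) :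
    J1 b h u = -J0 b (fun t => Dh t + 2 * h t) u :=
  JJ_ibp (DCls_B0 b) hh hu.1 hu.2

theorem J_ibp1 {b : Bool} {c u : ℝ} {h Dh : ℝ → ℝ} (hh : DCls c h Dh) (hu : u ∈ Reg b c) :
    u * J0 b (fun t => t ^ 2 * h t) u = -J1 b (fun t => Dh t + 2 * h t) u := by
  rw [← JJ_sq b h hu.1]
  exact JJ_ibp (DCls_B1 b) hh hu.1 hu.2

theorem J_smooth_nat (b : Bool) (c : ℝ) (m : ℕ) : ∀ h : ℝ → ℝ, Cls c h →
    ContDiffOn ℝ m (J0 b h) (Reg b c) ∧ ContDiffOn ℝ m (J1 b h) (Reg b c) := by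
  induction m with
  | zero =>
    intro h hh
    simp only [Nat.cast_zero, contDiffOn_zero]
    exact ⟨fun u hu => (J0_deriv hh hu).continuousAt.continuousWithinAt,
      fun u hu => (J1_deriv hh hu).continuousAt.continuousWithinAt⟩
  | succ m ih =>
    intro h hh
    have e : ((m + 1 : ℕ) : WithTop ℕ∞) = (m : WithTop ℕ∞) + 1 := by push_cast; rfl
    rw [e, contDiffOn_succ_iff_deriv_of_isOpen (Reg_open b c),
      contDiffOn_succ_iff_deriv_of_isOpen (Reg_open b c)]
    refine ⟨⟨fun u hu => (J0_deriv hh hu).differentiableAt.differentiableWithinAt, by simp, ?_⟩,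
      ⟨fun u hu => (J1_deriv hh hu).differentiableAt.differentiableWithinAt, by simp, ?_⟩⟩
    · refine ContDiffOn.congr (f := fun u => J1 b h u / (2 * u)) ?_ fun u hu => (J0_deriv hh hu).deriv
      refine (ih h hh).2.div (by fun_prop) fun u hu => ?_
      have := hu.1; positivity
    · refine ContDiffOn.congr (f := fun u => J0 b (fun t => t ^ 2 * h t) u / 2) ?_
        fun u hu => (J1_deriv hh hu).deriv
      exact (ih _ hh.sqmul).1.div_const 2

theorem J0_smooth {b : Bool} {c : ℝ} {h : ℝ → ℝ} (hh : Cls c h) :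
    ContDiffOn ℝ (⊤ : ℕ∞) (J0 b h) (Reg b c) :=
  contDiffOn_infty.2 fun m => (J_smooth_nat b c m h hh).1

theorem J1_smooth {b : Bool} {c : ℝ} {h : ℝ → ℝ} (hh : Cls c h) :
    ContDiffOn ℝ (⊤ : ℕ∞) (J1 b h) (Reg b c) :=
  contDiffOn_infty.2 fun m => (J_smooth_nat b c m h hh).2

theorem J0_add {b : Bool} {c u : ℝ} {f h : ℝ → ℝ} (hf : Cls c f) (hh : Cls c h) (hu : u ∈ Reg b c) :
    J0 b (fun t => f t + h t) u = J0 b f u + J0 b h u := by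
  unfold J0 JJ
  rw [← integral_add ((JJ_cls (Cls_B0 b) hf hu.1).integrable (by linarith [hu.2]))
    ((JJ_cls (Cls_B0 b) hh hu.1).integrable (by linarith [hu.2]))]
  congr 1; ext t; ring

theorem J0_smul {b : Bool} {u : ℝ} (a : ℝ) (h : ℝ → ℝ) :
    J0 b (fun t => a * h t) u = a * J0 b h u := by
  unfold J0 JJ
  rw [← integral_const_mul]
  congr 1; ext t; ring

theorem J0_congr {b : Bool} {u : ℝ} {f h : ℝ → ℝ} (hf : ∀ t, 0 < t → f t = h t) :
    J0 b f u = J0 b h u := by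
  unfold J0 JJ
  refine setIntegral_congr_fun measurableSet_Ioi fun t ht => ?_
  simp only [hf t ht]

theorem Cls.congr {c : ℝ} {f h : ℝ → ℝ} (hh : Cls c h) (e : ∀ t, 0 < t → f t = h t) : Cls c f := by
  obtain ⟨h1, C, p, hC, h2⟩ := hh
  exact ⟨h1.congr fun t ht => e t ht, C, p, hC, fun t ht => by rw [e t ht]; exact h2 t ht⟩

theorem Cls.lim_top0 {c : ℝ} {h : ℝ → ℝ} (hh : Cls c h) (hc : 0 < c) :
    Tendsto h atTop (𝓝 0) := by
  refine squeeze_zero_norm' ?_ (tendsto_zero_iff_abs_tendsto_zero _ |>.1 (hh.lim_top hc))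
  filter_upwards [eventually_ge_atTop 1] with t ht
  simp only [Function.comp, Real.norm_eq_abs, abs_mul]
  rw [abs_of_nonneg (by positivity : 0 ≤ t ^ 2)]
  have := abs_nonneg (h t)
  have : 1 ≤ t ^ 2 := by nlinarith
  nlinarith

noncomputable def SS : List Bool → ℕ → ℝ → ℝ
  | [], 0 => fun _ => 1
  | [], (_ + 1) => fun _ => 0
  | (b :: l), 0 => fun t => B0 b t * SS l 0 t
  | (b :: l), (m + 1) => fun t => B0 b t * SS l (m + 1) t + B1 b t * SS l m t

noncomputable def cl (l : List Bool) : ℝ := (l.map sg).sum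

theorem cl_cons (b : Bool) (l : List Bool) : cl (b :: l) = sg b + cl l := by simp [cl]

theorem SS_cls (l : List Bool) : ∀ m, Cls (cl l) (SS l m) := by
  induction l with
  | nil =>
    intro m
    cases m <;> simpa [cl, SS] using Cls_const _
  | cons b l ih =>
    intro m
    rw [cl_cons]
    cases m with
    | zero => exact (Cls_B0 b).mul (ih 0)
    | succ m => exact ((Cls_B0 b).mul (ih (m + 1))).add ((Cls_B1 b).mul (ih m))

noncomputable def DSS (l : List Bool) : ℕ → ℝ → ℝ
  | 0 => SS l 1
  | (m + 1) => fun t => (m + 2) * SS l (m + 2) t + (l.length - m) * (t ^ 2 * SS l m t)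

theorem SS_deriv (l : List Bool) : ∀ m, ∀ t, 0 < t → HasDerivAt (SS l m) (DSS l m t / t) t := by
  induction l with
  | nil =>
    intro m t ht
    match m with
    | 0 => simpa [SS, DSS] using hasDerivAt_const t (1:ℝ)
    | 1 => simpa [SS, DSS] using hasDerivAt_const t (0:ℝ)
    | (m+2) => simpa [SS, DSS] using hasDerivAt_const t (0:ℝ)
  | cons b l ih =>
    intro m t ht
    match m with
    | 0 =>
      refine ((hasDerivAt_B0 b ht).mul (ih 0 t ht)).congr_deriv ?_
      simp only [DSS, SS]; ring
    | 1 =>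
      refine (((hasDerivAt_B0 b ht).mul (ih 1 t ht)).add
        ((hasDerivAt_B1 b ht).mul (ih 0 t ht))).congr_deriv ?_
      simp only [DSS, SS, List.length_cons]; push_cast; field_simp; ring
    | (m+2) =>
      refine (((hasDerivAt_B0 b ht).mul (ih (m+2) t ht)).add
        ((hasDerivAt_B1 b ht).mul (ih (m+1) t ht))).congr_deriv ?_
      simp only [DSS, SS, List.length_cons]; push_cast; field_simp; ring

theorem SS_zero (l : List Bool) : ∀ m, l.length < m → SS l m = fun _ => 0 := by
  induction l with
  | nil =>
    intro m hm
    cases m with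
    | zero => simp at hm
    | succ m => rfl
  | cons b l ih =>
    intro m hm
    cases m with
    | zero => simp at hm
    | succ m =>
      simp only [List.length_cons] at hm
      simp only [SS, ih (m+1) (by omega), ih m (by omega)]
      simp

inductive Md (l : List Bool) : (ℝ → ℝ) → Prop
  | S (m : ℕ) : Md l (SS l m)
  | add {f h : ℝ → ℝ} : Md l f → Md l h → Md l (fun t => f t + h t)
  | smul (a : ℝ) {h : ℝ → ℝ} : Md l h → Md l (fun t => a * h t)
  | sq {h : ℝ → ℝ} : Md l h → Md l (fun t => t ^ 2 * h t)
  | congr {f h : ℝ → ℝ} : Md l h → (∀ t, 0 < t → f t = h t) → Md l f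

theorem Md.cls {l : List Bool} {h : ℝ → ℝ} (hh : Md l h) : Cls (cl l) h := by
  induction hh with
  | S m => exact SS_cls l m
  | add _ _ h1 h2 => exact h1.add h2
  | smul a _ h => exact h.smul a
  | sq _ h => exact h.sqmul
  | congr _ e h => exact h.congr e

theorem Md_DSS (l : List Bool) (m : ℕ) : Md l (DSS l m) := by
  cases m with
  | zero => exact Md.S 1
  | succ m => exact ((Md.S _).smul _).add ((Md.S _).sq.smul _)

theorem Md.deriv {l : List Bool} {h : ℝ → ℝ} (hh : Md l h) :
    ∃ Dh, Md l Dh ∧ ∀ t, 0 < t → HasDerivAt h (Dh t / t) t := by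
  induction hh with
  | S m => exact ⟨DSS l m, Md_DSS l m, SS_deriv l m⟩
  | add _ _ h1 h2 =>
    obtain ⟨D1, a1, b1⟩ := h1
    obtain ⟨D2, a2, b2⟩ := h2
    exact ⟨_, a1.add a2, fun t ht => ((b1 t ht).add (b2 t ht)).congr_deriv (by ring)⟩
  | smul a _ h =>
    obtain ⟨D1, a1, b1⟩ := h
    exact ⟨_, a1.smul a, fun t ht => ((b1 t ht).const_mul a).congr_deriv (by ring)⟩
  | @sq h0 hm h =>
    obtain ⟨D1, a1, b1⟩ := h
    refine ⟨_, a1.sq.add (hm.sq.smul 2), fun t ht =>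
      ((hasDerivAt_pow 2 t).mul (b1 t ht)).congr_deriv ?_⟩
    field_simp; ring
  | congr _ e h =>
    obtain ⟨D1, a1, b1⟩ := h
    refine ⟨D1, a1, fun t ht => (b1 t ht).congr_of_eventuallyEq ?_⟩
    filter_upwards [lt_mem_nhds ht] with s hs using e s hs

noncomputable def DD (h : ℝ → ℝ) (t : ℝ) : ℝ := t * deriv h t

theorem Md.DD {l : List Bool} {h : ℝ → ℝ} (hh : Md l h) : Md l (DD h) := by
  obtain ⟨Dh, a, b⟩ := hh.deriv
  refine a.congr fun t ht => ?_
  rw [_root_.DD, (b t ht).deriv]; field_simp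

theorem Md.hasDeriv {l : List Bool} {h : ℝ → ℝ} (hh : Md l h) (t : ℝ) (ht : 0 < t) :
    HasDerivAt h (_root_.DD h t / t) t := by
  obtain ⟨Dh, a, b⟩ := hh.deriv
  refine (b t ht).congr_deriv ?_
  rw [_root_.DD, (b t ht).deriv]; field_simp

theorem Md.dcls {l : List Bool} {h : ℝ → ℝ} (hh : Md l h) : DCls (cl l) h (_root_.DD h) :=
  ⟨hh.cls, hh.DD.cls, hh.hasDeriv⟩

noncomputable def RR (l : List Bool) : ℕ → ℝ → ℝ
  | 0 => fun _ => 0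
  | 1 => fun _ => 0
  | (m + 2) => fun t => (1 / (m + 2 : ℝ)) *
      ((DD (RR l (m + 1)) t + 2 * RR l (m + 1) t) + (-(l.length - m : ℝ)) * SS l m t)

theorem Md_zero (l : List Bool) : Md l (fun _ => 0) :=
  ((Md.S 0).smul 0).congr (by simp)

theorem Md_RR (l : List Bool) : ∀ m, Md l (RR l m)
  | 0 => Md_zero l
  | 1 => Md_zero l
  | (m + 2) => by
    have ih := Md_RR l (m + 1)
    exact ((ih.DD.add (ih.smul 2)).add ((Md.S m).smul _)).smul _

noncomputable def GG (l : List Bool) (m : ℕ) (t : ℝ) : ℝ :=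
  m.factorial * (SS l m t + (-1) * (t ^ 2 * RR l m t))

theorem Md_GG (l : List Bool) (m : ℕ) : Md l (GG l m) :=
  ((Md.S m).add ((Md_RR l m).sq.smul _)).smul _

theorem GG_deriv (l : List Bool) (m : ℕ) (t : ℝ) (ht : 0 < t) :
    HasDerivAt (GG l m) (GG l (m + 1) t / t) t := by
  have h := ((SS_deriv l m t ht).add (((hasDerivAt_pow 2 t).mul
    ((Md_RR l m).hasDeriv t ht)).const_mul (-1))).const_mul (m.factorial : ℝ)
  refine h.congr_deriv ?_
  cases m with
  | zero => simp [GG, RR, DSS, DD]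
  | succ m =>
    simp only [GG, DSS, RR, Nat.factorial_succ (m + 1)]
    push_cast; field_simp; ring

theorem DD_GG (l : List Bool) (m : ℕ) (t : ℝ) (ht : 0 < t) : DD (GG l m) t = GG l (m + 1) t := by
  rw [DD, (GG_deriv l m t ht).deriv]; field_simp

noncomputable def al (l : List Bool) (b : Bool) (m : ℕ) (u : ℝ) : ℝ := J0 b (SS l m) u
noncomputable def aa (l : List Bool) (b : Bool) (m : ℕ) (u : ℝ) : ℝ :=
  J0 b (RR l (m + 2)) u + u * J0 b (GG l m) u / (m + 2).factorial

/-- `2u d/du J0(h) = -J0((D+2)h)`. -/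
theorem J0_theta {l : List Bool} {b : Bool} {h : ℝ → ℝ} {u : ℝ} (hh : Md l h) (hu : u ∈ Reg b (cl l)) :
    2 * u * deriv (J0 b h) u = -(J0 b (DD h) u + 2 * J0 b h u) := by
  rw [(J0_deriv hh.cls hu).deriv, J_ibp hh.dcls hu, J0_add hh.DD.cls (hh.cls.smul 2) hu, J0_smul]
  have := hu.1
  field_simp

theorem J0_theta_inv {l : List Bool} {b : Bool} {h : ℝ → ℝ} {u : ℝ} (hh : Md l h)
    (hu : u ∈ Reg b (cl l)) :
    2 * deriv (J0 b (fun t => DD h t + 2 * h t)) u = -J0 b (fun t => t ^ 2 * h t) u := by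
  have h1 := J_ibp1 hh.dcls hu
  rw [(J0_deriv (hh.DD.add (hh.smul 2)).cls hu).deriv]
  have := hu.1
  field_simp
  linarith

theorem J0_diff {l : List Bool} {b : Bool} {h : ℝ → ℝ} {u : ℝ} (hh : Md l h)
    (hu : u ∈ Reg b (cl l)) : HasDerivAt (J0 b h) (deriv (J0 b h) u) u :=
  (J0_deriv hh.cls hu).differentiableAt.hasDerivAt

theorem uJ0G_deriv {l : List Bool} {b : Bool} {u : ℝ} (m : ℕ) (hu : u ∈ Reg b (cl l)) :
    HasDerivAt (fun u => u * J0 b (GG l m) u) (-J0 b (GG l (m + 1)) u / 2) u := by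
  have h := (hasDerivAt_id u).mul (J0_diff (Md_GG l m) hu)
  refine h.congr_deriv ?_
  have h2 := J0_theta (Md_GG l m) hu
  rw [J0_congr (DD_GG l m)] at h2
  simp only [id]
  linarith

theorem aa_deriv {l : List Bool} {b : Bool} {u : ℝ} (m : ℕ) (hu : u ∈ Reg b (cl l)) :
    HasDerivAt (aa l b m) (deriv (J0 b (RR l (m + 2))) u
      + (-J0 b (GG l (m + 1)) u / 2) / (m + 2).factorial) u :=
  (J0_diff (Md_RR l (m + 2)) hu).add ((uJ0G_deriv m hu).div_const _)

theorem RR_rec (l : List Bool) (m : ℕ) (t : ℝ) : DD (RR l (m + 1)) t + 2 * RR l (m + 1) t =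
    (l.length - m) * SS l m t + (m + 2) * RR l (m + 2) t := by
  simp only [RR]
  field_simp
  ring

theorem al_rec {l : List Bool} {b : Bool} {u : ℝ} (m : ℕ) (hu : u ∈ Reg b (cl l)) :
    al l b (m + 1) u = -2 * (l.length - m) * deriv (al l b m) u - 2 * (m + 2) * deriv (aa l b m) u := by
  rw [(aa_deriv m hu).deriv]
  have h1 := J0_theta_inv (Md_RR l (m + 1)) hu
  have e : (fun t => DD (RR l (m + 1)) t + 2 * RR l (m + 1) t) = fun t =>
    (l.length - m) * SS l m t + (m + 2) * RR l (m + 2) t := funext fun t => RR_rec l m t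
  have h2 : HasDerivAt (J0 b (fun t => (l.length - m) * SS l m t + (m + 2) * RR l (m + 2) t))
      ((l.length - m) * deriv (al l b m) u + (m + 2) * deriv (J0 b (RR l (m + 2))) u) u := by
    have := ((J0_diff (Md.S m) hu).const_mul (l.length - m : ℝ)).add
      ((J0_diff (Md_RR l (m + 2)) hu).const_mul (m + 2 : ℝ))
    refine this.congr_of_eventuallyEq ?_
    filter_upwards [(Reg_open b (cl l)).mem_nhds hu] with v hv
    rw [J0_add ((Md.S m).smul _).cls ((Md_RR l (m+2)).smul _).cls hv, J0_smul, J0_smul]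
    rfl
  rw [e, h2.deriv] at h1
  have h3 : J0 b (GG l (m + 1)) u = (m + 1).factorial * (al l b (m + 1) u +
      (-1) * J0 b (fun t => t ^ 2 * RR l (m + 1) t) u) := by
    unfold GG
    rw [J0_smul, J0_add (SS_cls l _) ((Md_RR l _).sq.smul _).cls hu, J0_smul]
    rfl
  rw [h3, Nat.factorial_succ (m + 1)]
  have : ((m + 1).factorial : ℝ) ≠ 0 := by positivity
  push_cast
  have h4 : (m + 2 : ℝ) ≠ 0 := by positivity
  have e5 : 2 * (m + 2 : ℝ) * (deriv (J0 b (RR l (m + 2))) u +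
      (-(((m + 1).factorial : ℝ) * (al l b (m + 1) u + (-1) * J0 b (fun t => t ^ 2 * RR l (m + 1) t) u)) / 2) /
        ((m + 1 + 1) * (m + 1).factorial)) = 2 * (m + 2) * deriv (J0 b (RR l (m + 2))) u -
        (al l b (m + 1) u + (-1) * J0 b (fun t => t ^ 2 * RR l (m + 1) t) u) := by
    have h5 : (m + 1 + 1 : ℝ) = m + 2 := by ring
    rw [h5]
    field_simp
    ring
  rw [e5]
  linarith

theorem aa_rec {l : List Bool} {b : Bool} {u : ℝ} (m : ℕ) (hu : u ∈ Reg b (cl l)) :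
    (m + 3) * aa l b (m + 1) u = -2 * u * deriv (aa l b m) u - (l.length - m - 1) * al l b (m + 1) u := by
  rw [(aa_deriv m hu).deriv]
  have h1 := J0_theta (Md_RR l (m + 2)) hu
  have h2 : J0 b (DD (RR l (m + 2))) u + 2 * J0 b (RR l (m + 2)) u =
      (l.length - m - 1) * al l b (m + 1) u + (m + 3) * J0 b (RR l (m + 3)) u := by
    have e := J0_congr (b := b) (u := u) (fun t _ => RR_rec l (m + 1) t)
    rw [J0_add (Md_RR l _).DD.cls ((Md_RR l _).smul _).cls hu,
      J0_add ((Md.S _).smul _).cls ((Md_RR l _).smul _).cls hu, J0_smul, J0_smul, J0_smul] at e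
    rw [e, al]; push_cast; ring
  rw [h2] at h1
  have e3 : -2 * u * (deriv (J0 b (RR l (m + 2))) u + -J0 b (GG l (m + 1)) u / 2 / (m + 2).factorial)
    = -(2 * u * deriv (J0 b (RR l (m + 2))) u) + u * J0 b (GG l (m + 1)) u / (m + 2).factorial := by ring
  rw [e3, h1]
  unfold aa
  rw [Nat.factorial_succ (m + 2)]
  push_cast
  have : (m + 3 : ℝ) ≠ 0 := by positivity
  have h5 : (m + 2 + 1 : ℝ) = m + 3 := by ring
  rw [h5]
  field_simp
  ring

theorem aa_zero {l : List Bool} {b : Bool} {u : ℝ} :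
    aa l b 0 u = (u - l.length) / 2 * al l b 0 u := by
  unfold aa
  have h1 : J0 b (RR l (0 + 2)) u = -(l.length / 2) * al l b 0 u := by
    rw [al, ← J0_smul]
    refine J0_congr fun t ht => ?_
    simp [RR, DD]; ring
  have h2 : J0 b (GG l 0) u = al l b 0 u := by
    rw [al]
    refine J0_congr fun t ht => ?_
    simp [GG, RR]
  rw [h1, h2]; simp [Nat.factorial]; ring

theorem aa_last {l : List Bool} {b : Bool} {u L : ℝ} {n : ℕ} (hl : l.length = n + 1)
    (hu : u ∈ Reg b (cl l))
    (hL : Tendsto (fun t => B0 b (Real.sqrt u * t) * GG l (n + 1) t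
      - B1 b (Real.sqrt u * t) * GG l n t) (𝓝[>] 0) (𝓝 L)) :
    (n + 2).factorial * aa l b n u = L := by
  have hs := Real.sqrt_pos.2 hu.1
  have c1 := JJ_cls (Cls_B0 b) (Md_RR l (n + 2)).cls hu.1
  have c2 := JJ_cls (Cls_B0 b) (Md_GG l n).cls hu.1
  have hpos : 0 < sg b * Real.sqrt u + cl l := by linarith [hu.2]
  have hfac : ((n + 2).factorial : ℝ) ≠ 0 := by positivity
  have i1 := (c1.smul (-((n + 2).factorial : ℝ))).integrable hpos
  have i2 := (c2.smul (-u)).integrable hpos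
  have htop : Tendsto (fun t => B0 b (Real.sqrt u * t) * GG l (n + 1) t
      - B1 b (Real.sqrt u * t) * GG l n t) atTop (𝓝 0) := by
    have := ((JJ_cls (Cls_B0 b) (Md_GG l (n+1)).cls hu.1).lim_top0 hpos).sub
      ((JJ_cls (Cls_B1 b) (Md_GG l n).cls hu.1).lim_top0 hpos)
    simpa using this
  have key := ftc_Ioi (f := fun t => B0 b (Real.sqrt u * t) * GG l (n + 1) t
      - B1 b (Real.sqrt u * t) * GG l n t) (l := L) (m := 0) ?_ (i1.add i2) hL htop
  · simp only [Pi.add_apply] at key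
    rw [integral_add i1 i2] at key
    have e1 : ∫ t in Set.Ioi (0:ℝ), -((n + 2).factorial : ℝ) * (B0 b (Real.sqrt u * t) * RR l (n + 2) t) * t
        = -((n + 2).factorial : ℝ) * J0 b (RR l (n + 2)) u := by
      unfold J0 JJ; rw [← integral_const_mul]; congr 1; ext t; ring
    have e2 : ∫ t in Set.Ioi (0:ℝ), -u * (B0 b (Real.sqrt u * t) * GG l n t) * t
        = -u * J0 b (GG l n) u := by
      unfold J0 JJ; rw [← integral_const_mul]; congr 1; ext t; ring
    rw [e1, e2] at key
    unfold aa
    field_simp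
    linarith
  · intro t ht
    have ht : 0 < t := ht
    have h3 : HasDerivAt (fun t => Real.sqrt u * t) (Real.sqrt u * 1) t := (hasDerivAt_id t).const_mul _
    have h := (((hasDerivAt_B0 b (mul_pos hs ht)).comp t h3).mul (GG_deriv l (n + 1) t ht)).sub
      (((hasDerivAt_B1 b (mul_pos hs ht)).comp t h3).mul (GG_deriv l n t ht))
    refine h.congr_deriv ?_
    have hz : GG l (n + 1 + 1) t = -((n + 2).factorial) * (t ^ 2 * RR l (n + 2) t) := by
      rw [GG, SS_zero l (n + 1 + 1) (by omega)]; push_cast; ring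
    rw [hz]
    simp only [Function.comp, Pi.add_apply]
    have hq := Real.sq_sqrt hu.1.le
    field_simp
    rw [hq]
    ring

def Sm (c : ℝ) (h : ℝ → ℝ) : Prop := ∃ X, Cls c X ∧ ∀ t, 0 < t → h t = t * X t

theorem Sm.add {c : ℝ} {f h : ℝ → ℝ} (hf : Sm c f) (hh : Sm c h) : Sm c (fun t => f t + h t) := by
  obtain ⟨X, a, b⟩ := hf
  obtain ⟨Y, a', b'⟩ := hh
  exact ⟨_, a.add a', fun t ht => by beta_reduce; rw [b t ht, b' t ht]; ring⟩

theorem Sm.mul {c d : ℝ} {f h : ℝ → ℝ} (hf : Cls c f) (hh : Sm d h) :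
    Sm (c + d) (fun t => f t * h t) := by
  obtain ⟨Y, a', b'⟩ := hh
  exact ⟨_, hf.mul a', fun t ht => by beta_reduce; rw [b' t ht]; ring⟩

theorem Sm.smul {c : ℝ} {h : ℝ → ℝ} (a : ℝ) (hh : Sm c h) : Sm c (fun t => a * h t) := by
  have := Sm.mul (Cls_const a) hh
  rwa [zero_add] at this

theorem Sm.congr {c : ℝ} {f h : ℝ → ℝ} (hh : Sm c h) (e : ∀ t, 0 < t → f t = h t) : Sm c f := by
  obtain ⟨Y, a', b'⟩ := hh
  exact ⟨Y, a', fun t ht => by rw [e t ht, b' t ht]⟩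

theorem Sm_sq {c : ℝ} {h : ℝ → ℝ} (hh : Cls c h) : Sm c (fun t => t ^ 2 * h t) :=
  ⟨_, hh.tmul, fun t _ => by ring⟩

theorem Sm_zero (c : ℝ) : Sm c (fun _ => 0) :=
  ⟨fun _ => 0, ⟨continuousOn_const, 0, 0, le_refl _, by simp⟩, by simp⟩

theorem Sm.lim {c : ℝ} {h : ℝ → ℝ} (hh : Sm c h) : Tendsto h (𝓝[>] 0) (𝓝 0) := by
  obtain ⟨Y, a', b'⟩ := hh
  refine a'.lim_zero1.congr' ?_
  filter_upwards [self_mem_nhdsWithin] with t ht using (b' t ht).symm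

theorem Sm.cls {c : ℝ} {h : ℝ → ℝ} (hh : Sm c h) : Cls c h := by
  obtain ⟨Y, a', b'⟩ := hh
  exact a'.tmul.congr b'

theorem Cls_I1 : Cls (sg true) bI1 := by
  refine ⟨fun t ht => (hasDerivAt_I1 ht).continuousAt.continuousWithinAt, 1, 0, by norm_num,
    fun t ht => ?_⟩
  simpa [sg] using (I1_abs_le (t := t)).trans (I0_le ht.le)

theorem Sm_B1 : Sm (sg true) (B1 true) := ⟨bI1, Cls_I1, fun t _ => by simp [B1]⟩

theorem Sm.mul' {c d : ℝ} {f h : ℝ → ℝ} (hf : Sm c f) (hh : Cls d h) :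
    Sm (c + d) (fun t => f t * h t) := by
  obtain ⟨Y, a', b'⟩ := hf
  exact ⟨_, a'.mul hh, fun t ht => by beta_reduce; rw [b' t ht]; ring⟩

theorem SS_small (l : List Bool) : ∀ m, l.count false < m → Sm (cl l) (SS l m) := by
  induction l with
  | nil =>
    intro m hm
    cases m with
    | zero => simp at hm
    | succ m => exact Sm_zero _
  | cons b l ih =>
    intro m hm
    rw [cl_cons]
    cases m with
    | zero => simp at hm
    | succ m =>
      cases b
      · simp at hm
        exact (Sm.mul (Cls_B0 _) (ih _ (by omega))).add (Sm.mul (Cls_B1 _) (ih _ (by omega)))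
      · simp at hm
        exact (Sm.mul (Cls_B0 _) (ih _ (by omega))).add (Sm_B1.mul' (SS_cls l m))

noncomputable def lead (l : List Bool) (t : ℝ) : ℝ :=
  besselI0 t ^ (l.count true) * B1 false t ^ (l.count false)

theorem SS_lead (l : List Bool) : ∃ h, Sm (cl l) h ∧
    ∀ t, 0 < t → SS l (l.count false) t = lead l t + h t := by
  induction l with
  | nil => exact ⟨_, Sm_zero _, fun t _ => by simp [SS, lead]⟩
  | cons b l ih =>
    obtain ⟨h, h1, h2⟩ := ih
    rw [cl_cons]
    cases b
    · refine ⟨_, (Sm.mul (Cls_B0 _) (SS_small l (l.count false + 1) (by omega))).add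
        (Sm.mul (Cls_B1 false) h1), fun t ht => ?_⟩
      simp only [List.count_cons_self, SS, lead, h2 t ht]
      rw [List.count_cons_of_ne (by simp)]
      ring
    · have hc : (true :: l).count false = l.count false := List.count_cons_of_ne (by simp)
      rw [hc]
      rcases hm : l.count false with _ | m
      · refine ⟨_, (Sm.mul (Cls_B0 true) h1), fun t ht => ?_⟩
        rw [hm] at h2
        simp only [List.count_cons_self, SS, lead, h2 t ht, hc, hm]
        simp [B0]; ring
      · refine ⟨_, (Sm.mul (Cls_B0 true) h1).add (Sm_B1.mul' (SS_cls l m)), fun t ht => ?_⟩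
        rw [hm] at h2
        simp only [List.count_cons_self, SS, lead, h2 t ht, hc, hm]
        simp [B0]; ring

theorem GG_sub (l : List Bool) (m : ℕ) : ∃ h, Sm (cl l) h ∧
    ∀ t, 0 < t → GG l m t = m.factorial * SS l m t + h t :=
  ⟨_, (Sm_sq (Md_RR l m).cls).smul (-(m.factorial : ℝ)), fun t _ => by rw [GG]; ring⟩

theorem GG_small (l : List Bool) (m : ℕ) (hm : l.count false < m) : Sm (cl l) (GG l m) := by
  obtain ⟨h, h1, h2⟩ := GG_sub l m
  exact (((SS_small l m hm).smul _).add h1).congr h2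

theorem GG_lead (l : List Bool) : ∃ h, Sm (cl l) h ∧
    ∀ t, 0 < t → GG l (l.count false) t = (l.count false).factorial * lead l t + h t := by
  obtain ⟨h, h1, h2⟩ := GG_sub l (l.count false)
  obtain ⟨h', h1', h2'⟩ := SS_lead l
  exact ⟨_, (h1'.smul _).add h1, fun t ht => by rw [h2 t ht, h2' t ht]; ring⟩

theorem B1_false_lim : Tendsto (B1 false) (𝓝[>] 0) (𝓝 (-1)) := by
  have h : Tendsto (fun t => t * bK1 t) (𝓝[>] 0) (𝓝 1) := by
    have c1 : Tendsto (fun t : ℝ => Real.exp (-t)) (𝓝[>] 0) (𝓝 1) := by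
      have := (by fun_prop : Continuous fun t : ℝ => Real.exp (-t)).tendsto 0
      simp at this
      exact this.mono_left nhdsWithin_le_nhds
    have c2 : Tendsto (fun t : ℝ => Real.exp (-t) * (1 + t)) (𝓝[>] 0) (𝓝 1) := by
      have := (by fun_prop : Continuous fun t : ℝ => Real.exp (-t) * (1 + t)).tendsto 0
      simp at this
      exact this.mono_left nhdsWithin_le_nhds
    refine tendsto_of_tendsto_of_tendsto_of_le_of_le' c1 c2 ?_ ?_
    · filter_upwards [self_mem_nhdsWithin] with t ht using (tK1_bounds ht).1
    · filter_upwards [self_mem_nhdsWithin] with t ht using (tK1_bounds ht).2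
  refine h.neg.congr fun t => ?_
  simp [B1]

theorem I0_lim : Tendsto besselI0 (𝓝[>] 0) (𝓝 1) := by
  have := (hasDerivAt_I0 0).continuousAt.tendsto
  rw [I0_zero] at this
  exact this.mono_left nhdsWithin_le_nhds

theorem lead_lim (l : List Bool) : Tendsto (lead l) (𝓝[>] 0) (𝓝 ((-1) ^ (l.count false))) := by
  have := (I0_lim.pow (l.count true)).mul (B1_false_lim.pow (l.count false))
  rw [one_pow, one_mul] at this
  exact this

theorem cl_eq (l : List Bool) : cl l = (l.count true) * sg true + (l.count false) * sg false := by
  induction l with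
  | nil => simp [cl]
  | cons b l ih =>
    rw [cl_cons, ih]
    cases b <;> simp <;> ring

theorem lead_cls (l : List Bool) : Cls (cl l) (lead l) := by
  have h := ((Cls_B0 true).pow0 (l.count true)).mul ((Cls_B1 false).pow0 (l.count false))
  rw [cl_eq]; exact h

theorem scale_lim {F : ℝ → ℝ} {L u : ℝ} (hF : Tendsto F (𝓝[>] 0) (𝓝 L)) (hu : 0 < u) :
    Tendsto (fun t => F (Real.sqrt u * t)) (𝓝[>] 0) (𝓝 L) := by
  have hs := Real.sqrt_pos.2 hu
  refine hF.comp (tendsto_nhdsWithin_iff.2 ⟨?_, ?_⟩)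
  · have := (by fun_prop : Continuous fun t : ℝ => Real.sqrt u * t).tendsto 0
    simp at this
    exact this.mono_left nhdsWithin_le_nhds
  · filter_upwards [self_mem_nhdsWithin] with t ht using mul_pos hs ht

theorem Sm_scale_B1 {u : ℝ} (hu : 0 < u) : Sm (sg true * Real.sqrt u) (fun t => B1 true (Real.sqrt u * t)) :=
  ⟨_, (Cls_I1.scale (Real.sqrt_pos.2 hu)).smul (Real.sqrt u), fun t _ => by simp [B1]; ring⟩

theorem bdry_I_zero {l : List Bool} {n : ℕ} {u : ℝ} (hu : 0 < u) (hl : l.length = n + 1)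
    (hc : 1 ≤ l.count true) :
    Tendsto (fun t => B0 true (Real.sqrt u * t) * GG l (n + 1) t
      - B1 true (Real.sqrt u * t) * GG l n t) (𝓝[>] 0) (𝓝 0) := by
  have hlen := List.count_true_add_count_false (l := l)
  have h1 := (Sm.mul ((Cls_B0 true).scale (Real.sqrt_pos.2 hu)) (GG_small l (n + 1) (by omega))).lim
  have h2 := ((Sm_scale_B1 hu).mul' (Md_GG l n).cls).lim
  simpa using h1.sub h2

theorem bdry_I {l : List Bool} {n : ℕ} {u : ℝ} (hu : 0 < u) (hl : l.length = n + 1)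
    (hc : l.count true = 0) :
    Tendsto (fun t => B0 true (Real.sqrt u * t) * GG l (n + 1) t
      - B1 true (Real.sqrt u * t) * GG l n t) (𝓝[>] 0) (𝓝 ((n + 1).factorial * (-1) ^ (n + 1))) := by
  have hlen := List.count_true_add_count_false (l := l)
  have hf : l.count false = n + 1 := by omega
  have h2 := ((Sm_scale_B1 hu).mul' (Md_GG l n).cls).lim
  obtain ⟨h, a, b⟩ := GG_lead l
  have h3 := lead_lim l
  rw [hf] at b h3
  have h4 : Tendsto (GG l (n + 1)) (𝓝[>] 0) (𝓝 ((n + 1).factorial * (-1) ^ (n + 1) + 0)) := by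
    refine ((h3.const_mul _).add a.lim).congr' ?_
    filter_upwards [self_mem_nhdsWithin] with t ht using (b t ht).symm
  have h5 := ((scale_lim I0_lim hu).mul h4).sub h2
  simpa [B0] using h5

theorem bdry_K_zero {l : List Bool} {n : ℕ} {u : ℝ} (hu : 0 < u) (hl : l.length = n + 1)
    (hc : 2 ≤ l.count true) :
    Tendsto (fun t => B0 false (Real.sqrt u * t) * GG l (n + 1) t
      - B1 false (Real.sqrt u * t) * GG l n t) (𝓝[>] 0) (𝓝 0) := by
  have hlen := List.count_true_add_count_false (l := l)
  have h1 := (Sm.mul ((Cls_B0 false).scale (Real.sqrt_pos.2 hu)) (GG_small l (n + 1) (by omega))).lim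
  have h2 := (Sm.mul ((Cls_B1 false).scale (Real.sqrt_pos.2 hu)) (GG_small l n (by omega))).lim
  simpa using h1.sub h2

theorem bdry_K {l : List Bool} {n : ℕ} {u : ℝ} (hu : 0 < u) (hl : l.length = n + 1)
    (hc : l.count true = 1) :
    Tendsto (fun t => B0 false (Real.sqrt u * t) * GG l (n + 1) t
      - B1 false (Real.sqrt u * t) * GG l n t) (𝓝[>] 0) (𝓝 (n.factorial * (-1) ^ n)) := by
  have hlen := List.count_true_add_count_false (l := l)
  have hf : l.count false = n := by omega
  have h1 := (Sm.mul ((Cls_B0 false).scale (Real.sqrt_pos.2 hu)) (GG_small l (n + 1) (by omega))).lim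
  obtain ⟨h, a, b⟩ := GG_lead l
  have h3 := lead_lim l
  rw [hf] at b h3
  have h4 : Tendsto (GG l n) (𝓝[>] 0) (𝓝 (n.factorial * (-1) ^ n + 0)) := by
    refine ((h3.const_mul _).add a.lim).congr' ?_
    filter_upwards [self_mem_nhdsWithin] with t ht using (b t ht).symm
  have h5 := h1.sub ((scale_lim B1_false_lim hu).mul h4)
  simpa using h5

def Smo (φ : ℝ → ℝ) (U : Set ℝ) : Prop := ContDiffOn ℝ (⊤ : ℕ∞) φ U

theorem Smo.deriv {φ : ℝ → ℝ} {U : Set ℝ} (hU : IsOpen U) (h : Smo φ U) : Smo (deriv φ) U := by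
  unfold Smo at h ⊢
  exact ((contDiffOn_infty_iff_deriv_of_isOpen hU).1 h).2

theorem Smo.iter {φ : ℝ → ℝ} {U : Set ℝ} (hU : IsOpen U) (h : Smo φ U) (i : ℕ) :
    Smo (iteratedDeriv i φ) U := by
  induction i with
  | zero => simpa [iteratedDeriv_zero] using h
  | succ i ih => rw [iteratedDeriv_succ]; exact ih.deriv hU

theorem Smo.hasDeriv {φ : ℝ → ℝ} {U : Set ℝ} (hU : IsOpen U) (h : Smo φ U) (i : ℕ) {u : ℝ}
    (hu : u ∈ U) : HasDerivAt (iteratedDeriv i φ) (iteratedDeriv (i + 1) φ u) u := by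
  have h1 := h.iter hU i
  have h2 := ((contDiffOn_infty_iff_deriv_of_isOpen hU).1 h1).1 u hu
  rw [iteratedDeriv_succ]
  exact (h2.differentiableAt (hU.mem_nhds hu)).hasDerivAt

theorem Smo.iter_add {φ ψ : ℝ → ℝ} {U : Set ℝ} (hU : IsOpen U) (h : Smo φ U) (h' : Smo ψ U) (c : ℝ)
    (i : ℕ) : ∀ u ∈ U, iteratedDeriv i (fun u => φ u + c * ψ u) u =
      iteratedDeriv i φ u + c * iteratedDeriv i ψ u := by
  induction i with
  | zero => intro u hu; simp
  | succ i ih =>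
    intro u hu
    rw [iteratedDeriv_succ]
    refine HasDerivAt.deriv ?_
    refine ((h.hasDeriv hU i hu).add ((h'.hasDeriv hU i hu).const_mul c)).congr_of_eventuallyEq ?_
    filter_upwards [hU.mem_nhds hu] with v hv using ih v hv

theorem Smo.add {φ ψ : ℝ → ℝ} {U : Set ℝ} (h : Smo φ U) (h' : Smo ψ U) (c : ℝ) :
    Smo (fun u => φ u + c * ψ u) U := ContDiffOn.add h (contDiffOn_const.mul h')

/-- composition of a differential operator with d/du -/
noncomputable def dO (L : ℕ → ℝ[X]) : ℕ → ℝ[X]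
  | 0 => derivative (L 0)
  | (i + 1) => derivative (L (i + 1)) + L i

noncomputable def opE (M : ℕ) (L : ℕ → ℝ[X]) (φ : ℝ → ℝ) (u : ℝ) : ℝ :=
  ∑ i ∈ Finset.range (M + 1), (L i).eval u * iteratedDeriv i φ u

theorem opE_deriv {M : ℕ} {L : ℕ → ℝ[X]} {φ : ℝ → ℝ} {U : Set ℝ} (hU : IsOpen U) (h : Smo φ U)
    (hL : ∀ i, M < i → L i = 0) {u : ℝ} (hu : u ∈ U) :
    HasDerivAt (opE M L φ) (opE (M + 1) (dO L) φ u) u := by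
  have h1 : HasDerivAt (opE M L φ) (∑ i ∈ Finset.range (M + 1),
      ((derivative (L i)).eval u * iteratedDeriv i φ u + (L i).eval u * iteratedDeriv (i + 1) φ u)) u := by
    unfold opE
    refine HasDerivAt.fun_sum fun i _ => ?_
    exact ((L i).hasDerivAt u).mul (h.hasDeriv hU i hu)
  refine h1.congr_deriv ?_
  unfold opE
  rw [Finset.sum_range_succ' _ (M + 1)]
  simp only [dO, eval_add, add_mul]
  rw [Finset.sum_add_distrib, Finset.sum_add_distrib]
  have h2 : ∑ i ∈ Finset.range (M + 1), eval u (derivative (L i)) * iteratedDeriv i φ u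
      = ∑ i ∈ Finset.range (M + 1), eval u (derivative (L (i + 1))) * iteratedDeriv (i + 1) φ u
        + eval u (derivative (L 0)) * iteratedDeriv 0 φ u := by
    rw [← Finset.sum_range_succ' (fun i => eval u (derivative (L i)) * iteratedDeriv i φ u),
      Finset.sum_range_succ _ (M + 1), hL (M + 1) (by omega)]
    simp
  rw [h2]; ring

theorem opE_lin (M : ℕ) (L K : ℕ → ℝ[X]) (p q : ℝ[X]) (φ : ℝ → ℝ) (u : ℝ) :
    opE M (fun i => p * L i + q * K i) φ u = p.eval u * opE M L φ u + q.eval u * opE M K φ u := by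
  unfold opE
  rw [Finset.mul_sum, Finset.mul_sum, ← Finset.sum_add_distrib]
  refine Finset.sum_congr rfl fun i _ => ?_
  simp only [eval_add, eval_mul]; ring

theorem dO_zero {L : ℕ → ℝ[X]} {M : ℕ} (hL : ∀ i, M < i → L i = 0) : ∀ i, M + 1 < i → dO L i = 0 := by
  intro i hi
  cases i with
  | zero => omega
  | succ i => simp [dO, hL (i + 1) (by omega), hL i (by omega)]

noncomputable def stA (n : ℝ) (m : ℕ) (a b : ℕ → ℝ[X]) (i : ℕ) : ℝ[X] :=
  C (-2 * (n - m)) * dO a i + C (-2 * ((m:ℝ) + 2)) * dO b i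

noncomputable def stB (n : ℝ) (m : ℕ) (a b : ℕ → ℝ[X]) (i : ℕ) : ℝ[X] :=
  (C (-2 / ((m:ℝ) + 3)) * X) * dO b i + C (-(n - (m:ℝ) - 1) / ((m:ℝ) + 3)) * stA n m a b i

noncomputable def VV (n : ℝ) : ℕ → (ℕ → ℝ[X]) × (ℕ → ℝ[X])
  | 0 => (fun i => if i = 0 then 1 else 0, fun i => if i = 0 then C (1/2) * (X - C n) else 0)
  | (m + 1) => (stA n m (VV n m).1 (VV n m).2, stB n m (VV n m).1 (VV n m).2)

theorem VV_ord (n : ℝ) (m : ℕ) : (∀ i, m < i → (VV n m).1 i = 0) ∧ (∀ i, m < i → (VV n m).2 i = 0) := by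
  induction m with
  | zero =>
    constructor <;> intro i hi <;> simp [VV, (Nat.pos_iff_ne_zero.1 hi)]
  | succ m ih =>
    have hA : ∀ i, m + 1 < i → stA n m (VV n m).1 (VV n m).2 i = 0 := fun i hi => by
      simp [stA, dO_zero ih.1 i hi, dO_zero ih.2 i hi]
    exact ⟨hA, fun i hi => by simp [VV, stB, hA i hi, dO_zero ih.2 i hi]⟩

theorem chain_op {l : List Bool} {b : Bool} (m : ℕ) : ∀ u ∈ Reg b (cl l),
    al l b m u = opE m (VV l.length m).1 (al l b 0) u ∧
    aa l b m u = opE m (VV l.length m).2 (al l b 0) u := by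
  have hU := Reg_open b (cl l)
  have hS : Smo (al l b 0) (Reg b (cl l)) := J0_smooth (SS_cls l 0)
  induction m with
  | zero =>
    intro u hu
    refine ⟨by simp [opE, VV], ?_⟩
    rw [aa_zero]
    simp only [opE, VV, zero_add, Finset.sum_range_one, if_true, iteratedDeriv_zero, eval_mul, eval_C,
      eval_sub, eval_X]
    ring
  | succ m ih =>
    intro u hu
    have d1 : deriv (al l b m) u = opE (m + 1) (dO (VV l.length m).1) (al l b 0) u := by
      refine HasDerivAt.deriv ((opE_deriv hU hS (VV_ord _ m).1 hu).congr_of_eventuallyEq ?_)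
      filter_upwards [hU.mem_nhds hu] with v hv using (ih v hv).1
    have d2 : deriv (aa l b m) u = opE (m + 1) (dO (VV l.length m).2) (al l b 0) u := by
      refine HasDerivAt.deriv ((opE_deriv hU hS (VV_ord _ m).2 hu).congr_of_eventuallyEq ?_)
      filter_upwards [hU.mem_nhds hu] with v hv using (ih v hv).2
    have h1 := al_rec m hu
    have h2 := aa_rec m hu
    rw [d1, d2] at h1
    rw [d2] at h2
    have e1 : al l b (m + 1) u = opE (m + 1) (VV l.length (m + 1)).1 (al l b 0) u := by
      rw [h1]
      refine Eq.trans ?_ (opE_lin (m + 1) (dO (VV l.length m).1) (dO (VV l.length m).2)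
        (C (-2 * ((l.length:ℝ) - m))) (C (-2 * ((m:ℝ) + 2))) (al l b 0) u).symm
      simp only [eval_C]; ring
    refine ⟨e1, ?_⟩
    refine Eq.trans ?_ (opE_lin (m + 1) (dO (VV l.length m).2) (VV l.length (m + 1)).1
        (C (-2 / ((m:ℝ) + 3)) * X) (C (-((l.length:ℝ) - (m:ℝ) - 1) / ((m:ℝ) + 3))) (al l b 0) u).symm
    rw [e1] at h2
    simp only [eval_C, eval_mul, eval_X]
    have h3 : (m + 3 : ℝ) ≠ 0 := by positivity
    field_simp
    rw [mul_comm, h2]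
    ring

/-! Top and sub-top symbols -/
noncomputable def tA (n : ℝ) (m : ℕ) (u : ℝ) : ℝ := ((VV n m).1 m).eval u
noncomputable def tB (n : ℝ) (m : ℕ) (u : ℝ) : ℝ := ((VV n m).2 m).eval u
noncomputable def dA (n : ℝ) (m : ℕ) (u : ℝ) : ℝ := (derivative ((VV n m).1 m)).eval u
noncomputable def dB (n : ℝ) (m : ℕ) (u : ℝ) : ℝ := (derivative ((VV n m).2 m)).eval u
noncomputable def sA (n : ℝ) : ℕ → ℝ → ℝ
  | 0, _ => 0
  | (m + 1), u => ((VV n (m + 1)).1 m).eval u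
noncomputable def sB (n : ℝ) : ℕ → ℝ → ℝ
  | 0, _ => 0
  | (m + 1), u => ((VV n (m + 1)).2 m).eval u

theorem tA_zero (n u : ℝ) : tA n 0 u = 1 := by simp [tA, VV]
theorem tB_zero (n u : ℝ) : tB n 0 u = (u - n) / 2 := by simp [tB, VV]; ring

theorem tA_succ (n : ℝ) (m : ℕ) (u : ℝ) :
    tA n (m + 1) u = -2 * (n - m) * tA n m u - 2 * (m + 2) * tB n m u := by
  simp only [tA, tB, VV, stA, dO, (VV_ord n m).1 (m + 1) (by omega), (VV_ord n m).2 (m + 1) (by omega)]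
  simp; ring

theorem tB_succ (n : ℝ) (m : ℕ) (u : ℝ) :
    tB n (m + 1) u = (-2 * u * tB n m u - (n - m - 1) * tA n (m + 1) u) / (m + 3) := by
  have : tB n (m + 1) u = -2 / (m + 3) * u * tB n m u + -(n - m - 1) / (m + 3) * tA n (m + 1) u := by
    simp only [tA, tB, VV, stB, dO, (VV_ord n m).2 (m + 1) (by omega)]
    simp
  rw [this]; ring

theorem dA_deriv (n : ℝ) (m : ℕ) (u : ℝ) : HasDerivAt (tA n m) (dA n m u) u :=
  Polynomial.hasDerivAt _ _
theorem dB_deriv (n : ℝ) (m : ℕ) (u : ℝ) : HasDerivAt (tB n m) (dB n m u) u :=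
  Polynomial.hasDerivAt _ _

theorem dO_sub1 (n : ℝ) (m : ℕ) (u : ℝ) : (dO (VV n m).1 m).eval u = dA n m u + sA n m u := by
  cases m with
  | zero => simp [dO, dA, sA]
  | succ m => simp [dO, dA, sA]

theorem dO_sub2 (n : ℝ) (m : ℕ) (u : ℝ) : (dO (VV n m).2 m).eval u = dB n m u + sB n m u := by
  cases m with
  | zero => simp [dO, dB, sB]
  | succ m => simp [dO, dB, sB]

theorem sA_succ (n : ℝ) (m : ℕ) (u : ℝ) :
    sA n (m + 1) u = -2 * (n - m) * (dA n m u + sA n m u) - 2 * (m + 2) * (dB n m u + sB n m u) := by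
  rw [← dO_sub1, ← dO_sub2]
  simp only [sA, VV, stA]
  simp; ring

theorem sB_succ (n : ℝ) (m : ℕ) (u : ℝ) :
    sB n (m + 1) u = (-2 * u * (dB n m u + sB n m u) - (n - m - 1) * sA n (m + 1) u) / (m + 3) := by
  rw [← dO_sub2]
  have : sB n (m + 1) u = -2 / (m + 3) * u * ((dO (VV n m).2 m).eval u)
      + -(n - m - 1) / (m + 3) * sA n (m + 1) u := by
    simp only [sA, sB, VV, stB]
    simp
  rw [this]; ring

noncomputable def kap (N m : ℕ) : ℝ :=
  -(4 / (N + 2)) * ((N + 1 - m).factorial * (m + 2).factorial / (2 * (N + 1).factorial))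

theorem kap_sym (N m : ℕ) (hm : m < N) : kap N (N - 1 - m) = kap N m := by
  unfold kap
  rw [show N + 1 - (N - 1 - m) = m + 2 by omega, show N - 1 - m + 2 = N + 1 - m by omega]
  ring

theorem kap_succ (N m : ℕ) (hm : m + 1 < N) : kap N m * (m + 3) = kap N (m + 1) * (N + 1 - m) := by
  unfold kap
  obtain ⟨r, rfl⟩ : ∃ r, N = m + r + 2 := ⟨N - m - 2, by omega⟩
  rw [show m + r + 2 + 1 - m = (r + 2) + 1 by omega, show m + r + 2 + 1 - (m + 1) = r + 2 by omega,
    Nat.factorial_succ (r + 2), show m + 1 + 2 = (m + 2) + 1 by omega, Nat.factorial_succ (m + 2)]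
  push_cast
  ring

noncomputable def Lpr (N m : ℕ) (u x y : ℝ) : ℝ :=
  kap N m * (-tA (N + 1) (N - 1 - m) u * x + tB (N + 1) (N - 1 - m) u * y)

theorem Lpr_step (N m : ℕ) (hm : m + 1 < N) (u x y x' y' : ℝ)
    (hx : x' = -2 * (N + 1 - m) * x - 2 * (m + 2) * y)
    (hy : y' = (-2 * u * y - (N + 1 - m - 1) * x') / (m + 3)) :
    Lpr N (m + 1) u x' y' = Lpr N m u x y := by
  unfold Lpr
  obtain ⟨r, rfl⟩ : ∃ r, N = m + r + 2 := ⟨N - m - 2, by omega⟩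
  rw [show m + r + 2 - 1 - m = r + 1 by omega, show m + r + 2 - 1 - (m + 1) = r by omega]
  have hk := kap_succ (m + r + 2) m hm
  have h3 : (m + 3 : ℝ) ≠ 0 := by positivity
  have h4 : (r + 3 : ℝ) ≠ 0 := by positivity
  have hk' : kap (m + r + 2) m = kap (m + r + 2) (m + 1) * ((m + r + 2 : ℕ) + 1 - m) / (m + 3) := by
    rw [eq_div_iff h3, hk]
  rw [hk', tB_succ, tA_succ, hy, hx]
  push_cast
  rw [show ((m:ℝ) + r + 2 + 1 - m) = r + 3 by ring]
  field_simp
  ring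

theorem Lpr_last (N : ℕ) (hN : 1 ≤ N) (u x y x' y' : ℝ)
    (hx : x' = -2 * (N + 1 - (N - 1 : ℕ)) * x - 2 * ((N - 1 : ℕ) + 2) * y)
    (hy : y' = (-2 * u * y - (N + 1 - (N - 1 : ℕ) - 1) * x') / ((N - 1 : ℕ) + 3)) :
    y' = Lpr N (N - 1) u x y := by
  unfold Lpr
  obtain ⟨r, rfl⟩ : ∃ r, N = r + 1 := ⟨N - 1, by omega⟩
  rw [show r + 1 - 1 - (r + 1 - 1) = 0 by omega, tA_zero, tB_zero, kap]
  simp only [Nat.add_sub_cancel] at *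
  rw [show r + 1 + 1 - r = 2 by omega, hy, hx]
  have : ((r + 1 + 1).factorial : ℝ) ≠ 0 := by positivity
  have h4 : (r + 3 : ℝ) ≠ 0 := by positivity
  rw [show r + 2 = r + 1 + 1 by ring]
  push_cast
  rw [show ((r:ℝ) + 1 + 2) = r + 3 by ring]
  simp [Nat.factorial]
  field_simp
  ring

theorem p0_Lpr (N : ℕ) (hN : 1 ≤ N) (u : ℝ) (m : ℕ) (hm : m < N) :
    tB (N + 1) N u = Lpr N m u (tA (N + 1) m u) (tB (N + 1) m u) := by
  obtain ⟨d, hd⟩ : ∃ d, m + d + 1 = N := ⟨N - m - 1, by omega⟩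
  induction d generalizing m with
  | zero =>
    have : N = (N - 1) + 1 := by omega
    have hm' : m = N - 1 := by omega
    subst hm'
    conv_lhs => rw [this]
    refine Lpr_last N hN u _ _ (tA (N + 1) (N - 1 + 1) u) _ ?_ ?_
    · rw [tA_succ]
    · rw [← this]; conv_lhs => rw [this]
      rw [tB_succ, ← this]
  | succ d ih =>
    rw [ih (m + 1) (by omega) (by omega)]
    exact Lpr_step N m (by omega) u _ _ _ _ (tA_succ _ _ _) (tB_succ _ _ _)

theorem p1_Lpr (N : ℕ) (hN : 1 ≤ N) (u : ℝ) :
    sB (N + 1) N u = ∑ m ∈ Finset.range N, Lpr N m u (dA (N + 1) m u) (dB (N + 1) m u) := by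
  have Ladd : ∀ m x y z w, Lpr N m u (x + z) (y + w) = Lpr N m u x y + Lpr N m u z w := by
    intro m x y z w; unfold Lpr; ring
  have key : ∀ m, m < N → Lpr N m u (sA (N + 1) m u) (sB (N + 1) m u) =
      ∑ j ∈ Finset.range m, Lpr N j u (dA (N + 1) j u) (dB (N + 1) j u) := by
    intro m hm
    induction m with
    | zero => simp [sA, sB, Lpr]
    | succ m ih =>
      rw [Finset.sum_range_succ, ← ih (by omega)]
      rw [add_comm (Lpr N m u (sA (N + 1) m u) (sB (N + 1) m u)), ← Ladd]
      exact Lpr_step N m (by omega) u _ _ _ _ (sA_succ _ _ _) (sB_succ _ _ _)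
  obtain ⟨r, rfl⟩ : ∃ r, N = r + 1 := ⟨N - 1, by omega⟩
  rw [Finset.sum_range_succ, ← key r (by omega)]
  rw [add_comm (Lpr _ _ _ (sA _ _ _) (sB _ _ _)), ← Ladd]
  refine Lpr_last (r + 1) hN u _ _ (sA ((r + 1 : ℕ) + 1) (r + 1) u) _ ?_ ?_
  · rw [sA_succ]; simp
  · rw [sB_succ]; simp

theorem p1_eq (N : ℕ) (hN : 1 ≤ N) (u : ℝ) :
    2 * sB (N + 1) N u = N * dB (N + 1) N u := by
  have key : ∀ m, m < N → dB (N + 1) N u = Lpr N m u (dA (N + 1) m u) (dB (N + 1) m u)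
      + Lpr N (N - 1 - m) u (dA (N + 1) (N - 1 - m) u) (dB (N + 1) (N - 1 - m) u) := by
    intro m hm
    refine (dB_deriv (N + 1) N u).unique ?_
    have e : tB (N + 1) N = fun u => Lpr N m u (tA (N + 1) m u) (tB (N + 1) m u) :=
      funext fun u => p0_Lpr N hN u m hm
    rw [e]
    unfold Lpr
    have h := ((((dA_deriv (N + 1) (N - 1 - m) u).neg).mul (dA_deriv (N + 1) m u)).add
      ((dB_deriv (N + 1) (N - 1 - m) u).mul (dB_deriv (N + 1) m u))).const_mul (kap N m)
    refine h.congr_deriv ?_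
    rw [kap_sym N m hm, show N - 1 - (N - 1 - m) = m by omega]
    simp only [Pi.neg_apply]
    ring
  have h2 : ∑ m ∈ Finset.range N, dB (N + 1) N u = sB (N + 1) N u + sB (N + 1) N u := by
    conv_rhs => 
      rw [p1_Lpr N hN u]
      arg 2
      rw [← Finset.sum_range_reflect]
    rw [← Finset.sum_add_distrib]
    exact Finset.sum_congr rfl fun m hm => key m (Finset.mem_range.1 hm)
  rw [Finset.sum_const, Finset.card_range, nsmul_eq_mul] at h2
  linarith

/-! value of the top coefficient -/
noncomputable def QQ (n s : ℝ) : ℕ → ℝ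
  | 0 => 1
  | 1 => -s
  | (m + 2) => (-s * QQ n s (m + 1) - (n - m) * QQ n s m) / (m + 2)

theorem QQ_rec (n s : ℝ) (m : ℕ) :
    (m + 2) * QQ n s (m + 2) = -s * QQ n s (m + 1) - (n - m) * QQ n s m := by
  have h : (m + 2 : ℝ) ≠ 0 := by positivity
  rw [QQ]; field_simp

theorem t_QQ (n s : ℝ) (m : ℕ) : tA n m (s ^ 2) = (2 * s) ^ m * QQ n s m ∧
    tB n m (s ^ 2) = (2 * s) ^ m * QQ n s (m + 2) := by
  induction m with
  | zero =>
    rw [tA_zero, tB_zero]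
    simp [QQ]; ring
  | succ m ih =>
    have h1 := QQ_rec n s m
    have h2 := QQ_rec n s (m + 1)
    have e : tA n (m + 1) (s ^ 2) = (2 * s) ^ (m + 1) * QQ n s (m + 1) := by
      rw [tA_succ, ih.1, ih.2]
      linear_combination (-2 * (2 * s) ^ m) * h1
    refine ⟨e, ?_⟩
    rw [tB_succ, e, ih.2]
    have h : (m + 3 : ℝ) ≠ 0 := by positivity
    rw [div_eq_iff h]
    push_cast at h2
    linear_combination (-(2 * s) ^ (m + 1)) * h2

theorem QQ_shift (n s : ℝ) (m : ℕ) :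
    QQ (n + 1) (s + 1) (m + 1) = QQ n s (m + 1) - QQ n s m ∧
    QQ (n + 1) (s + 1) (m + 2) = QQ n s (m + 2) - QQ n s (m + 1) := by
  induction m with
  | zero => constructor <;> simp [QQ] <;> ring
  | succ m ih =>
    refine ⟨ih.2, ?_⟩
    have h1 := QQ_rec n s m
    have h2 := QQ_rec n s (m + 1)
    have h3 := QQ_rec (n + 1) (s + 1) (m + 1)
    have h : (m + 3 : ℝ) ≠ 0 := by positivity
    rw [ih.1, ih.2] at h3
    refine mul_left_cancel₀ h ?_
    push_cast at h1 h2 h3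
    linear_combination h3 - h2 + h1

theorem QQ_top (n : ℕ) : ∀ s : ℝ, ((n + 1).factorial : ℝ) * QQ n s (n + 1) =
    (-1) ^ (n + 1) * ∏ i ∈ Finset.range (n + 1), (s - n + 2 * i) := by
  induction n with
  | zero => intro s; simp [QQ]
  | succ n ih =>
    intro s
    have h := (QQ_shift n (s - 1) (n + 1)).1
    have h2 := QQ_rec n (s - 1) n
    have h3 := ih (s - 1)
    rw [sub_add_cancel] at h
    rw [Finset.prod_range_succ, Nat.factorial_succ]
    have e : ∏ i ∈ Finset.range (n + 1), (s - (n + 1 : ℕ) + 2 * i) =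
        ∏ i ∈ Finset.range (n + 1), (s - 1 - n + 2 * i) :=
      Finset.prod_congr rfl fun i _ => by push_cast; ring
    rw [e]
    push_cast at h ⊢
    rw [h]
    rw [pow_succ]
    linear_combination ((n + 1).factorial : ℝ) * h2 - (s + n + 1) * h3

theorem prod_even (k : ℕ) (s : ℝ) : ∏ i ∈ Finset.range (2 * k + 1), (s - (2 * k : ℕ) + 2 * i) =
    s * ∏ j ∈ Finset.Icc 1 k, (s ^ 2 - (2 * (j : ℝ)) ^ 2) := by
  induction k with
  | zero => simp
  | succ k ih =>
    rw [Finset.prod_Icc_succ_top (by omega), ← mul_assoc, ← ih, show 2 * (k + 1) + 1 = (2 * k + 1) + 1 + 1 by ring,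
      Finset.prod_range_succ, Finset.prod_range_succ']
    have e : ∏ i ∈ Finset.range (2 * k + 1), (s - (2 * (k + 1) : ℕ) + 2 * ((i + 1 : ℕ) : ℝ)) =
        ∏ i ∈ Finset.range (2 * k + 1), (s - (2 * k : ℕ) + 2 * i) :=
      Finset.prod_congr rfl fun i _ => by push_cast; ring
    rw [e]; push_cast; ring

noncomputable def PP (k : ℕ) (u : ℝ) : ℝ := u ^ k * ∏ j ∈ Finset.Icc 1 k, ((2 * (j : ℝ)) ^ 2 - u)

theorem p0_val (k : ℕ) (hk : 1 ≤ k) {u : ℝ} (hu : 0 < u) :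
    tB ((2 * k : ℕ) : ℝ) (2 * k - 1) u =
      -(2 ^ (2 * k - 1) * (-1) ^ k / (2 * k + 1).factorial) * PP k u := by
  have h := (t_QQ ((2 * k : ℕ) : ℝ) (Real.sqrt u) (2 * k - 1)).2
  rw [Real.sq_sqrt hu.le, show 2 * k - 1 + 2 = 2 * k + 1 by omega] at h
  have h2 := QQ_top (2 * k) (Real.sqrt u)
  rw [prod_even, Real.sq_sqrt hu.le] at h2
  have e : ∏ j ∈ Finset.Icc 1 k, (u - (2 * (j : ℝ)) ^ 2) =
      (-1) ^ k * ∏ j ∈ Finset.Icc 1 k, ((2 * (j : ℝ)) ^ 2 - u) := by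
    have : (-1 : ℝ) ^ k = ∏ j ∈ Finset.Icc 1 k, (-1 : ℝ) := by simp
    rw [this, ← Finset.prod_mul_distrib]
    exact Finset.prod_congr rfl fun i _ => by ring
  rw [e, pow_succ, pow_mul] at h2
  have hf : ((2 * k + 1).factorial : ℝ) ≠ 0 := by positivity
  have hs : Real.sqrt u ^ (2 * k - 1) * Real.sqrt u = u ^ k := by
    rw [← pow_succ, show 2 * k - 1 + 1 = 2 * k by omega, pow_mul, Real.sq_sqrt hu.le]
  rw [h, PP, ← hs, mul_pow]
  rw [neg_mul, div_mul_eq_mul_div, eq_neg_iff_add_eq_zero, add_div' _ _ _ hf, div_eq_zero_iff]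
  left
  simp only [even_two, Even.neg_pow, one_pow] at h2
  linear_combination (2 ^ (2 * k - 1) * Real.sqrt u ^ (2 * k - 1)) * h2

/-! determinants -/
theorem det_deriv {n : ℕ} {M : ℝ → Matrix (Fin n) (Fin n) ℝ} {M' : Matrix (Fin n) (Fin n) ℝ} {u : ℝ}
    (h : ∀ i j, HasDerivAt (fun u => M u i j) (M' i j) u) :
    HasDerivAt (fun u => (M u).det) (∑ i, ((M u).updateRow i (M' i)).det) u := by
  have e : (fun u => (M u).det) = fun u => ∑ σ : Equiv.Perm (Fin n), (Equiv.Perm.sign σ : ℤ) * ∏ i, M u i (σ i) := by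
    ext u
    rw [← Matrix.det_transpose, Matrix.det_apply']
    simp [Matrix.transpose_apply]
  rw [e]
  have h1 : HasDerivAt (fun u => ∑ σ : Equiv.Perm (Fin n), ((Equiv.Perm.sign σ : ℤ) : ℝ) * ∏ i, M u i (σ i))
      (∑ σ : Equiv.Perm (Fin n), ((Equiv.Perm.sign σ : ℤ) : ℝ) *
        ∑ i, (∏ j ∈ Finset.univ.erase i, M u j (σ j)) • M' i (σ i)) u := by
    refine HasDerivAt.fun_sum fun σ _ => HasDerivAt.const_mul _ ?_
    exact HasDerivAt.fun_finsetProd fun i _ => h i (σ i)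
  refine h1.congr_deriv ?_
  simp_rw [Finset.mul_sum]
  rw [Finset.sum_comm]
  refine Finset.sum_congr rfl fun i _ => ?_
  rw [← Matrix.det_transpose, Matrix.det_apply']
  refine Finset.sum_congr rfl fun σ _ => ?_
  congr 1
  simp only [Matrix.transpose_apply]
  rw [← Finset.mul_prod_erase Finset.univ _ (Finset.mem_univ i), Matrix.updateRow_self, smul_eq_mul, mul_comm]
  congr 1
  refine Finset.prod_congr rfl fun j hj => ?_
  rw [Matrix.updateRow_ne (Finset.ne_of_mem_erase hj)]

noncomputable def Wr (N : ℕ) (φ : Fin N → ℝ → ℝ) (u : ℝ) : ℝ :=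
  Matrix.det (Matrix.of fun i j : Fin N => iteratedDeriv (i : ℕ) (φ j) u)

theorem Wr_deriv {M : ℕ} {φ : Fin (M + 1) → ℝ → ℝ} {U : Set ℝ} (hU : IsOpen U) (hs : ∀ j, Smo (φ j) U)
    {L : ℕ → ℝ[X]} (hL : ∀ j, ∀ u ∈ U, opE (M + 1) L (φ j) u = 0) {u : ℝ} (hu : u ∈ U)
    (h0 : (L (M + 1)).eval u ≠ 0) :
    HasDerivAt (Wr (M + 1) φ) (-((L M).eval u / (L (M + 1)).eval u) * Wr (M + 1) φ u) u := by
  set A : ℝ → Matrix (Fin (M + 1)) (Fin (M + 1)) ℝ :=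
    fun u => Matrix.of fun i j => iteratedDeriv (i : ℕ) (φ j) u with hA
  have h := det_deriv (M := A) (M' := Matrix.of fun i j => iteratedDeriv ((i : ℕ) + 1) (φ j) u) (u := u)
    (fun i j => by simpa [hA] using (hs j).hasDeriv hU i hu)
  refine h.congr_deriv ?_
  rw [Finset.sum_eq_single (Fin.last M)]
  · have e : (Matrix.of fun i j : Fin (M + 1) => iteratedDeriv ((i : ℕ) + 1) (φ j) u) (Fin.last M) =
      ∑ r : Fin (M + 1), (-((L r).eval u / (L (M + 1)).eval u)) • A u r := by
      ext j
      have := hL j u hu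
      rw [opE, Finset.sum_range_succ, Finset.sum_range] at this
      simp only [Finset.sum_apply, Pi.smul_apply, hA, Matrix.of_apply, smul_eq_mul, Fin.val_last]
      refine mul_left_cancel₀ h0 ?_
      rw [Finset.mul_sum]
      have e2 : ∀ i : Fin (M + 1), eval u (L (M + 1)) * (-(eval u (L i) / eval u (L (M + 1))) * iteratedDeriv i (φ j) u)
        = -(eval u (L i) * iteratedDeriv i (φ j) u) := fun i => by field_simp
      simp only [e2, Finset.sum_neg_distrib]
      linarith
    rw [e, Matrix.det_updateRow_sum]
    simp [Wr, hA]
  · intro i _ hi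
    have hi' : (i : ℕ) < M := by
      have := i.2
      have h3 : (i : ℕ) ≠ M := fun h => hi (Fin.ext h)
      omega
    refine Matrix.det_zero_of_row_eq (i := i) (j := ⟨i + 1, by omega⟩) (fun h => by simpa using congrArg Fin.val h) ?_
    rw [Matrix.updateRow_self, Matrix.updateRow_ne (fun h => by simpa using congrArg Fin.val h)]
    ext j; simp [hA]
  · simp

theorem Wr_rows {N : ℕ} (O : ℕ → ℕ → ℝ[X]) (hO : ∀ i r, i < r → O i r = 0) (φ : Fin N → ℝ → ℝ) (u : ℝ) :
    Matrix.det (Matrix.of fun i j : Fin N => opE i (O i) (φ j) u) =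
      (∏ i : Fin N, (O i i).eval u) * Wr N φ u := by
  have e : (Matrix.of fun i j : Fin N => opE i (O i) (φ j) u) =
      (Matrix.of fun i r : Fin N => (O i r).eval u) *
      (Matrix.of fun i j : Fin N => iteratedDeriv (i : ℕ) (φ j) u) := by
    ext i j
    rw [Matrix.mul_apply]
    simp only [Matrix.of_apply, opE]
    rw [← Finset.sum_range (fun r => eval u (O i r) * iteratedDeriv r (φ j) u)]
    refine Finset.sum_subset (Finset.range_subset_range.2 i.2) fun r _ hr => ?_
    rw [hO i r (by simpa using hr)]; simp
  rw [e, Matrix.det_mul, Matrix.det_of_lowerTriangular]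
  · rfl
  · intro i j hij
    rw [Matrix.of_apply, hO i j (by simpa using hij)]; simp

noncomputable def Ph (k : ℕ) (u : ℝ) : ℝ := (PP k u ^ 2) ^ (((k : ℝ) - 1 / 2) / 2)

theorem PP_diff (k : ℕ) : Differentiable ℝ (PP k) := by
  unfold PP; fun_prop

theorem abel {k : ℕ} (hk : 1 ≤ k) {φ : Fin (2 * k - 1) → ℝ → ℝ} {U : Set ℝ} (hU : IsOpen U)
    (hUc : IsPreconnected U) (hpos : ∀ u ∈ U, 0 < u) (hP : ∀ u ∈ U, PP k u ≠ 0)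
    (hs : ∀ j, Smo (φ j) U)
    (hL : ∀ j, ∀ u ∈ U, opE (2 * k - 1) (VV ((2 * k : ℕ) : ℝ) (2 * k - 1)).2 (φ j) u = 0) :
    ∃ c, ∀ u ∈ U, Ph k u * Wr (2 * k - 1) φ u = c := by
  obtain ⟨M, hM⟩ : ∃ M, 2 * k - 1 = M + 1 := ⟨2 * k - 2, by omega⟩
  have hkM : (2 * k : ℕ) = M + 2 := by omega
  have hkr : (k : ℝ) = (M + 2) / 2 := by
    have : ((2 * k : ℕ) : ℝ) = (M + 2 : ℕ) := by rw [hkM]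
    push_cast at this; linarith
  set p : ℝ := -(2 ^ (2 * k - 1) * (-1) ^ k / (2 * k + 1).factorial) with hp
  have hp0 : p ≠ 0 := by rw [hp]; simp [Nat.factorial_ne_zero]
  have top : ∀ u, 0 < u → tB ((2 * k : ℕ) : ℝ) (2 * k - 1) u = p * PP k u := fun u hu => p0_val k hk hu
  have dtop : ∀ u, 0 < u → dB ((2 * k : ℕ) : ℝ) (2 * k - 1) u = p * deriv (PP k) u := by
    intro u hu
    refine (dB_deriv _ _ u).unique ?_
    refine ((PP_diff k u).hasDerivAt.const_mul p).congr_of_eventuallyEq ?_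
    filter_upwards [lt_mem_nhds hu] with v hv using top v hv
  have p1 : ∀ u, 2 * sB ((2 * k : ℕ) : ℝ) (2 * k - 1) u = (2 * k - 1 : ℝ) * dB ((2 * k : ℕ) : ℝ) (2 * k - 1) u := by
    intro u
    have := p1_eq (2 * k - 1) (by omega) u
    rw [show (((2 * k - 1 : ℕ) : ℝ)) = 2 * k - 1 by push_cast [Nat.cast_sub (show 1 ≤ 2 * k by omega)]; ring] at this
    rw [show ((2 * k - 1 : ℝ) + 1) = ((2 * k : ℕ) : ℝ) by push_cast; ring] at this
    exact this
  have hW : ∀ u ∈ U, HasDerivAt (Wr (2 * k - 1) φ)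
      (-(((k:ℝ) - 1 / 2) * deriv (PP k) u / PP k u) * Wr (2 * k - 1) φ u) u := by
    intro u hu
    have h1 := p1 u
    rw [dtop u (hpos u hu)] at h1
    have h2 := top u (hpos u hu)
    clear p1 dtop top
    generalize ((2 * k : ℕ) : ℝ) = nn at *
    generalize 2 * k - 1 = N at *
    subst hM
    have h0 := hP u hu
    have := Wr_deriv hU hs hL hu (by
      change tB nn (M + 1) u ≠ 0
      rw [h2]; exact mul_ne_zero hp0 h0)
    refine this.congr_deriv ?_
    congr 2
    change sB nn (M + 1) u / tB nn (M + 1) u = _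
    rw [h2]
    field_simp
    linarith
  have hd : ∀ u ∈ U, HasDerivAt (fun u => Ph k u * Wr (2 * k - 1) φ u) 0 u := by
    intro u hu
    have h0 := hP u hu
    have h1 : HasDerivAt (fun u => PP k u ^ 2) (2 * PP k u * deriv (PP k) u) u := by
      exact ((PP_diff k u).hasDerivAt.pow 2).congr_deriv (by norm_num)
    have h2 := h1.rpow_const (p := ((k : ℝ) - 1 / 2) / 2) (Or.inl (pow_ne_zero 2 h0))
    refine (h2.mul (hW u hu)).congr_deriv ?_
    have h3 : Ph k u = (PP k u ^ 2) ^ (((k : ℝ) - 1 / 2) / 2 - 1) * PP k u ^ 2 := by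
      rw [Ph, Real.rpow_sub_one (pow_ne_zero 2 h0)]
      field_simp
    change _ + Ph k u * _ = _
    rw [h3]
    field_simp
    ring
  have := IsOpen.exists_is_const_of_deriv_eq_zero hU hUc
    (fun u hu => (hd u hu).differentiableAt.differentiableWithinAt) (fun u hu => (hd u hu).deriv)
  exact this

theorem opE_mul (M : ℕ) (L : ℕ → ℝ[X]) (p : ℝ[X]) (φ : ℝ → ℝ) (u : ℝ) :
    opE M (fun i => p * L i) φ u = p.eval u * opE M L φ u := by
  unfold opE
  rw [Finset.mul_sum]
  exact Finset.sum_congr rfl fun i _ => by rw [eval_mul]; ring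

theorem opE_add {M : ℕ} {L : ℕ → ℝ[X]} {φ ψ : ℝ → ℝ} {U : Set ℝ} (hU : IsOpen U) (h : Smo φ U)
    (h' : Smo ψ U) (c : ℝ) {u : ℝ} (hu : u ∈ U) :
    opE M L (fun u => φ u + c * ψ u) u = opE M L φ u + c * opE M L ψ u := by
  unfold opE
  rw [Finset.mul_sum, ← Finset.sum_add_distrib]
  refine Finset.sum_congr rfl fun i _ => ?_
  rw [h.iter_add hU h' c i u hu]; ring

theorem opE_cont {M : ℕ} {L : ℕ → ℝ[X]} {φ : ℝ → ℝ} {U : Set ℝ} (hU : IsOpen U) (h : Smo φ U)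
    {u : ℝ} (hu : u ∈ U) : ContinuousAt (opE M L φ) u := by
  unfold opE
  refine tendsto_finsetSum _ fun i _ => ?_
  exact ((L i).hasDerivAt u).continuousAt.mul (h.hasDeriv hU i hu).continuousAt

/-- row operators -/
noncomputable def OV : ℕ → ℕ → ℝ[X]
  | 0 => fun i => if i = 0 then 1 else 0
  | (r + 1) => fun i => (if r % 2 = 0 then C 2 * X else C 2) * dO (OV r) i

theorem OV_ord (r : ℕ) : ∀ i, r < i → OV r i = 0 := by
  induction r with
  | zero => intro i hi; simp [OV, Nat.pos_iff_ne_zero.1 hi]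
  | succ r ih => intro i hi; simp [OV, dO_zero ih i hi]

theorem OV_lead (r : ℕ) {u : ℝ} (hu : u ≠ 0) : (OV r r).eval u ≠ 0 := by
  induction r with
  | zero => simp [OV]
  | succ r ih =>
    simp only [OV, dO, OV_ord r (r + 1) (by omega), derivative_zero, zero_add, eval_mul]
    refine mul_ne_zero ?_ ih
    split_ifs <;> simp [hu]

noncomputable def VR (b : Bool) (h : ℝ → ℝ) (r : ℕ) : ℝ → ℝ :=
  JJ (if r % 2 = 0 then B0 b else B1 b) (fun t => t ^ (2 * (r / 2)) * h t)

theorem Cls.pmul {c : ℝ} {h : ℝ → ℝ} (hh : Cls c h) (i : ℕ) : Cls c (fun t => t ^ (2 * i) * h t) := by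
  induction i with
  | zero => simpa using hh
  | succ i ih => exact ih.sqmul.congr fun t _ => by ring

theorem opE_OV {b : Bool} {c : ℝ} {h : ℝ → ℝ} (hh : Cls c h) (r : ℕ) : ∀ u ∈ Reg b c,
    opE r (OV r) (J0 b h) u = VR b h r u := by
  have hU := Reg_open b c
  have hS : Smo (J0 b h) (Reg b c) := J0_smooth hh
  induction r with
  | zero => intro u hu; simp [opE, OV, VR, J0]
  | succ r ih =>
    intro u hu
    have d : HasDerivAt (VR b h r) (opE (r + 1) (dO (OV r)) (J0 b h) u) u := by
      refine (opE_deriv hU hS (OV_ord r) hu).congr_of_eventuallyEq ?_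
      filter_upwards [hU.mem_nhds hu] with v hv using (ih v hv).symm
    have hu0 := hu.1
    simp only [OV]
    rw [opE_mul]
    obtain hr | hr := Nat.mod_two_eq_zero_or_one r
    · have e : VR b h r = J0 b (fun t => t ^ (2 * (r / 2)) * h t) := by simp [VR, hr, J0]
      rw [e] at d
      rw [d.unique (J0_deriv (hh.pmul (r / 2)) hu)]
      have e2 : VR b h (r + 1) = J1 b (fun t => t ^ (2 * (r / 2)) * h t) := by
        simp [VR, show (r + 1) % 2 = 1 by omega, J1, show (r + 1) / 2 = r / 2 by omega]
      rw [e2]; simp [hr]; field_simp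
    · have e : VR b h r = J1 b (fun t => t ^ (2 * (r / 2)) * h t) := by simp [VR, hr, J1]
      rw [e] at d
      rw [d.unique (J1_deriv (hh.pmul (r / 2)) hu)]
      have e2 : VR b h (r + 1) u = J0 b (fun t => t ^ 2 * (t ^ (2 * (r / 2)) * h t)) u := by
        simp only [VR, show (r + 1) % 2 = 0 by omega, if_true, show (r + 1) / 2 = r / 2 + 1 by omega]
        exact J0_congr fun t _ => by ring
      rw [e2]; simp [hr]; field_simp

noncomputable def OT : ℕ → ℕ → ℝ[X]
  | 0 => fun i => if i = 0 then X else 0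
  | (r + 1) => fun i => (C 2 * X) * dO (OT r) i

theorem OT_ord (r : ℕ) : ∀ i, r < i → OT r i = 0 := by
  induction r with
  | zero => intro i hi; simp [OT, Nat.pos_iff_ne_zero.1 hi]
  | succ r ih => intro i hi; simp [OT, dO_zero ih i hi]

theorem OT_lead (r : ℕ) (u : ℝ) : (OT r r).eval u = u * (2 * u) ^ r := by
  induction r with
  | zero => simp [OT]
  | succ r ih =>
    simp only [OT, dO, OT_ord r (r + 1) (by omega), derivative_zero, zero_add, eval_mul, ih, eval_C, eval_X]
    ring

theorem opE_OT {l : List Bool} {b : Bool} (r : ℕ) : ∀ u ∈ Reg b (cl l),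
    opE r (OT r) (al l b 0) u = (-1) ^ r * (u * J0 b (GG l r) u) := by
  have hU := Reg_open b (cl l)
  have hS : Smo (al l b 0) (Reg b (cl l)) := J0_smooth (SS_cls l 0)
  induction r with
  | zero =>
    intro u hu
    have : J0 b (GG l 0) u = J0 b (SS l 0) u := J0_congr fun t _ => by simp [GG, RR]
    simp [opE, OT, this, al]
  | succ r ih =>
    intro u hu
    have d : HasDerivAt (fun u => (-1) ^ r * (u * J0 b (GG l r) u)) (opE (r + 1) (dO (OT r)) (al l b 0) u) u := by
      refine (opE_deriv hU hS (OT_ord r) hu).congr_of_eventuallyEq ?_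
      filter_upwards [hU.mem_nhds hu] with v hv using (ih v hv).symm
    simp only [OT]
    rw [opE_mul, d.unique ((uJ0G_deriv r hu).const_mul _)]
    simp; ring

/-! columns -/
def lst (k a : ℕ) : List Bool := List.replicate a true ++ List.replicate (2 * k - a) false

theorem lst_length {k a : ℕ} (ha : a ≤ 2 * k) : (lst k a).length = 2 * k := by simp [lst]; omega
theorem lst_true (k a : ℕ) : (lst k a).count true = a := by simp [lst, List.count_replicate]
theorem lst_false (k a : ℕ) : (lst k a).count false = 2 * k - a := by simp [lst, List.count_replicate]
theorem lst_cl {k a : ℕ} (ha : a ≤ 2 * k) : cl (lst k a) = 2 * k - 2 * a := by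
  rw [cl_eq, lst_true, lst_false]
  push_cast [Nat.cast_sub ha]
  simp [sg]; ring

theorem SS_lst (k a : ℕ) (t : ℝ) : SS (lst k a) 0 t = besselI0 t ^ a * besselK0 t ^ (2 * k - a) := by
  have h : ∀ l : List Bool, SS l 0 t = besselI0 t ^ (l.count true) * besselK0 t ^ (l.count false) := by
    intro l
    induction l with
    | nil => simp [SS]
    | cons b l ih => cases b <;> simp [SS, ih, B0] <;> ring
  rw [h, lst_true, lst_false]

noncomputable def Bv (k : ℕ) (b : Bool) (a : ℕ) : ℝ → ℝ := al (lst k a) b 0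

def RegB (k : ℕ) (b : Bool) (a : ℕ) : Set ℝ := Reg b (cl (lst k a))

theorem Bv_smo (k : ℕ) (b : Bool) (a : ℕ) : Smo (Bv k b a) (RegB k b a) := J0_smooth (SS_cls _ 0)

theorem Bv_ode {k : ℕ} (hk : 1 ≤ k) {b : Bool} {a : ℕ} (ha : a ≤ 2 * k) {u L : ℝ} (hu : u ∈ RegB k b a)
    (hL : Tendsto (fun t => B0 b (Real.sqrt u * t) * GG (lst k a) (2 * k - 1 + 1) t
      - B1 b (Real.sqrt u * t) * GG (lst k a) (2 * k - 1) t) (𝓝[>] 0) (𝓝 L)) :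
    (2 * k + 1).factorial * opE (2 * k - 1) (VV ((2 * k : ℕ) : ℝ) (2 * k - 1)).2 (Bv k b a) u = L := by
  have h := (chain_op (2 * k - 1) u hu).2
  rw [lst_length ha] at h
  rw [Bv, ← h]
  have := aa_last (n := 2 * k - 1) (by rw [lst_length ha]; omega) hu hL
  rwa [show 2 * k - 1 + 2 = 2 * k + 1 by omega] at this

theorem I_ode {k : ℕ} (hk : 1 ≤ k) {a : ℕ} (ha : a ≤ 2 * k) (ha1 : 1 ≤ a) {u : ℝ} (hu : u ∈ RegB k true a) :
    opE (2 * k - 1) (VV ((2 * k : ℕ) : ℝ) (2 * k - 1)).2 (Bv k true a) u = 0 := by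
  have := Bv_ode hk ha hu (bdry_I_zero hu.1 (by rw [lst_length ha]; omega) (by rw [lst_true]; omega))
  have hf : ((2 * k + 1).factorial : ℝ) ≠ 0 := by positivity
  simpa [hf] using this

theorem K_ode {k : ℕ} (hk : 1 ≤ k) {a : ℕ} (ha : a ≤ 2 * k) (ha1 : 2 ≤ a) {u : ℝ} (hu : u ∈ RegB k false a) :
    opE (2 * k - 1) (VV ((2 * k : ℕ) : ℝ) (2 * k - 1)).2 (Bv k false a) u = 0 := by
  have := Bv_ode hk ha hu (bdry_K_zero hu.1 (by rw [lst_length ha]; omega) (by rw [lst_true]; omega))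
  have hf : ((2 * k + 1).factorial : ℝ) ≠ 0 := by positivity
  simpa [hf] using this

noncomputable def cmb (k : ℕ) : ℝ → ℝ := fun u => Bv k true 0 u + (2 * k : ℝ) * Bv k false 1 u

theorem cmb_ode {k : ℕ} (hk : 1 ≤ k) {u : ℝ} (hu : u ∈ RegB k true 0) (hu' : u ∈ RegB k false 1) :
    opE (2 * k - 1) (VV ((2 * k : ℕ) : ℝ) (2 * k - 1)).2 (cmb k) u = 0 := by
  have h1 := Bv_ode hk (a := 0) (by omega) hu (bdry_I hu.1 (by rw [lst_length (by omega)]; omega) (by rw [lst_true]))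
  have h2 := Bv_ode hk (a := 1) (by omega) hu' (bdry_K hu.1 (by rw [lst_length (by omega)]; omega) (by rw [lst_true]))
  have hf : ((2 * k + 1).factorial : ℝ) ≠ 0 := by positivity
  unfold cmb; rw [opE_add ((Reg_open _ _).inter (Reg_open _ _)) (ContDiffOn.mono (Bv_smo k true 0) Set.inter_subset_left)
    (ContDiffOn.mono (Bv_smo k false 1) Set.inter_subset_right) _ ⟨hu, hu'⟩]
  refine mul_left_cancel₀ hf ?_
  rw [mul_add, h1, mul_left_comm, h2, Nat.factorial_succ, pow_succ]
  push_cast [Nat.cast_sub (show 1 ≤ 2 * k by omega)]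
  ring

noncomputable def cl_q (k j q : ℕ) : ℝ → ℝ :=
  if q < k then
    if j + q < k then (if q = 0 then cmb k else Bv k true q) else Bv k false (2 * k - q)
  else Bv k false (q - k + 2)

theorem mem_RegI {k a : ℕ} (ha : a ≤ 2 * k) {u : ℝ} (hu : 0 < u) (h : Real.sqrt u < 2 * k - 2 * a) :
    u ∈ RegB k true a := by
  refine ⟨hu, ?_⟩
  rw [lst_cl ha]; simp [sg]; linarith

theorem mem_RegK {k a : ℕ} (ha : a ≤ 2 * k) {u : ℝ} (hu : 0 < u) (h : 2 * a - 2 * k < Real.sqrt u) :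
    u ∈ RegB k false a := by
  refine ⟨hu, ?_⟩
  rw [lst_cl ha]; simp [sg]; linarith

/-- stage interval -/
def stg (k j : ℕ) : Set ℝ := {u | 0 < u ∧ 2 * (j : ℝ) < Real.sqrt u ∧ (j < k → Real.sqrt u < 2 * j + 2)}

theorem cmb_smo (k : ℕ) : Smo (cmb k) (RegB k true 0 ∩ RegB k false 1) :=
  Smo.add (ContDiffOn.mono (Bv_smo k true 0) Set.inter_subset_left)
    (ContDiffOn.mono (Bv_smo k false 1) Set.inter_subset_right) _

theorem Smo.mono' {φ : ℝ → ℝ} {U V : Set ℝ} (h : Smo φ U) (hV : V ⊆ U) : Smo φ V := ContDiffOn.mono h hV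

theorem col_ok {k j q : ℕ} (hk : 1 ≤ k) (hj : j ≤ k) (hq : q < 2 * k - 1) {U : Set ℝ}
    (hU : U ⊆ {u | 0 < u ∧ (j + q < k → Real.sqrt u < 2 * k - 2 * q) ∧
      (q < k → k ≤ j + q → 2 * (k:ℝ) - 2 * q < Real.sqrt u)}) :
    Smo (cl_q k j q) U ∧ ∀ u ∈ U, opE (2 * k - 1) (VV ((2 * k : ℕ) : ℝ) (2 * k - 1)).2 (cl_q k j q) u = 0 := by
  unfold cl_q
  split_ifs with h1 h2 h3
  · have m1 : U ⊆ RegB k true 0 ∩ RegB k false 1 := fun u hu => by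
      have h := hU hu
      have hs := Real.sqrt_pos.2 h.1
      have := h.2.1 h2
      rw [h3] at this
      have hk' : (1:ℝ) ≤ k := by exact_mod_cast hk
      exact ⟨mem_RegI (by omega) h.1 this, mem_RegK (by omega) h.1 (by push_cast; linarith)⟩
    exact ⟨(cmb_smo k).mono' m1, fun u hu => cmb_ode hk (m1 hu).1 (m1 hu).2⟩
  · have m1 : U ⊆ RegB k true q := fun u hu => mem_RegI (by omega) (hU hu).1 ((hU hu).2.1 h2)
    exact ⟨(Bv_smo _ _ _).mono' m1, fun u hu => I_ode hk (by omega) (by omega) (m1 hu)⟩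
  · have m1 : U ⊆ RegB k false (2 * k - q) := fun u hu => mem_RegK (by omega) (hU hu).1 (by
      have := (hU hu).2.2 h1 (by omega)
      push_cast [Nat.cast_sub (show q ≤ 2 * k by omega)]
      linarith)
    exact ⟨(Bv_smo _ _ _).mono' m1, fun u hu => K_ode hk (by omega) (by omega) (m1 hu)⟩
  · have m1 : U ⊆ RegB k false (q - k + 2) := fun u hu => mem_RegK (by omega) (hU hu).1 (by
      have h := hU hu
      have hs := Real.sqrt_pos.2 h.1
      have : ((q - k + 2 : ℕ) : ℝ) ≤ k := by exact_mod_cast (by omega)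
      linarith)
    exact ⟨(Bv_smo _ _ _).mono' m1, fun u hu => K_ode hk (by omega) (by omega) (m1 hu)⟩

theorem stg_sub {k j q : ℕ} (hj : j ≤ k) : stg k j ⊆ {u | 0 < u ∧ (j + q < k → Real.sqrt u < 2 * k - 2 * q) ∧
      (q < k → k ≤ j + q → 2 * (k:ℝ) - 2 * q < Real.sqrt u)} := by
  intro u hu
  refine ⟨hu.1, fun h => ?_, fun h h' => ?_⟩
  · have := hu.2.2 (by omega)
    have : (j:ℝ) + q + 1 ≤ k := by exact_mod_cast h
    linarith
  · have := hu.2.1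
    have : (k:ℝ) ≤ j + q := by exact_mod_cast h'
    linarith

theorem stg_eq {k j : ℕ} : stg k j = if j < k then Set.Ioo ((2 * (j:ℝ)) ^ 2) ((2 * (j:ℝ) + 2) ^ 2) else Set.Ioi ((2 * (j:ℝ)) ^ 2) := by
  ext u
  have h1 : ∀ u : ℝ, (0 < u ∧ 2 * (j : ℝ) < Real.sqrt u) ↔ (2 * (j:ℝ)) ^ 2 < u := fun u => by
    rw [Real.lt_sqrt (by positivity)]
    exact ⟨fun h => h.2, fun h => ⟨lt_of_le_of_lt (by positivity) h, h⟩⟩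
  unfold stg
  split_ifs with h
  · rw [Set.mem_Ioo, ← h1, ← Real.sqrt_lt' (by positivity)]
    simp [h, and_assoc]
  · rw [Set.mem_Ioi, ← h1]; simp [h]

theorem stg_open (k j : ℕ) : IsOpen (stg k j) := by
  rw [stg_eq]; split_ifs; exacts [isOpen_Ioo, isOpen_Ioi]

theorem stg_conn (k j : ℕ) : IsPreconnected (stg k j) := by
  rw [stg_eq]; split_ifs; exacts [isPreconnected_Ioo, isPreconnected_Ioi]

theorem PP_ne {k j : ℕ} (hj : j ≤ k) {u : ℝ} (hu : u ∈ stg k j) : PP k u ≠ 0 := by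
  refine mul_ne_zero (pow_ne_zero _ hu.1.ne') (Finset.prod_ne_zero_iff.2 fun i hi => ?_)
  rw [Finset.mem_Icc] at hi
  intro h
  have h2 : Real.sqrt u = 2 * i := by
    rw [show u = (2 * (i:ℝ)) ^ 2 by linarith, Real.sqrt_sq (by positivity)]
  have h3 := hu.2.1
  rw [h2] at h3
  have h4 : j < i := by exact_mod_cast (by linarith : (j:ℝ) < i)
  have h5 := hu.2.2 (by omega)
  rw [h2] at h5
  have h6 : i < j + 1 := by exact_mod_cast (by linarith : (i:ℝ) < j + 1)
  omega

theorem stage_const {k j : ℕ} (hk : 1 ≤ k) (hj : j ≤ k) : ∃ c, ∀ u ∈ stg k j,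
    Ph k u * Wr (2 * k - 1) (fun q => cl_q k j q) u = c :=
  abel hk (stg_open k j) (stg_conn k j) (fun u hu => hu.1) (fun u hu => PP_ne hj hu)
    (fun q => (col_ok hk hj q.2 (stg_sub hj)).1) (fun q => (col_ok hk hj q.2 (stg_sub hj)).2)

theorem thr_main {k : ℕ} (hk : 1 ≤ k) {s c u0 LF Lh : ℝ} {F h : ℝ → ℝ} (hFc : ContinuousOn F (Set.Ioi 0))
    (hhc : ContinuousOn h (Set.Ioi 0))
    (hFb : ∃ C, ∀ z, 0 < z → |Real.sqrt z * Real.exp (s * z) * F z| ≤ C)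
    (hFl : Tendsto (fun z => Real.sqrt z * Real.exp (s * z) * F z) atTop (𝓝 LF))
    (hhb : ∃ C, ∀ z, 0 < z → |z ^ k * Real.exp (c * z) * h z| ≤ C)
    (hhl : Tendsto (fun z => z ^ k * Real.exp (c * z) * h z) atTop (𝓝 Lh))
    (hu0 : 0 < u0) (h0 : c + s * Real.sqrt u0 = 0) :
    Tendsto (fun u => (c + s * Real.sqrt u) ^ ((k : ℝ) - 1 / 2) *
        JJ F (fun t => t ^ (2 * (k - 1)) * h t) u)
      (𝓝[{u | 0 < c + s * Real.sqrt u}] u0)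
      (𝓝 ((Real.sqrt (Real.sqrt u0))⁻¹ * (Real.Gamma ((k : ℝ) - 1 / 2) * (LF * Lh)))) := by
  have hk' : (1:ℝ) ≤ k := by exact_mod_cast hk
  set κ : ℝ := (k : ℝ) - 1 / 2 with hκ
  have hκ0 : 0 < κ := by rw [hκ]; linarith
  obtain ⟨CF, hFb⟩ := hFb
  obtain ⟨Ch, hhb⟩ := hhb
  set AF : ℝ → ℝ := fun z => Real.sqrt z * Real.exp (s * z) * F z with hAF
  set Ah : ℝ → ℝ := fun z => z ^ k * Real.exp (c * z) * h z with hAh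
  have hAFc : ContinuousOn AF (Set.Ioi 0) := by
    refine ContinuousOn.mul (by fun_prop) hFc
  have hAhc : ContinuousOn Ah (Set.Ioi 0) := by
    refine ContinuousOn.mul (by fun_prop) hhc
  set G : ℝ → ℝ → ℝ := fun u x => Real.exp (-x) * x ^ (κ - 1) *
    (AF (Real.sqrt u * (x / (c + s * Real.sqrt u))) * Ah (x / (c + s * Real.sqrt u))) with hG
  have ev : ∀ᶠ u in 𝓝[{u | 0 < c + s * Real.sqrt u}] u0, 0 < u ∧ 0 < c + s * Real.sqrt u := by
    filter_upwards [self_mem_nhdsWithin, nhdsWithin_le_nhds (lt_mem_nhds hu0)] with u h1 h2 using ⟨h2, h1⟩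
  have key : ∀ u, 0 < u → 0 < c + s * Real.sqrt u → (c + s * Real.sqrt u) ^ κ *
        JJ F (fun t => t ^ (2 * (k - 1)) * h t) u = (Real.sqrt (Real.sqrt u))⁻¹ * ∫ x in Set.Ioi (0:ℝ), G u x := by
    intro u hu hd
    set d := c + s * Real.sqrt u with hdd
    have hsu := Real.sqrt_pos.2 hu
    have e : JJ F (fun t => t ^ (2 * (k - 1)) * h t) u =
        ∫ t in Set.Ioi (0:ℝ), ((Real.sqrt (Real.sqrt u))⁻¹ * (d ^ (κ - 1))⁻¹) * G u (d * t) := by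
      refine setIntegral_congr_fun measurableSet_Ioi fun t ht => ?_
      have ht' : 0 < t := ht
      simp only [hG, hAF, hAh]
      rw [← hdd, mul_div_cancel_left₀ t hd.ne', Real.mul_rpow hd.le ht'.le, Real.sqrt_mul hsu.le]
      have e1 : Real.exp (-(d * t)) * Real.exp (s * (Real.sqrt u * t)) * Real.exp (c * t) = 1 := by
        rw [← Real.exp_add, ← Real.exp_add, Real.exp_eq_one_iff, hdd]; ring
      have e2 : t ^ (κ - 1) * Real.sqrt t * t ^ k = t ^ (2 * (k - 1)) * t := by
        rw [Real.sqrt_eq_rpow, ← Real.rpow_natCast t k, ← pow_succ, ← Real.rpow_natCast t (2 * (k - 1) + 1),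
          ← Real.rpow_add ht', ← Real.rpow_add ht']
        congr 1
        push_cast [Nat.cast_sub hk]
        rw [hκ]; ring
      have p1 : 0 < d ^ (κ - 1) := Real.rpow_pos_of_pos hd _
      have p2 : 0 < Real.sqrt (Real.sqrt u) := Real.sqrt_pos.2 hsu
      have : F (Real.sqrt u * t) * (t ^ (2 * (k - 1)) * h t) * t =
        (Real.exp (-(d * t)) * Real.exp (s * (Real.sqrt u * t)) * Real.exp (c * t)) *
        F (Real.sqrt u * t) * h t * (t ^ (2 * (k - 1)) * t) := by rw [e1]; ring
      rw [this, ← e2]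
      field_simp
    rw [e, integral_const_mul, integral_comp_mul_left_Ioi (fun x => G u x) 0 hd, mul_zero, smul_eq_mul]
    have p1 : 0 < d ^ (κ - 1) := Real.rpow_pos_of_pos hd _
    have : d ^ κ = d ^ (κ - 1) * d := by rw [Real.rpow_sub_one hd.ne']; field_simp
    rw [this]
    field_simp
  have hlim : Tendsto (fun u => ∫ x in Set.Ioi (0:ℝ), G u x) (𝓝[{u | 0 < c + s * Real.sqrt u}] u0)
      (𝓝 (∫ x in Set.Ioi (0:ℝ), Real.exp (-x) * x ^ (κ - 1) * (LF * Lh))) := by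
    refine tendsto_integral_filter_of_dominated_convergence
      (fun x => Real.exp (-x) * x ^ (κ - 1) * (CF * Ch)) ?_ ?_ ?_ ?_
    · filter_upwards [ev] with u hu
      have hsu := Real.sqrt_pos.2 hu.1
      refine ContinuousOn.aestronglyMeasurable ?_ measurableSet_Ioi
      refine ContinuousOn.mul (ContinuousOn.mul (by fun_prop) ?_) (ContinuousOn.mul ?_ ?_)
      · exact ContinuousOn.rpow_const continuousOn_id fun x hx => Or.inl (ne_of_gt hx)
      · exact hAFc.comp (by fun_prop) fun x hx => mul_pos hsu (div_pos hx hu.2)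
      · exact hAhc.comp (by fun_prop) fun x hx => (div_pos hx hu.2)
    · filter_upwards [ev] with u hu
      have hsu := Real.sqrt_pos.2 hu.1
      refine (ae_restrict_iff' measurableSet_Ioi).2 (Eventually.of_forall fun x hx => ?_)
      have hx' : 0 < x := hx
      have q1 := hFb _ (mul_pos hsu (div_pos hx hu.2))
      have q2 := hhb _ (div_pos hx hu.2)
      have q3 : 0 ≤ Real.exp (-x) * x ^ (κ - 1) := by positivity
      simp only [hG, Real.norm_eq_abs]
      rw [abs_mul, abs_of_nonneg q3, abs_mul]
      gcongr ?_ * ?_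
      exact mul_le_mul q1 q2 (abs_nonneg _) ((abs_nonneg _).trans q1)
    · exact (Real.GammaIntegral_convergent hκ0).mul_const _
    · refine (ae_restrict_iff' measurableSet_Ioi).2 (Eventually.of_forall fun x hx => ?_)
      have hx' : 0 < x := hx
      have t1 : Tendsto (fun u => c + s * Real.sqrt u) (𝓝[{u | 0 < c + s * Real.sqrt u}] u0) (𝓝[>] 0) := by
        refine tendsto_nhdsWithin_iff.2 ⟨?_, ev.mono fun u hu => hu.2⟩
        have := (by fun_prop : Continuous fun u : ℝ => c + s * Real.sqrt u).tendsto u0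
        rw [h0] at this
        exact this.mono_left nhdsWithin_le_nhds
      have t2 : Tendsto (fun u => x / (c + s * Real.sqrt u)) (𝓝[{u | 0 < c + s * Real.sqrt u}] u0) atTop := by
        have := (tendsto_inv_nhdsGT_zero.comp t1).const_mul_atTop hx'
        simpa [div_eq_mul_inv] using this
      have t3 : Tendsto (fun u => Real.sqrt u * (x / (c + s * Real.sqrt u))) (𝓝[{u | 0 < c + s * Real.sqrt u}] u0) atTop := by
        refine Tendsto.pos_mul_atTop (Real.sqrt_pos.2 hu0) ?_ t2
        exact (Real.continuous_sqrt.tendsto u0).mono_left nhdsWithin_le_nhds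
      exact ((hFl.comp t3).mul (hhl.comp t2)).const_mul _
  rw [integral_mul_const, ← Real.Gamma_eq_integral hκ0] at hlim
  have hc : Tendsto (fun u => (Real.sqrt (Real.sqrt u))⁻¹) (𝓝[{u | 0 < c + s * Real.sqrt u}] u0)
      (𝓝 (Real.sqrt (Real.sqrt u0))⁻¹) := by
    refine Tendsto.inv₀ ?_ (Real.sqrt_pos.2 (Real.sqrt_pos.2 hu0)).ne'
    exact ((by fun_prop : Continuous fun u : ℝ => Real.sqrt (Real.sqrt u)).tendsto u0).mono_left nhdsWithin_le_nhds
  refine (hc.mul hlim).congr' ?_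
  filter_upwards [ev] with u hu using (key u hu.1 hu.2).symm

theorem thr_small {k i : ℕ} (hi : i + 2 ≤ k) {s c R : ℝ} {F h : ℝ → ℝ} (hF : Cls s F) (hh : Cls c h)
    (hFb : ∃ C, 0 ≤ C ∧ ∀ z, 1 ≤ z → |F z| ≤ C * z * Real.exp (-(s * z)))
    (hhb : ∃ C, ∀ z, 0 < z → |z ^ k * Real.exp (c * z) * h z| ≤ C) :
    ∃ C, ∀ u, 1 ≤ Real.sqrt u → Real.sqrt u ≤ R → 0 < c + s * Real.sqrt u → c + s * Real.sqrt u ≤ 1 →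
      |JJ F (fun t => t ^ (2 * i) * h t) u| ≤ C / (c + s * Real.sqrt u) ^ (k - 1) := by
  obtain ⟨_, CF, p, hCF, f2⟩ := hF
  obtain ⟨_, Ch, q, hCh, h2⟩ := hh
  obtain ⟨CG, hCG, hFb⟩ := hFb
  obtain ⟨CH, hhb⟩ := hhb
  have hCH : 0 ≤ CH := (abs_nonneg _).trans (hhb 1 one_pos)
  obtain ⟨D1, hD1, b1⟩ := t_om_bound (p + q) one_pos
  obtain ⟨D2, hD2, b2⟩ := pow_le_exp_bound (k - 2) (half_pos one_pos)
  set OR := 1 + R + R with hOR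
  set E1 := CF * Ch * |OR| ^ p * D1 * Real.exp 1 with hE1
  set E2 := CG * |R| * CH * D2 with hE2
  have hE1' : 0 ≤ E1 := by positivity
  have hE2' : 0 ≤ E2 := by positivity
  refine ⟨(E1 + E2) * 2, fun u hu1 huR hd hd1 => ?_⟩
  set d := c + s * Real.sqrt u with hdd
  have hsu : 0 < Real.sqrt u := by linarith
  have hR : 0 < R := by linarith
  have pt : ∀ t, 0 < t → |F (Real.sqrt u * t) * (t ^ (2 * i) * h t) * t| ≤
      ((E1 + E2) / d ^ (k - 2)) * Real.exp (-((d / 2) * t)) := by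
    intro t ht
    rw [div_mul_eq_mul_div, le_div_iff₀ (by positivity)]
    have eexp : Real.exp (-(s * (Real.sqrt u * t))) * Real.exp (-(c * t)) = Real.exp (-((d / 2) * t)) * Real.exp (-((d / 2) * t)) := by
      rw [← Real.exp_add, ← Real.exp_add, hdd]; congr 1; ring
    have ee0 : 0 ≤ d / 2 * t := by positivity
    have ee1 : Real.exp (-((d / 2) * t)) ≤ 1 := Real.exp_le_one_iff.2 (by linarith)
    rw [abs_mul, abs_mul, abs_mul, abs_of_pos ht, abs_of_pos (by positivity : 0 < t ^ (2 * i))]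
    rcases le_total t 1 with h1 | h1
    · have o1 : om (Real.sqrt u * t) ≤ |OR| * om t := by
        refine (om_mul hsu ht).trans ?_
        have := om_pos ht
        gcongr
        rw [abs_of_pos (by linarith)]
        unfold om
        rw [abs_of_nonneg (Real.log_nonneg hu1)]
        have := Real.log_le_sub_one_of_pos hsu
        linarith
      have o2 := om_pos (mul_pos hsu ht)
      have f3 : |F (Real.sqrt u * t)| ≤ CF * (|OR| * om t) ^ p * Real.exp (-(s * (Real.sqrt u * t))) := by
        refine (f2 _ (mul_pos hsu ht)).trans ?_
        gcongr
      have ho := om_pos ht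
      calc |F (Real.sqrt u * t)| * (t ^ (2 * i) * |h t|) * t * d ^ (k - 2)
          ≤ (CF * (|OR| * om t) ^ p * Real.exp (-(s * (Real.sqrt u * t)))) * (1 * (Ch * om t ^ q * Real.exp (-(c * t)))) * t * 1 := by
            gcongr
            · exact pow_le_one₀ ht.le h1
            · exact h2 t ht
            · exact pow_le_one₀ hd.le hd1
        _ = CF * Ch * |OR| ^ p * (t * om t ^ (p + q)) * (Real.exp (-(s * (Real.sqrt u * t))) * Real.exp (-(c * t))) := by
            rw [mul_pow, pow_add]; ring
        _ ≤ CF * Ch * |OR| ^ p * (D1 * Real.exp 1) * (Real.exp (-((d / 2) * t)) * 1) := by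
            rw [eexp]
            gcongr ?_ * ?_
            · gcongr ?_ * ?_
              refine (b1 t ht).trans ?_
              gcongr
              linarith
            · gcongr
        _ = E1 * Real.exp (-((d / 2) * t)) := by rw [hE1]; ring
        _ ≤ (E1 + E2) * Real.exp (-((d / 2) * t)) := by gcongr; linarith
    · have f3 := hFb (Real.sqrt u * t) (by nlinarith)
      have h3 := hhb t ht
      rw [abs_mul, abs_of_pos (by positivity)] at h3
      have h4 : |h t| * t ^ k ≤ CH * Real.exp (-(c * t)) := by
        rw [Real.exp_neg, ← div_eq_mul_inv, le_div_iff₀ (Real.exp_pos _)]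
        linarith
      have pp : t ^ (2 * i) * t * t ≤ t ^ k * t ^ (k - 2) := by
        rw [← pow_succ, ← pow_succ, ← pow_add]
        exact pow_le_pow_right₀ h1 (by omega)
      have b3 := b2 (d * t) (by positivity)
      rw [mul_pow] at b3
      calc |F (Real.sqrt u * t)| * (t ^ (2 * i) * |h t|) * t * d ^ (k - 2)
          ≤ (CG * (Real.sqrt u * t) * Real.exp (-(s * (Real.sqrt u * t)))) * (t ^ (2 * i) * |h t|) * t * d ^ (k - 2) := by
            gcongr
        _ = CG * Real.sqrt u * Real.exp (-(s * (Real.sqrt u * t))) * |h t| * d ^ (k - 2) * (t ^ (2 * i) * t * t) := by ring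
        _ ≤ CG * |R| * Real.exp (-(s * (Real.sqrt u * t))) * |h t| * d ^ (k - 2) * (t ^ k * t ^ (k - 2)) := by
            rw [abs_of_pos hR]
            gcongr
        _ = CG * |R| * Real.exp (-(s * (Real.sqrt u * t))) * (|h t| * t ^ k) * (d ^ (k - 2) * t ^ (k - 2)) := by ring
        _ ≤ CG * |R| * Real.exp (-(s * (Real.sqrt u * t))) * (CH * Real.exp (-(c * t))) * (D2 * Real.exp (1 / 2 * (d * t))) := by
            gcongr
        _ = E2 * (Real.exp (-(s * (Real.sqrt u * t))) * Real.exp (-(c * t))) * Real.exp (1 / 2 * (d * t)) := by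
            rw [hE2]; ring
        _ = E2 * Real.exp (-((d / 2) * t)) := by
            have e0 : Real.exp (-((d / 2) * t)) * Real.exp (1 / 2 * (d * t)) = 1 := by
              rw [← Real.exp_add, show -((d / 2) * t) + 1 / 2 * (d * t) = 0 by ring, Real.exp_zero]
            rw [eexp]
            linear_combination E2 * Real.exp (-((d / 2) * t)) * e0
        _ ≤ (E1 + E2) * Real.exp (-((d / 2) * t)) := by gcongr; linarith
  have hI := exp_int (half_pos hd) ((E1 + E2) / d ^ (k - 2))
  have := norm_integral_le_of_norm_le hI ((ae_restrict_iff' measurableSet_Ioi).2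
    (Eventually.of_forall fun t ht => (Real.norm_eq_abs _).le.trans (pt t ht)))
  rw [Real.norm_eq_abs] at this
  refine this.trans (le_of_eq ?_)
  rw [integral_const_mul]
  have e : ∫ t in Set.Ioi (0:ℝ), Real.exp (-((d / 2) * t)) = 2 / d := by
    have := integral_exp_mul_Ioi (a := -(d / 2)) (by linarith) 0
    simp only [neg_mul] at this
    rw [this]; simp
  rw [e, show k - 1 = k - 2 + 1 by omega, pow_succ]
  field_simp

noncomputable def lB (b : Bool) : ℝ := if b then (1 / Real.pi) * Real.sqrt (Real.pi / 2) else Real.sqrt (Real.pi / 2)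

theorem B0_asy (b : Bool) : (∃ C, ∀ z, 0 < z → |Real.sqrt z * Real.exp (sg b * z) * B0 b z| ≤ C) ∧
    Tendsto (fun z => Real.sqrt z * Real.exp (sg b * z) * B0 b z) atTop (𝓝 (lB b)) := by
  cases b
  · simp only [sg, B0, lB, one_mul, Bool.false_eq_true, if_false]
    refine ⟨⟨Real.sqrt (Real.pi / 2), fun z hz => ?_⟩, AK_tendsto⟩
    rw [abs_of_nonneg (mul_nonneg (by positivity) (K0_nonneg z))]
    exact AK_le hz
  · simp only [sg, B0, lB, neg_mul, one_mul, if_true]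
    obtain ⟨C, hC⟩ := AI_le
    refine ⟨⟨C, fun z hz => ?_⟩, AI_tendsto⟩
    rw [abs_of_nonneg (mul_nonneg (by positivity) (I0_nonneg z))]
    exact hC z hz

noncomputable def lS : List Bool → ℝ
  | [] => 1
  | b :: l => lB b * lS l

theorem lS_eq (l : List Bool) : lS l = Real.sqrt (Real.pi / 2) ^ l.length * (1 / Real.pi) ^ l.count true := by
  induction l with
  | nil => simp [lS]
  | cons b l ih => cases b <;> simp [lS, lB, ih, pow_succ] <;> ring

theorem SS_asy (l : List Bool) :
    (∃ C, ∀ z, 0 < z → |Real.sqrt z ^ l.length * Real.exp (cl l * z) * SS l 0 z| ≤ C) ∧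
    Tendsto (fun z => Real.sqrt z ^ l.length * Real.exp (cl l * z) * SS l 0 z) atTop (𝓝 (lS l)) := by
  induction l with
  | nil => simp [SS, cl, lS]; exact ⟨1, fun z hz => le_rfl⟩
  | cons b l ih =>
    have e : ∀ z, Real.sqrt z ^ (b :: l).length * Real.exp (cl (b :: l) * z) * SS (b :: l) 0 z =
      (Real.sqrt z * Real.exp (sg b * z) * B0 b z) * (Real.sqrt z ^ l.length * Real.exp (cl l * z) * SS l 0 z) := by
      intro z
      simp only [SS, cl, List.map_cons, List.sum_cons, List.length_cons, add_mul, Real.exp_add, pow_succ]; ring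
    obtain ⟨⟨C, hC⟩, h1⟩ := B0_asy b
    obtain ⟨⟨D, hD⟩, h2⟩ := ih
    simp only [e]
    refine ⟨⟨C * D, fun z hz => ?_⟩, h1.mul h2⟩
    rw [abs_mul]
    exact mul_le_mul (hC z hz) (hD z hz) (abs_nonneg _) ((abs_nonneg _).trans (hC z hz))

theorem B_big (b b' : Bool) : ∃ C, 0 ≤ C ∧ ∀ z, 1 ≤ z →
    |(if b' then B0 b else B1 b) z| ≤ C * z * Real.exp (-(sg b * z)) := by
  cases b'
  · obtain ⟨hc, -⟩ := Cls_B1 b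
    refine ⟨2, by norm_num, fun z hz => ?_⟩
    have hz0 : 0 < z := by linarith
    cases b
    · simp only [B1, sg, Bool.false_eq_true, if_false, abs_neg, one_mul]
      rw [abs_of_nonneg (mul_nonneg hz0.le (K1_nonneg z))]
      refine (tK1_bounds hz0).2.trans ?_
      rw [mul_comm]
      gcongr
      linarith
    · simp only [B1, sg, Bool.false_eq_true, if_false, if_true, neg_mul, one_mul, neg_neg]
      rw [abs_mul, abs_of_pos hz0]
      have := (I1_abs_le (t := z)).trans (I0_le hz0.le)
      have := mul_le_mul_of_nonneg_left this hz0.le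
      have := Real.exp_pos z
      nlinarith
  · obtain ⟨C, hC⟩ := (B0_asy b).1
    refine ⟨C, (abs_nonneg _).trans (hC 1 one_pos), fun z hz => ?_⟩
    have hz0 : 0 < z := by linarith
    have h := hC z hz0
    rw [abs_mul, abs_of_pos (by positivity)] at h
    simp only [if_true]
    have s1 : 1 ≤ Real.sqrt z := Real.one_le_sqrt.2 hz
    have h2 : Real.exp (sg b * z) * |B0 b z| ≤ C * z := by
      have : 0 ≤ Real.exp (sg b * z) * |B0 b z| := by positivity
      have hC0 := (abs_nonneg _).trans (hC 1 one_pos)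
      nlinarith
    rw [Real.exp_neg, ← div_eq_mul_inv, le_div_iff₀ (Real.exp_pos _)]
    linarith

theorem Bv_thr {k : ℕ} (hk : 1 ≤ k) {b : Bool} {a : ℕ} (ha : a ≤ 2 * k) {u0 : ℝ} (hu1 : 1 < Real.sqrt u0)
    (h0 : cl (lst k a) + sg b * Real.sqrt u0 = 0) {r : ℕ} (hr : r < 2 * k - 1) :
    Tendsto (fun u => (cl (lst k a) + sg b * Real.sqrt u) ^ ((k:ℝ) - 1 / 2) * opE r (OV r) (Bv k b a) u)
      (𝓝[{u | 0 < cl (lst k a) + sg b * Real.sqrt u}] u0)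
      (𝓝 (if r = 2 * k - 2 then (Real.sqrt (Real.sqrt u0))⁻¹ * (Real.Gamma ((k:ℝ) - 1 / 2) * (lB b * lS (lst k a))) else 0)) := by
  have hu0 : 0 < u0 := Real.sqrt_pos.1 (by linarith)
  have hcs : Continuous fun u : ℝ => cl (lst k a) + sg b * Real.sqrt u := by fun_prop
  have ev : ∀ᶠ u in 𝓝[{u | 0 < cl (lst k a) + sg b * Real.sqrt u}] u0, 0 < u ∧ 0 < cl (lst k a) + sg b * Real.sqrt u :=
    ((eventually_gt_nhds hu0).filter_mono nhdsWithin_le_nhds).and self_mem_nhdsWithin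
  have hB : ∀ᶠ u in 𝓝[{u | 0 < cl (lst k a) + sg b * Real.sqrt u}] u0, opE r (OV r) (Bv k b a) u = VR b (SS (lst k a) 0) r u := by
    filter_upwards [ev] with u hu
    exact opE_OV (SS_cls _ 0) r u hu
  have hsl : ∀ z : ℝ, 0 < z → Real.sqrt z ^ (lst k a).length = z ^ k := fun z hz => by
    rw [lst_length ha, pow_mul, Real.sq_sqrt hz.le]
  obtain ⟨⟨C, hC⟩, hl⟩ := SS_asy (lst k a)
  have hC' : ∃ C, ∀ z, 0 < z → |z ^ k * Real.exp (cl (lst k a) * z) * SS (lst k a) 0 z| ≤ C :=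
    ⟨C, fun z hz => by rw [← hsl z hz]; exact hC z hz⟩
  split_ifs with h
  · have := thr_main hk (Cls_B0 b).1 (SS_cls (lst k a) 0).1 (B0_asy b).1 (B0_asy b).2 hC'
      (hl.congr' (by filter_upwards [eventually_gt_atTop 0] with z hz; rw [hsl z hz])) hu0 h0
    refine this.congr' ?_
    filter_upwards [hB] with u hu
    rw [hu, VR, if_pos (by omega), show r / 2 = k - 1 by omega]
  · obtain ⟨C, hC⟩ := thr_small (k := k) (i := r / 2) (by omega) (s := sg b) (c := cl (lst k a)) (R := Real.sqrt u0 + 1)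
      (F := if r % 2 = 0 then B0 b else B1 b) (h := SS (lst k a) 0)
      (by split_ifs; exacts [Cls_B0 b, Cls_B1 b]) (SS_cls _ 0)
      (by have := B_big b (decide (r % 2 = 0)); simpa using this) hC'
    have t1 : Tendsto (fun u => cl (lst k a) + sg b * Real.sqrt u) (𝓝[{u | 0 < cl (lst k a) + sg b * Real.sqrt u}] u0) (𝓝 0) := by
      have := hcs.tendsto u0
      rw [h0] at this
      exact this.mono_left nhdsWithin_le_nhds
    have t2 : Tendsto (fun u => |C| * (cl (lst k a) + sg b * Real.sqrt u) ^ (1 / 2 : ℝ)) (𝓝[{u | 0 < cl (lst k a) + sg b * Real.sqrt u}] u0) (𝓝 0) := by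
      have := (t1.rpow_const (p := 1 / 2) (Or.inr (by norm_num))).const_mul |C|
      simpa using this
    have ts := ((Real.continuous_sqrt.tendsto u0).mono_left (nhdsWithin_le_nhds (s := {u | 0 < cl (lst k a) + sg b * Real.sqrt u})))
    refine squeeze_zero_norm' ?_ t2
    filter_upwards [hB, ev, t1.eventually (ge_mem_nhds one_pos), ts.eventually (le_mem_nhds hu1),
      ts.eventually (ge_mem_nhds (lt_add_one _))] with u h1 h2 h3 h4 h5
    have h6 := hC u h4 h5 h2.2 h3
    rw [h1, VR, Real.norm_eq_abs, abs_mul, abs_of_nonneg (Real.rpow_nonneg h2.2.le _)]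
    set d := cl (lst k a) + sg b * Real.sqrt u with hd
    have hd0 : 0 < d := h2.2
    calc _ ≤ d ^ ((k:ℝ) - 1 / 2) * (C / d ^ (k - 1)) := by gcongr
      _ ≤ d ^ ((k:ℝ) - 1 / 2) * (|C| / d ^ (k - 1)) := by gcongr; exact le_abs_self C
      _ = |C| * d ^ (1 / 2 : ℝ) := by
        rw [show (k:ℝ) - 1 / 2 = 1 / 2 + ((k - 1 : ℕ) : ℝ) by push_cast [Nat.cast_sub hk]; ring,
          Real.rpow_add hd0, Real.rpow_natCast]
        field_simp

theorem thr_side {k : ℕ} {l : Filter ℝ} [l.NeBot] {φ : Fin (2 * k - 1) → ℝ → ℝ} {q : Fin (2 * k - 1)}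
    {δ R : ℝ → ℝ} {R0 c C u0 : ℝ} {V0 : Matrix (Fin (2 * k - 1)) (Fin (2 * k - 1)) ℝ} (hlu : l ≤ 𝓝 u0)
    (hPh : ∀ᶠ u in l, Ph k u = δ u * R u) (hR : Tendsto R l (𝓝 R0))
    (hc : ∀ᶠ u in l, Ph k u * Wr (2 * k - 1) φ u = c)
    (hV : ∀ r p : Fin (2 * k - 1), p ≠ q → Tendsto (fun u => opE r (OV r) (φ p) u) l (𝓝 (V0 r p)))
    (hS : ∀ r : Fin (2 * k - 1), Tendsto (fun u => δ u * opE r (OV r) (φ q) u) l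
      (𝓝 (if (r : ℕ) = 2 * k - 2 then C else 0))) :
    (∏ r : Fin (2 * k - 1), (OV r r).eval u0) * c =
      R0 * (C * Matrix.det (V0.updateCol q (fun r => if (r : ℕ) = 2 * k - 2 then 1 else 0))) := by
  set M : ℝ → Matrix (Fin (2 * k - 1)) (Fin (2 * k - 1)) ℝ :=
    fun u => Matrix.of fun r p => opE r (OV r) (φ p) u with hM
  have t1 : Tendsto (fun u => ((M u).updateCol q (δ u • fun r => M u r q)).det) l
      (𝓝 (V0.updateCol q (C • fun r : Fin (2 * k - 1) => if (r : ℕ) = 2 * k - 2 then (1:ℝ) else 0)).det) := by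
    have hcont : Continuous (fun A : Matrix (Fin (2 * k - 1)) (Fin (2 * k - 1)) ℝ => A.det) := continuous_id.matrix_det
    refine (hcont.tendsto _).comp ?_
    refine tendsto_pi_nhds.2 fun r => tendsto_pi_nhds.2 fun p => ?_
    by_cases hp : p = q
    · subst hp
      simpa [Matrix.updateCol_self, hM] using hS r
    · simpa [Matrix.updateCol_ne hp, hM] using hV r p hp
  have t2 := hR.mul t1
  rw [Matrix.det_updateCol_smul] at t2
  have t3 : Tendsto (fun u => (∏ r : Fin (2 * k - 1), (OV r r).eval u) * c) l
      (𝓝 ((∏ r : Fin (2 * k - 1), (OV r r).eval u0) * c)) := by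
    refine Tendsto.mul_const _ (tendsto_finsetProd _ fun r _ => ?_)
    exact ((OV r r).continuous.tendsto u0).mono_left hlu
  refine tendsto_nhds_unique (t3.congr' ?_) t2
  filter_upwards [hPh, hc] with u h1 h2
  rw [Matrix.det_updateCol_smul]
  have : (M u).updateCol q (fun r => M u r q) = M u := by
    ext r p
    by_cases hp : p = q
    · subst hp; simp
    · simp [Matrix.updateCol_ne hp]
  rw [this, hM]
  beta_reduce
  rw [Wr_rows OV OV_ord, ← h2, h1]
  ring

noncomputable def Qj (k j : ℕ) (u : ℝ) : ℝ :=
  (2 * j + Real.sqrt u) * u ^ k * ∏ i ∈ (Finset.Icc 1 k).erase j, ((2 * (i : ℝ)) ^ 2 - u)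

theorem Ph_split {k j : ℕ} (hj1 : 1 ≤ j) (hj : j ≤ k) {u d : ℝ} (hu : 0 < u) (hd : 0 < d)
    (h : d = 2 * j - Real.sqrt u ∨ d = Real.sqrt u - 2 * j) :
    Ph k u = d ^ ((k:ℝ) - 1 / 2) * (Qj k j u ^ 2) ^ (((k:ℝ) - 1 / 2) / 2) := by
  have e : PP k u ^ 2 = d ^ 2 * Qj k j u ^ 2 := by
    unfold PP Qj
    rw [← Finset.mul_prod_erase _ _ (Finset.mem_Icc.2 ⟨hj1, hj⟩)]
    have hs := Real.sq_sqrt hu.le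
    rw [show (2 * (j:ℝ)) ^ 2 - u = (2 * j - Real.sqrt u) * (2 * j + Real.sqrt u) by rw [← hs]; simp; ring]
    rcases h with h | h <;> rw [h] <;> ring
  unfold Ph
  rw [e, Real.mul_rpow (by positivity) (by positivity)]
  congr 1
  rw [← Real.rpow_natCast, ← Real.rpow_mul hd.le]
  congr 1; push_cast; ring

theorem Qj_lim {k j : ℕ} (hj1 : 1 ≤ j) : Tendsto (fun u => (Qj k j u ^ 2) ^ (((k:ℝ) - 1 / 2) / 2))
    (𝓝 ((2 * (j:ℝ)) ^ 2)) (𝓝 ((Qj k j ((2 * (j:ℝ)) ^ 2) ^ 2) ^ (((k:ℝ) - 1 / 2) / 2))) := by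
  have hc : Continuous (Qj k j) := by unfold Qj; fun_prop
  refine ((hc.pow 2).tendsto _).rpow_const (Or.inl ?_)
  refine pow_ne_zero _ ?_
  unfold Qj
  have hj' : (0:ℝ) < j := by exact_mod_cast hj1
  refine mul_ne_zero (by positivity) (Finset.prod_ne_zero_iff.2 fun i hi => ?_)
  rw [Finset.mem_erase] at hi
  intro h
  have : (i:ℝ) ^ 2 = (j:ℝ) ^ 2 := by linarith
  have h2 : (i:ℝ) = j := (pow_left_inj₀ (by positivity) (by positivity) (by norm_num)).1 this
  exact hi.1 (by exact_mod_cast h2)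

theorem thr_step {k j : ℕ} (hk : 1 ≤ k) (hj : j < k) {c c' : ℝ}
    (hc : ∀ u ∈ stg k j, Ph k u * Wr (2 * k - 1) (fun q => cl_q k j q) u = c)
    (hc' : ∀ u ∈ stg k (j + 1), Ph k u * Wr (2 * k - 1) (fun q => cl_q k (j + 1) q) u = c') :
    c = c' * Real.pi ^ (2 * j + 1) := by
  have hkj : ((k - 1 - j : ℕ) : ℝ) = k - 1 - j := by
    rw [Nat.cast_sub (by omega), Nat.cast_sub hk]; simp
  set u0 : ℝ := (2 * ((j + 1 : ℕ) : ℝ)) ^ 2 with hu0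
  have hs0 : Real.sqrt u0 = 2 * j + 2 := by rw [hu0, Real.sqrt_sq (by positivity)]; push_cast; ring
  have hu0p : 0 < u0 := by positivity
  have hs1 : 1 < Real.sqrt u0 := by rw [hs0]; have : (0:ℝ) ≤ j := by positivity
                                    linarith
  let q : Fin (2 * k - 1) := ⟨k - 1 - j, by omega⟩
  have clL : cl (lst k (k - 1 - j)) = 2 * j + 2 := by rw [lst_cl (by omega), hkj]; ring
  have clR : cl (lst k (k + 1 + j)) = -(2 * j + 2) := by rw [lst_cl (by omega)]; push_cast; ring
  have setL : {u | 0 < cl (lst k (k - 1 - j)) + sg true * Real.sqrt u} = Set.Iio u0 := by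
    ext u
    simp only [clL, sg, if_true, Set.mem_ofPred_eq, Set.mem_Iio]
    rw [show u0 = (2 * (j:ℝ) + 2) ^ 2 by rw [hu0]; push_cast; ring, ← Real.sqrt_lt' (by positivity)]
    constructor <;> intro h <;> linarith
  have setR : {u | 0 < cl (lst k (k + 1 + j)) + sg false * Real.sqrt u} = Set.Ioi u0 := by
    ext u
    simp only [clR, sg, Bool.false_eq_true, if_false, Set.mem_ofPred_eq, Set.mem_Ioi]
    rw [show u0 = (2 * (j:ℝ) + 2) ^ 2 by rw [hu0]; push_cast; ring, ← Real.lt_sqrt (by positivity)]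
    constructor <;> intro h <;> linarith
  set A := (Real.sqrt (Real.sqrt u0))⁻¹ with hA
  set V0 : Matrix (Fin (2 * k - 1)) (Fin (2 * k - 1)) ℝ := Matrix.of fun r p => opE r (OV r) (cl_q k j p) u0 with hV0
  -- continuity of the other columns
  have hsame : ∀ p : Fin (2 * k - 1), p ≠ q → cl_q k (j + 1) p = cl_q k j p := by
    intro p hp
    have hp' : (p : ℕ) ≠ k - 1 - j := fun h => hp (Fin.ext h)
    unfold cl_q
    have : j + 1 + (p:ℕ) < k ↔ j + (p:ℕ) < k := by omega
    simp only [this]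
  have hcont : ∀ r p : Fin (2 * k - 1), p ≠ q → Tendsto (fun u => opE r (OV r) (cl_q k j p) u) (𝓝 u0) (𝓝 (V0 r p)) := by
    intro r p hp
    have hp' : (p : ℕ) ≠ k - 1 - j := fun h => hp (Fin.ext h)
    set U : Set ℝ := {u | 0 < u ∧ (j + (p:ℕ) < k → Real.sqrt u < 2 * k - 2 * (p:ℕ)) ∧
      ((p:ℕ) < k → k ≤ j + (p:ℕ) → 2 * (k:ℝ) - 2 * (p:ℕ) < Real.sqrt u)} with hU
    have hUo : ∃ V ⊆ U, IsOpen V ∧ u0 ∈ V := by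
      refine ⟨interior U, interior_subset, isOpen_interior, mem_interior_iff_mem_nhds.2 ?_⟩
      have c1 := (Real.continuous_sqrt.tendsto u0)
      refine ((eventually_gt_nhds hu0p).and (Eventually.and ?_ ?_))
      · by_cases h : j + (p:ℕ) < k
        · have h2 : j + (p:ℕ) + 2 ≤ k := by omega
          have h3 : (j:ℝ) + (p:ℕ) + 2 ≤ k := by exact_mod_cast h2
          filter_upwards [c1.eventually (gt_mem_nhds (show Real.sqrt u0 < 2 * k - 2 * (p:ℕ) by rw [hs0]; linarith))] with u hu _ using hu
        · exact Eventually.of_forall fun u hu => absurd hu h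
      · by_cases h : k ≤ j + (p:ℕ)
        · have h3 : (k:ℝ) ≤ (j:ℝ) + (p:ℕ) := by exact_mod_cast h
          filter_upwards [c1.eventually (lt_mem_nhds (show 2 * k - 2 * ((p:ℕ):ℝ) < Real.sqrt u0 by rw [hs0]; linarith))] with u hu _ _ using hu
        · exact Eventually.of_forall fun u _ hu => absurd hu h
    obtain ⟨V, hVU, hVo, hVm⟩ := hUo
    exact opE_cont hVo (col_ok hk hj.le p.2 hVU).1 hVm
  have hPhL : ∀ᶠ u in 𝓝[<] u0, Ph k u = (2 * j + 2 - Real.sqrt u) ^ ((k:ℝ) - 1 / 2) * (Qj k (j + 1) u ^ 2) ^ (((k:ℝ) - 1 / 2) / 2) := by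
    filter_upwards [(eventually_gt_nhds hu0p).filter_mono nhdsWithin_le_nhds, self_mem_nhdsWithin] with u h1 h2
    rw [← setL] at h2
    simp only [clL, sg, if_true, Set.mem_ofPred_eq] at h2
    exact Ph_split (by omega) (by omega) h1 (by linarith) (Or.inl (by push_cast; ring))
  have hPhR : ∀ᶠ u in 𝓝[>] u0, Ph k u = (Real.sqrt u - (2 * j + 2)) ^ ((k:ℝ) - 1 / 2) * (Qj k (j + 1) u ^ 2) ^ (((k:ℝ) - 1 / 2) / 2) := by
    filter_upwards [(eventually_gt_nhds hu0p).filter_mono nhdsWithin_le_nhds, self_mem_nhdsWithin] with u h1 h2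
    rw [← setR] at h2
    simp only [clR, sg, Bool.false_eq_true, if_false, Set.mem_ofPred_eq] at h2
    exact Ph_split (by omega) (by omega) h1 (by linarith) (Or.inr (by push_cast; ring))
  have hcL : ∀ᶠ u in 𝓝[<] u0, Ph k u * Wr (2 * k - 1) (fun q => cl_q k j q) u = c := by
    have : Real.sqrt u0 > 2 * j := by rw [hs0]; linarith
    filter_upwards [(eventually_gt_nhds hu0p).filter_mono nhdsWithin_le_nhds, self_mem_nhdsWithin,
      ((Real.continuous_sqrt.tendsto u0).eventually (lt_mem_nhds this)).filter_mono nhdsWithin_le_nhds] with u h1 h2 h3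
    rw [← setL] at h2
    simp only [clL, sg, if_true, Set.mem_ofPred_eq] at h2
    exact hc u ⟨h1, h3, fun _ => by linarith⟩
  have hcR : ∀ᶠ u in 𝓝[>] u0, Ph k u * Wr (2 * k - 1) (fun q => cl_q k (j + 1) q) u = c' := by
    have : Real.sqrt u0 < 2 * j + 4 := by rw [hs0]; linarith
    filter_upwards [(eventually_gt_nhds hu0p).filter_mono nhdsWithin_le_nhds, self_mem_nhdsWithin,
      ((Real.continuous_sqrt.tendsto u0).eventually (gt_mem_nhds this)).filter_mono nhdsWithin_le_nhds] with u h1 h2 h3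
    rw [← setR] at h2
    simp only [clR, sg, Bool.false_eq_true, if_false, Set.mem_ofPred_eq] at h2
    exact hc' u ⟨h1, by push_cast; linarith, fun _ => by push_cast; linarith⟩
  have sR : ∀ r : Fin (2 * k - 1), Tendsto (fun u => (Real.sqrt u - (2 * j + 2)) ^ ((k:ℝ) - 1 / 2) * opE r (OV r) (cl_q k (j + 1) q) u)
      (𝓝[>] u0) (𝓝 (if (r : ℕ) = 2 * k - 2 then A * (Real.Gamma ((k:ℝ) - 1 / 2) * (lB false * lS (lst k (k + 1 + j)))) else 0)) := by
    intro r
    have h := Bv_thr hk (b := false) (a := k + 1 + j) (by omega) hs1 (by rw [clR, hs0]; simp [sg]) r.2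
    rw [setR, clR] at h
    have e : cl_q k (j + 1) q = Bv k false (k + 1 + j) := by
      unfold cl_q
      rw [if_pos (show (q:ℕ) < k by simp only [q]; omega), if_neg (show ¬ (j + 1 + (q:ℕ) < k) by simp only [q]; omega)]
      congr 1; simp only [q]; omega
    rw [e]
    refine h.congr fun u => ?_
    congr 2; simp only [sg]; simp; ring
  have sL : ∀ r : Fin (2 * k - 1), Tendsto (fun u => (2 * j + 2 - Real.sqrt u) ^ ((k:ℝ) - 1 / 2) * opE r (OV r) (cl_q k j q) u)
      (𝓝[<] u0) (𝓝 (if (r : ℕ) = 2 * k - 2 then A * (Real.Gamma ((k:ℝ) - 1 / 2) * (lB true * lS (lst k (k - 1 - j)))) else 0)) := by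
    intro r
    have h := Bv_thr hk (b := true) (a := k - 1 - j) (by omega) hs1 (by rw [clL, hs0]; simp [sg]) r.2
    rw [setL, clL] at h
    have ed : ∀ u, 2 * (j:ℝ) + 2 + sg true * Real.sqrt u = 2 * j + 2 - Real.sqrt u := fun u => by simp [sg]; ring
    simp only [ed] at h
    by_cases hq : k - 1 - j = 0
    · have e : cl_q k j q = cmb k := by
        unfold cl_q
        rw [if_pos (show (q:ℕ) < k by simp only [q]; omega), if_pos (show (j + (q:ℕ) < k) by simp only [q]; omega),
          if_pos (show (q:ℕ) = 0 by simp only [q]; omega)]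
      rw [e]
      have hk' : (1:ℝ) ≤ k := by exact_mod_cast hk
      have m1 : ∀ᶠ u in 𝓝[<] u0, u ∈ RegB k true 0 ∩ RegB k false 1 := by
        filter_upwards [(eventually_gt_nhds hu0p).filter_mono nhdsWithin_le_nhds, self_mem_nhdsWithin] with u h1 h2
        have hsu := Real.sqrt_pos.2 h1
        refine ⟨⟨h1, ?_⟩, mem_RegK (by omega) h1 (by push_cast; linarith)⟩
        rw [← setL, hq] at h2
        exact h2
      have h4 : Tendsto (fun u => opE r (OV r) (Bv k false 1) u) (𝓝[<] u0) (𝓝 (opE r (OV r) (Bv k false 1) u0)) := by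
        have : u0 ∈ RegB k false 1 := mem_RegK (by omega) hu0p (by rw [hs0]; push_cast; have : (0:ℝ) ≤ j := by positivity
                                                                   linarith)
        exact (opE_cont (Reg_open _ _) (Bv_smo _ _ _) this).tendsto.mono_left nhdsWithin_le_nhds
      have h5 : Tendsto (fun u => (2 * j + 2 - Real.sqrt u) ^ ((k:ℝ) - 1 / 2)) (𝓝[<] u0) (𝓝 0) := by
        have h6 : Tendsto (fun u => 2 * j + 2 - Real.sqrt u) (𝓝 u0) (𝓝 0) := by
          have := (by fun_prop : Continuous fun u : ℝ => 2 * j + 2 - Real.sqrt u).tendsto u0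
          rwa [hs0, sub_self] at this
        have := h6.rpow_const (p := (k:ℝ) - 1 / 2) (Or.inr (by linarith))
        rw [Real.zero_rpow (by linarith)] at this
        exact this.mono_left nhdsWithin_le_nhds
      have h7 := h.add ((h5.mul h4).const_mul (2 * k : ℝ))
      rw [zero_mul, mul_zero, add_zero] at h7
      refine h7.congr' ?_
      filter_upwards [m1] with u hu
      unfold cmb
      rw [opE_add ((Reg_open _ _).inter (Reg_open _ _)) (ContDiffOn.mono (Bv_smo k true 0) Set.inter_subset_left)
        (ContDiffOn.mono (Bv_smo k false 1) Set.inter_subset_right) _ hu, hq]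
      ring
    · have e : cl_q k j q = Bv k true (k - 1 - j) := by
        unfold cl_q
        rw [if_pos (show (q:ℕ) < k by simp only [q]; omega), if_pos (show (j + (q:ℕ) < k) by simp only [q]; omega),
          if_neg (show ¬ (q:ℕ) = 0 by simp only [q]; omega)]
      rw [e]
      exact h
  have eL := thr_side (φ := fun q => cl_q k j q) (q := q) (V0 := V0) (nhdsWithin_le_nhds) hPhL ((Qj_lim (by omega)).mono_left nhdsWithin_le_nhds) hcL
    (fun r p hp => (hcont r p hp).mono_left nhdsWithin_le_nhds) sL
  have eR := thr_side (φ := fun q => cl_q k (j + 1) q) (q := q) (V0 := V0) (nhdsWithin_le_nhds) hPhR ((Qj_lim (by omega)).mono_left nhdsWithin_le_nhds) hcR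
    (fun r p hp => by beta_reduce; rw [hsame p hp]; exact (hcont r p hp).mono_left nhdsWithin_le_nhds) sR
  have hlead : (∏ r : Fin (2 * k - 1), (OV r r).eval u0) ≠ 0 := Finset.prod_ne_zero_iff.2 fun r _ => OV_lead r hu0p.ne'
  rw [lS_eq, lst_length (by omega), lst_true] at eL eR
  simp only [lB, Bool.false_eq_true, if_false, if_true] at eL eR
  have hpi := Real.pi_ne_zero
  refine mul_left_cancel₀ hlead ?_
  rw [← hu0] at eL eR
  have e1 : (1 / Real.pi) ^ (k + 1 + j) * Real.pi ^ (2 * j + 1) = (1 / Real.pi) * (1 / Real.pi) ^ (k - 1 - j) := by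
    obtain ⟨m, rfl⟩ : ∃ m, k = m + 1 + j := ⟨k - 1 - j, by omega⟩
    rw [show m + 1 + j - 1 - j = m by omega, show m + 1 + j + 1 + j = (2 * j + 1) + 1 + m by ring, pow_add, pow_add]
    rw [pow_one, one_div, inv_pow, inv_pow]
    field_simp
  linear_combination eL - Real.pi ^ (2 * j + 1) * eR - (((Qj k (j + 1) u0 ^ 2) ^ (((k:ℝ) - 1 / 2) / 2) * A * Real.Gamma ((k:ℝ) - 1 / 2) * Real.sqrt (Real.pi / 2) ^ (2 * k) * Real.sqrt (Real.pi / 2) * (V0.updateCol q (fun r => if (r : ℕ) = 2 * k - 2 then 1 else 0)).det)) * e1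

theorem thr_all {k : ℕ} (hk : 1 ≤ k) (c : ℕ → ℝ)
    (hc : ∀ j ≤ k, ∀ u ∈ stg k j, Ph k u * Wr (2 * k - 1) (fun q => cl_q k j q) u = c j) :
    c 0 = c k * Real.pi ^ (k ^ 2) := by
  have : ∀ j ≤ k, c 0 = c j * Real.pi ^ (j ^ 2) := by
    intro j
    induction j with
    | zero => intro _; simp
    | succ j ih =>
      intro hj
      rw [ih (by omega), thr_step hk (by omega) (hc j (by omega)) (hc (j + 1) hj), mul_assoc, ← pow_add]
      congr 2; ring
  exact this k le_rfl

theorem J_scale {h : ℝ → ℝ} {u : ℝ} (hu : 0 < u) :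
    u * J0 false h u = ∫ s in Set.Ioi (0:ℝ), besselK0 s * h ((Real.sqrt u)⁻¹ * s) * s := by
  have hs := Real.sqrt_pos.2 hu
  have h1 := integral_comp_mul_left_Ioi (fun s => besselK0 s * h ((Real.sqrt u)⁻¹ * s) * s) 0 hs
  rw [mul_zero, smul_eq_mul] at h1
  have h2 : (∫ t in Set.Ioi (0:ℝ), besselK0 (Real.sqrt u * t) * h ((Real.sqrt u)⁻¹ * (Real.sqrt u * t)) * (Real.sqrt u * t))
      = Real.sqrt u * J0 false h u := by
    unfold J0 JJ
    rw [← integral_const_mul]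
    refine integral_congr_ae (Eventually.of_forall fun t => ?_)
    beta_reduce
    rw [inv_mul_cancel_left₀ hs.ne']
    simp only [B0, Bool.false_eq_true, if_false]; ring
  rw [h2] at h1
  have h3 := Real.mul_self_sqrt hu.le
  calc u * J0 false h u = Real.sqrt u * (Real.sqrt u * J0 false h u) := by rw [← mul_assoc, h3]
    _ = _ := by rw [h1, ← mul_assoc, mul_inv_cancel₀ hs.ne', one_mul]

theorem om_cont : ContinuousOn om (Set.Ioi 0) := by
  unfold om
  refine (continuousOn_const.add ?_).add continuousOn_id
  exact (Real.continuousOn_log.mono fun x hx => (ne_of_gt hx)).abs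

theorem dom_int (p m : ℕ) : IntegrableOn (fun s => besselK0 s * (om s ^ p * Real.exp (1 / 2 * s)) * s ^ m * s) (Set.Ioi 0) := by
  have h1 : Cls (-(1 / 2)) (fun s => om s ^ p * Real.exp (1 / 2 * s)) := by
    refine ⟨(om_cont.pow p).mul (by fun_prop), 1, p, zero_le_one, fun t ht => ?_⟩
    have := om_pos ht
    rw [abs_of_nonneg (by positivity), one_mul, neg_mul, neg_neg]
  have h2 : ∀ m : ℕ, Cls (1 / 2) (fun s => besselK0 s * (om s ^ p * Real.exp (1 / 2 * s)) * s ^ m) := by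
    intro m
    induction m with
    | zero =>
      have := (Cls_B0 false).mul h1
      simp only [sg, B0, Bool.false_eq_true, if_false] at this
      norm_num at this
      norm_num
      exact this
    | succ m ih => exact ih.tmul.congr fun t _ => by ring
  exact (h2 m).integrable (by norm_num)

theorem sqrt_large (Y : ℝ) : ∀ᶠ u : ℝ in atTop, 0 < u ∧ 1 ≤ Real.sqrt u ∧ Y ≤ Real.sqrt u := by
  have := Real.tendsto_sqrt_atTop
  filter_upwards [eventually_gt_atTop 0, this.eventually_ge_atTop 1, this.eventually_ge_atTop Y] with u a b c
  exact ⟨a, b, c⟩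

theorem inf_bound (m : ℕ) {c : ℝ} {X : ℝ → ℝ} (hX : Cls c X) : ∃ C : ℝ, ∃ p : ℕ, 0 ≤ C ∧ ∀ᶠ u in atTop,
    |u * J0 false (fun t => t ^ m * X t) u| ≤ C * om (Real.sqrt u)⁻¹ ^ p * (Real.sqrt u)⁻¹ ^ m := by
  obtain ⟨_, C, p, hC, hb⟩ := hX
  refine ⟨C * ∫ s in Set.Ioi (0:ℝ), besselK0 s * (om s ^ p * Real.exp (1 / 2 * s)) * s ^ m * s, p, ?_, ?_⟩
  · refine mul_nonneg hC (setIntegral_nonneg measurableSet_Ioi fun s hs => ?_)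
    have hs' : (0:ℝ) < s := hs
    have := om_pos hs'
    have := K0_nonneg s
    positivity
  filter_upwards [sqrt_large (2 * |c|)] with u hu
  have hy : 0 < Real.sqrt u := by linarith [hu.2.1]
  set y := (Real.sqrt u)⁻¹ with hyd
  have hy' : 0 < y := by positivity
  rw [J_scale hu.1]
  have := norm_integral_le_of_norm_le (f := fun s => besselK0 s * ((y * s) ^ m * X (y * s)) * s)
    ((dom_int p m).const_mul (C * om y ^ p * y ^ m)) ((ae_restrict_iff' measurableSet_Ioi).2
    (Eventually.of_forall fun s hs => ?_))
  · rw [Real.norm_eq_abs, integral_const_mul] at this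
    refine this.trans (le_of_eq (by ring))
  · have hs' : (0:ℝ) < s := hs
    have hK := K0_nonneg s
    have ho := om_pos hs'
    have hoy := om_pos hy'
    have hos := om_pos (mul_pos hy' hs')
    rw [Real.norm_eq_abs, abs_mul, abs_mul, abs_mul, abs_of_nonneg hK, abs_of_pos hs', abs_of_pos (pow_pos (mul_pos hy' hs') m)]
    have b1 := hb (y * s) (mul_pos hy' hs')
    have b2 : Real.exp (-(c * (y * s))) ≤ Real.exp (1 / 2 * s) := by
      rw [Real.exp_le_exp]
      have e1 : -c * y ≤ 1 / 2 := by
        have : -c ≤ |c| := neg_le_abs c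
        rw [hyd, ← div_eq_mul_inv, div_le_iff₀ hy]
        linarith [hu.2.2]
      nlinarith
    calc besselK0 s * ((y * s) ^ m * |X (y * s)|) * s
        ≤ besselK0 s * ((y * s) ^ m * (C * (om y * om s) ^ p * Real.exp (1 / 2 * s))) * s := by
          gcongr ?_ * ?_
          gcongr ?_ * ?_
          gcongr ?_ * ?_
          refine b1.trans ?_
          gcongr
          exact om_mul hy' hs'
      _ = _ := by rw [mul_pow, mul_pow]; ring

theorem om_pow (p : ℕ) {η : ℝ} (hη : 0 < η) {α : ℝ} (hα : α + η < 0) :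
    Tendsto (fun y : ℝ => y ^ α * om y⁻¹ ^ p) atTop (𝓝 0) := by
  set θ := η / (p + 1) with hθ
  have hθ0 : 0 < θ := by positivity
  have t0 : Tendsto (fun y : ℝ => (2 + 1 / θ) ^ p * y ^ (α + η)) atTop (𝓝 0) := by
    have := (tendsto_rpow_neg_atTop (y := -(α + η)) (by linarith)).const_mul ((2 + 1 / θ) ^ p)
    rw [mul_zero, neg_neg] at this
    exact this
  refine squeeze_zero' ?_ ?_ t0
  · filter_upwards [eventually_gt_atTop 0] with y hy
    have := om_pos (inv_pos.2 hy)
    positivity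
  · filter_upwards [eventually_ge_atTop 1] with y hy
    have hy0 : 0 < y := by linarith
    have o0 := om_pos (inv_pos.2 hy0)
    have h1 : om y⁻¹ ≤ (2 + 1 / θ) * y ^ θ := by
      unfold om
      rw [Real.log_inv, abs_neg, abs_of_nonneg (Real.log_nonneg hy)]
      have a1 := Real.log_le_rpow_div hy0.le hθ0
      have a2 : y⁻¹ ≤ 1 := inv_le_one_of_one_le₀ hy
      have a3 : 1 ≤ y ^ θ := Real.one_le_rpow hy hθ0.le
      have : (2 + 1 / θ) * y ^ θ = 2 * y ^ θ + y ^ θ / θ := by ring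
      linarith
    calc y ^ α * om y⁻¹ ^ p ≤ y ^ α * ((2 + 1 / θ) * y ^ θ) ^ p := by gcongr
      _ = (2 + 1 / θ) ^ p * (y ^ α * y ^ (θ * p)) := by
        rw [mul_pow, ← Real.rpow_natCast (y ^ θ), ← Real.rpow_mul hy0.le]; ring
      _ = (2 + 1 / θ) ^ p * y ^ (α + θ * p) := by rw [Real.rpow_add hy0]
      _ ≤ (2 + 1 / θ) ^ p * y ^ (α + η) := by
        gcongr
        rw [hθ, div_mul_eq_mul_div, div_le_iff₀ (by positivity)]
        nlinarith

theorem inf_zero (m : ℕ) {c : ℝ} {X : ℝ → ℝ} (hX : Cls c X) {α : ℝ} (hα : 2 * α < m) :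
    Tendsto (fun u => u ^ α * (u * J0 false (fun t => t ^ m * X t) u)) atTop (𝓝 0) := by
  obtain ⟨C, p, hC, hb⟩ := inf_bound m hX
  have h1 := ((om_pow p (η := (m - 2 * α) / 2) (by linarith) (α := 2 * α - m) (by linarith)).comp Real.tendsto_sqrt_atTop).const_mul C
  rw [mul_zero] at h1
  refine squeeze_zero_norm' ?_ h1
  filter_upwards [hb, eventually_gt_atTop 0] with u hu hu0
  have hs := Real.sqrt_pos.2 hu0
  rw [norm_mul, Real.norm_eq_abs, Real.norm_eq_abs, abs_of_nonneg (Real.rpow_nonneg hu0.le _)]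
  have e : u ^ α = Real.sqrt u ^ (2 * α) := by
    rw [Real.sqrt_eq_rpow, ← Real.rpow_mul hu0.le]; congr 1; ring
  calc _ ≤ u ^ α * (C * om (Real.sqrt u)⁻¹ ^ p * (Real.sqrt u)⁻¹ ^ m) := by gcongr
    _ = _ := by
      rw [e, Function.comp, Real.rpow_sub hs, Real.rpow_natCast, inv_pow]; field_simp

theorem K0_int : ∫ s in Set.Ioi (0:ℝ), besselK0 s * s = 1 := by
  have h := ftc_Ioi (f := B1 false) (f' := fun s => besselK0 s * s) (l := -1) (m := 0)
    (fun x hx => (hasDerivAt_B1 false hx).congr_deriv (by simp [B0]; ring))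
    (by have := (Cls_B0 false).integrable (by simp [sg]); simpa [B0] using this) B1_false_lim
    ((Cls_B1 false).lim_top0 (by simp [sg]))
  rw [h]; norm_num

theorem lead_le (l : List Bool) {t : ℝ} (ht : 0 < t) : |lead l t| ≤ Real.exp ((l.count true) * t) := by
  unfold lead
  rw [abs_mul, abs_pow, abs_pow, abs_of_nonneg (I0_nonneg t)]
  have h1 : |B1 false t| ≤ 1 := by
    simp only [B1, Bool.false_eq_true, if_false, abs_neg]
    rw [abs_of_nonneg (mul_nonneg ht.le (K1_nonneg t))]
    refine (tK1_bounds ht).2.trans ?_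
    rw [Real.exp_neg, inv_mul_le_iff₀ (Real.exp_pos t), mul_one]
    linarith [Real.add_one_le_exp t]
  calc _ ≤ Real.exp t ^ (l.count true) * 1 := by
        gcongr
        · exact I0_nonneg t
        · exact I0_le ht.le
        · exact pow_le_one₀ (abs_nonneg _) h1
    _ = _ := by rw [mul_one, ← Real.exp_nat_mul]

theorem inf_lead (l : List Bool) :
    Tendsto (fun u => u * J0 false (lead l) u) atTop (𝓝 ((-1) ^ (l.count false))) := by
  have h : Tendsto (fun u => ∫ s in Set.Ioi (0:ℝ), besselK0 s * lead l ((Real.sqrt u)⁻¹ * s) * s) atTop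
      (𝓝 (∫ s in Set.Ioi (0:ℝ), besselK0 s * (-1) ^ (l.count false) * s)) := by
    refine tendsto_integral_filter_of_dominated_convergence
      (fun s => besselK0 s * (om s ^ 0 * Real.exp (1 / 2 * s)) * s ^ 0 * s) ?_ ?_ (dom_int 0 0) ?_
    · filter_upwards [eventually_gt_atTop 0] with u hu
      have hs := Real.sqrt_pos.2 hu
      refine ContinuousOn.aestronglyMeasurable ?_ measurableSet_Ioi
      have h1 := (Cls_B0 false).1
      simp only [B0, Bool.false_eq_true, if_false] at h1
      exact (h1.mul ((lead_cls l).1.comp (by fun_prop) fun t ht => mul_pos (inv_pos.2 hs) ht)).mul continuousOn_id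
    · filter_upwards [sqrt_large (2 * l.count true)] with u hu
      refine (ae_restrict_iff' measurableSet_Ioi).2 (Eventually.of_forall fun s hs => ?_)
      have hs' : (0:ℝ) < s := hs
      have hy : 0 < Real.sqrt u := by linarith [hu.2.1]
      have hK := K0_nonneg s
      rw [Real.norm_eq_abs, abs_mul, abs_mul, abs_of_nonneg hK, abs_of_pos hs', pow_zero, pow_zero, one_mul, mul_one]
      gcongr
      refine (lead_le l (mul_pos (inv_pos.2 hy) hs')).trans ?_
      rw [Real.exp_le_exp, ← mul_assoc]
      gcongr
      rw [← div_eq_mul_inv, div_le_iff₀ hy]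
      linarith [hu.2.2]
    · refine (ae_restrict_iff' measurableSet_Ioi).2 (Eventually.of_forall fun s hs => ?_)
      have hs' : (0:ℝ) < s := hs
      refine (Tendsto.const_mul _ ((lead_lim l).comp ?_)).mul_const _
      refine tendsto_nhdsWithin_iff.2 ⟨?_, ?_⟩
      · have := (tendsto_inv_atTop_zero.comp Real.tendsto_sqrt_atTop).mul_const s
        rw [zero_mul] at this
        exact this
      · filter_upwards [eventually_gt_atTop 0] with u hu
        have hs := Real.sqrt_pos.2 hu
        exact mul_pos (inv_pos.2 hs) hs'
  have e : ∫ s in Set.Ioi (0:ℝ), besselK0 s * (-1) ^ (l.count false) * s = (-1) ^ (l.count false) := by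
    have : ∀ s, besselK0 s * (-1) ^ (l.count false) * s = (-1) ^ (l.count false) * (besselK0 s * s) := fun s => by ring
    simp only [this]
    rw [integral_const_mul, K0_int, mul_one]
  rw [e] at h
  refine h.congr' ?_
  filter_upwards [eventually_gt_atTop 0] with u hu
  rw [J_scale hu]

/-- entry asymptotics -/
theorem inf_entry (l : List Bool) (r N : ℕ) (hr : r ≤ N) :
    Tendsto (fun u : ℝ => u ^ (((r:ℝ) - (l.count false)) / (4 * (N + 1))) * opE r (OT r) (al l false 0) u) atTop
      (𝓝 (if r = l.count false then (r.factorial : ℝ) else 0)) := by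
  have hreg : ∀ᶠ u in atTop, u ∈ Reg false (cl l) := by
    filter_upwards [sqrt_large (|cl l| + 1)] with u hu
    refine ⟨hu.1, ?_⟩
    have := neg_abs_le (cl l)
    simp [sg]; linarith [hu.2.2]
  have hop : ∀ᶠ u in atTop, (-1) ^ r * (u ^ (((r:ℝ) - (l.count false)) / (4 * (N + 1))) * (u * J0 false (GG l r) u)) =
      u ^ (((r:ℝ) - (l.count false)) / (4 * (N + 1))) * opE r (OT r) (al l false 0) u := by
    filter_upwards [hreg] with u hu
    rw [opE_OT r u hu]; ring
  refine Tendsto.congr' hop ?_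
  rcases lt_trichotomy r (l.count false) with h | h | h
  · rw [if_neg h.ne]
    have h' : (r:ℝ) < l.count false := by exact_mod_cast h
    have := inf_zero 0 (Md_GG l r).cls (α := ((r:ℝ) - (l.count false)) / (4 * (N + 1))) (by
      have := div_neg_of_neg_of_pos (show (r:ℝ) - l.count false < 0 by linarith) (show (0:ℝ) < 4 * (N + 1) by positivity)
      push_cast; linarith)
    simp only [pow_zero, one_mul] at this
    have := this.const_mul ((-1) ^ r)
    rwa [mul_zero] at this
  · rw [if_pos h, h, sub_self, zero_div]
    simp only [Real.rpow_zero, one_mul]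
    obtain ⟨H, ⟨X, hX, hXe⟩, hH⟩ := GG_lead l
    have z := inf_zero 1 hX (α := 0) (by norm_num)
    have t := ((inf_lead l).const_mul ((l.count false).factorial : ℝ)).add z
    have t' := t.const_mul ((-1) ^ (l.count false))
    have e : ((-1 : ℝ)) ^ (l.count false) * ((l.count false).factorial * (-1) ^ (l.count false) + 0) = (l.count false).factorial := by
      have : ((-1 : ℝ)) ^ (l.count false) * (-1) ^ (l.count false) = 1 := by rw [← mul_pow]; norm_num
      linear_combination ((l.count false).factorial : ℝ) * this
    rw [e] at t'
    refine t'.congr' ?_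
    filter_upwards [hreg] with u hu
    have e1 : J0 false (GG l (l.count false)) u = J0 false (fun t => (l.count false).factorial * lead l t + t ^ 1 * X t) u :=
      J0_congr fun t ht => by rw [hH t ht, hXe t ht, pow_one]
    rw [e1, J0_add ((lead_cls l).smul _) (hX.tmul.congr fun t _ => by rw [pow_one]) hu, J0_smul, Real.rpow_zero]
    ring
  · rw [if_neg h.ne']
    obtain ⟨X, hX, hXe⟩ := GG_small l r h
    have hN : (r:ℝ) ≤ N := by exact_mod_cast hr
    have := inf_zero 1 hX (α := ((r:ℝ) - (l.count false)) / (4 * (N + 1))) (by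
      rw [← mul_div_assoc, div_lt_iff₀ (by positivity)]
      have : (0:ℝ) ≤ l.count false := by positivity
      push_cast; linarith)
    have := this.const_mul ((-1) ^ r)
    rw [mul_zero] at this
    refine this.congr fun u => ?_
    rw [J0_congr (f := GG l r) (h := fun t => t ^ 1 * X t) fun t ht => by rw [hXe t ht, pow_one]]

def dq (k q : ℕ) : ℕ := if q < k then q else 3 * k - 2 - q

def sgm (k : ℕ) : Equiv.Perm (Fin (2 * k - 1)) :=
  Function.Involutive.toPerm (fun q : Fin (2 * k - 1) => (⟨dq k q, by
    have := q.2; unfold dq; split_ifs <;> omega⟩ : Fin (2 * k - 1))) (by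
    intro q
    ext
    have := q.2
    simp only [dq]
    split_ifs <;> omega)

theorem sgm_val (k : ℕ) (q : Fin (2 * k - 1)) : ((sgm k q : Fin (2 * k - 1)) : ℕ) = dq k q := rfl

theorem inner_prod (k j N : ℕ) (hj : j < N) : ∏ i ∈ Finset.Iio (⟨j, hj⟩ : Fin N), (if (i:ℕ) < k then (1:ℤˣ) else -1) = (-1) ^ (j - k) := by
  induction j with
  | zero =>
    have : Finset.Iio (⟨0, hj⟩ : Fin N) = ∅ := by
      ext i; simp only [Finset.mem_Iio, Fin.lt_def]; simp
    rw [this]; simp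
  | succ j ih =>
    have h : j < N := by omega
    have e : Finset.Iio (⟨j + 1, hj⟩ : Fin N) = insert (⟨j, h⟩ : Fin N) (Finset.Iio (⟨j, h⟩ : Fin N)) := by
      ext i; simp only [Finset.mem_Iio, Finset.mem_insert, Fin.lt_def, Fin.ext_iff]; omega
    rw [e, Finset.prod_insert (by simp), ih h]
    dsimp only
    split_ifs with h1
    · rw [one_mul]; congr 1; omega
    · rw [show j + 1 - k = (j - k) + 1 by omega, pow_succ']

theorem tri_sum (k m : ℕ) : ∑ j ∈ Finset.range (k + m), (j - k) = m * (m - 1) / 2 := by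
  rw [Finset.sum_range_add]
  have : ∑ x ∈ Finset.range k, (x - k) = 0 := Finset.sum_eq_zero fun x hx => by
    rw [Finset.mem_range] at hx; omega
  rw [this, zero_add]
  simp [Finset.sum_range_id]

theorem sgm_sign {k : ℕ} (hk : 1 ≤ k) : Equiv.Perm.sign (sgm k) = (-1) ^ ((k - 1) * (k - 2) / 2) := by
  rw [Equiv.Perm.sign_eq_prod_prod_Iio]
  have h : ∀ j : Fin (2 * k - 1), ∏ i ∈ Finset.Iio j, (if sgm k i < sgm k j then (1:ℤˣ) else -1) = (-1) ^ ((j:ℕ) - k) := by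
    intro j
    rw [← inner_prod k j (2 * k - 1) j.2]
    refine Finset.prod_congr rfl fun i hi => ?_
    have hi' : (i:ℕ) < j := Fin.lt_def.1 (Finset.mem_Iio.1 hi)
    have : sgm k i < sgm k j ↔ (i:ℕ) < k := by
      rw [Fin.lt_def, sgm_val, sgm_val]
      have := i.2; have := j.2
      unfold dq
      split_ifs <;> omega
    simp only [this]
  simp only [h]
  rw [Finset.prod_pow_eq_pow_sum, Fin.sum_univ_eq_sum_range (fun j => j - k), show 2 * k - 1 = k + (k - 1) by omega, tri_sum]
  rfl

theorem cl_k {k q : ℕ} (hq : q < 2 * k - 1) : ∃ l : List Bool, l.count false = dq k q ∧ cl_q k k q = al l false 0 := by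
  unfold cl_q dq
  split_ifs with h1 h2 h3
  · omega
  · omega
  · exact ⟨_, by rw [lst_false]; omega, rfl⟩
  · exact ⟨_, by rw [lst_false]; omega, rfl⟩

theorem PP_lim {k : ℕ} (hk : 1 ≤ k) : Tendsto (fun u => ((PP k u / u ^ (2 * k)) ^ 2) ^ (((k:ℝ) - 1 / 2) / 2)) atTop (𝓝 1) := by
  have h1 : Tendsto (fun u => PP k u / u ^ (2 * k)) atTop (𝓝 ((-1) ^ k)) := by
    have h2 : Tendsto (fun u : ℝ => ∏ j ∈ Finset.Icc 1 k, ((2 * (j:ℝ)) ^ 2 * u⁻¹ - 1)) atTop (𝓝 (∏ j ∈ Finset.Icc 1 k, ((2 * (j:ℝ)) ^ 2 * 0 - 1))) :=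
      tendsto_finsetProd _ fun j _ => (tendsto_inv_atTop_zero.const_mul _).sub_const 1
    simp only [mul_zero, zero_sub, Finset.prod_const, Nat.card_Icc, Nat.add_sub_cancel] at h2
    refine h2.congr' ?_
    filter_upwards [eventually_gt_atTop 0] with u hu
    have : ∀ j : ℕ, (2 * (j:ℝ)) ^ 2 * u⁻¹ - 1 = ((2 * (j:ℝ)) ^ 2 - u) / u := fun j => by field_simp
    simp only [this]
    rw [Finset.prod_div_distrib, Finset.prod_const, Nat.card_Icc, Nat.add_sub_cancel, PP, two_mul k, pow_add]
    field_simp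
  have h3 := (h1.pow 2).rpow_const (p := ((k:ℝ) - 1 / 2) / 2) (Or.inl (by positivity))
  rwa [← pow_mul, mul_comm k 2, pow_mul, neg_one_sq, one_pow, Real.one_rpow] at h3

theorem c_inf {k : ℕ} (hk : 1 ≤ k) {c : ℝ}
    (hc : ∀ u ∈ stg k k, Ph k u * Wr (2 * k - 1) (fun q => cl_q k k q) u = c) :
    c * 2 ^ ((2 * k - 1) * (k - 1)) = (-1) ^ ((k - 1) * (k - 2) / 2) * ∏ r : Fin (2 * k - 1), ((r:ℕ).factorial : ℝ) := by
  set N := 2 * k - 1 with hN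
  set M : ℝ → Matrix (Fin N) (Fin N) ℝ := fun u => Matrix.of fun r q => opE r (OT r) (cl_q k k q) u with hM
  set e : ℝ := 4 * ((N:ℝ) + 1) with he
  have hdet : Tendsto (fun u => (M u).det) atTop (𝓝 ((-1) ^ ((k - 1) * (k - 2) / 2) * ∏ r : Fin N, ((r:ℕ).factorial : ℝ))) := by
    have hD : Matrix.det ((Matrix.diagonal fun r : Fin N => ((r:ℕ).factorial : ℝ)).submatrix id (sgm k)) =
        (-1) ^ ((k - 1) * (k - 2) / 2) * ∏ r : Fin N, ((r:ℕ).factorial : ℝ) := by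
      rw [Matrix.det_permute', sgm_sign hk, Matrix.det_diagonal]; push_cast; rfl
    rw [← hD]
    have t : Tendsto (fun u : ℝ => (Matrix.of fun r q : Fin N => u ^ (((r:ℝ) - dq k q) / e) * M u r q).det) atTop
        (𝓝 (Matrix.det ((Matrix.diagonal fun r : Fin N => ((r:ℕ).factorial : ℝ)).submatrix id (sgm k)))) := by
      have hcont : Continuous (fun A : Matrix (Fin N) (Fin N) ℝ => A.det) := continuous_id.matrix_det
      refine (hcont.tendsto _).comp ?_
      refine tendsto_pi_nhds.2 fun r => tendsto_pi_nhds.2 fun q => ?_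
      obtain ⟨l, h1, h2⟩ := cl_k (k := k) q.2
      have := inf_entry l r N r.2.le
      rw [h1] at this
      simp only [Matrix.of_apply, hM, h2, Matrix.submatrix_apply, id, Matrix.diagonal_apply, Fin.ext_iff, sgm_val]
      exact this
    refine t.congr' ?_
    filter_upwards [eventually_gt_atTop 0] with u hu
    have e1 : (Matrix.of fun r q : Fin N => u ^ (((r:ℝ) - dq k q) / e) * M u r q) =
        Matrix.of fun r q : Fin N => u ^ ((r:ℝ) / e) * (Matrix.of fun r q : Fin N => (u ^ (((sgm k q : Fin N) : ℝ) / e))⁻¹ * M u r q) r q := by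
      ext r q
      simp only [Matrix.of_apply]
      rw [sub_div, Real.rpow_sub hu, sgm_val]; ring
    rw [e1, Matrix.det_mul_column, Matrix.det_mul_row, Finset.prod_inv_distrib,
      Equiv.prod_comp (sgm k) (fun q : Fin N => u ^ ((q:ℝ) / e)), ← mul_assoc, mul_inv_cancel₀, one_mul]
    exact Finset.prod_ne_zero_iff.2 fun r _ => (Real.rpow_pos_of_pos hu _).ne'
  have t2 := hdet.mul (PP_lim hk)
  rw [mul_one] at t2
  refine tendsto_nhds_unique (tendsto_const_nhds.congr' ?_) t2
  filter_upwards [sqrt_large (2 * k + 1)] with u hu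
  have hu0 := hu.1
  have hW := hc u ⟨hu.1, by linarith [hu.2.2], fun h => absurd h (lt_irrefl _)⟩
  have hPh : Ph k u = ((PP k u / u ^ (2 * k)) ^ 2) ^ (((k:ℝ) - 1 / 2) / 2) * u ^ (k * (2 * k - 1)) := by
    unfold Ph
    rw [show PP k u ^ 2 = (PP k u / u ^ (2 * k)) ^ 2 * (u ^ (2 * k)) ^ 2 by field_simp,
      Real.mul_rpow (by positivity) (by positivity)]
    congr 1
    rw [← pow_mul, ← Real.rpow_natCast, ← Real.rpow_mul hu0.le, ← Real.rpow_natCast]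
    congr 1
    push_cast [Nat.cast_sub (show 1 ≤ 2 * k by omega)]
    ring
  have hd : (M u).det = (u ^ (k * (2 * k - 1)) * 2 ^ ((2 * k - 1) * (k - 1))) * Wr N (fun q => cl_q k k q) u := by
    rw [hM]
    beta_reduce
    rw [Wr_rows OT OT_ord (fun q : Fin N => cl_q k k q) u]
    congr 1
    have hsum : ∑ r ∈ Finset.range N, r = (2 * k - 1) * (k - 1) := by
      have := Finset.sum_range_id_mul_two N
      rw [hN] at this ⊢
      have e2 : (2 * k - 1) * (2 * k - 1 - 1) = ((2 * k - 1) * (k - 1)) * 2 := by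
        rw [mul_assoc]; congr 1; omega
      omega
    have : ∀ r : Fin N, eval u (OT r r) = u * (2 * u) ^ (r:ℕ) := fun r => OT_lead r u
    simp only [this]
    rw [Finset.prod_mul_distrib, Finset.prod_const, Finset.prod_pow_eq_pow_sum,
      Fin.sum_univ_eq_sum_range (fun j => j), hsum, mul_pow, Finset.card_univ, Fintype.card_fin, hN,
      show k * (2 * k - 1) = (2 * k - 1) + (2 * k - 1) * (k - 1) by
        obtain ⟨m, rfl⟩ : ∃ m, k = m + 1 := ⟨k - 1, by omega⟩
        simp only [show 2 * (m + 1) - 1 = 2 * m + 1 by omega, Nat.add_sub_cancel]; ring, pow_add]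
    ring
  rw [hd, ← hW, hPh]
  ring

theorem Bv_I (k a : ℕ) (u : ℝ) : IvKM (a + 1) (2 * k - a) (2 * 1 - 1) u = Bv k true a u := by
  unfold IvKM Bv al J0 JJ
  simp only [SS_lst, B0]
  refine integral_congr_ae (Eventually.of_forall fun t => ?_)
  simp only [if_true, Nat.add_sub_cancel, mul_assoc]
  norm_num

theorem Bv_K (k a b : ℕ) (hb : b - 1 = 2 * k - a) (u : ℝ) : IKvM a b (2 * 1 - 1) u = Bv k false a u := by
  unfold IKvM Bv al J0 JJ
  simp only [SS_lst, B0]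
  refine integral_congr_ae (Eventually.of_forall fun t => ?_)
  rw [hb]
  simp only [mul_assoc]
  norm_num

noncomputable def wq (k q : ℕ) : ℝ :=
  if q = 0 then Real.pi ^ (-(k:ℤ)) / (2 * k + 1) else
  if q < k then Real.pi ^ ((q:ℤ) - k) else Real.pi ^ ((q:ℤ) + 1 - 2 * k)

theorem mu_eq {k q : ℕ} (hk : 1 ≤ k) (hq : q < 2 * k - 1) :
    muS k 1 (q + 1) = fun u => wq k q * cl_q k 0 q u := by
  funext u
  unfold muS wq cl_q
  by_cases h0 : q = 0
  · subst h0
    have hk' : 0 < k := hk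
    simp only [zero_add, if_true, hk', cmb]
    have h1 := Bv_I k 0 u
    have h2 := Bv_K k 1 (2 * k) rfl u
    simp only [zero_add, Nat.sub_zero] at h1
    rw [h1, h2]; ring
  · have h1 : q + 1 ≠ 1 := by omega
    simp only [h1, h0, if_false, zero_add]
    by_cases h : q < k
    · have h2 : q + 1 ≤ k := h
      simp only [h, h2, if_true]
      rw [← Bv_I, show 2 * k + 1 - (q + 1) = 2 * k - q by omega]
      congr 2; push_cast; ring
    · have h2 : ¬ (q + 1 ≤ k) := by omega
      simp only [h, h2, if_false]
      rw [← Bv_K k (q - k + 2) (3 * k - (q + 1)) (by omega), show q + 1 - k + 1 = q - k + 2 by omega]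
      congr 2

theorem pi_prod (m : ℕ) (n : ℤ) : (∏ q ∈ Finset.range m, Real.pi ^ ((q:ℤ) - n)) ^ 2 = Real.pi ^ ((m:ℤ) * (m - 1) - 2 * m * n) := by
  induction m with
  | zero => simp
  | succ m ih =>
    rw [Finset.prod_range_succ, mul_pow, ih, ← zpow_natCast (Real.pi ^ ((m:ℤ) - n)), ← _root_.zpow_mul, ← zpow_add₀ Real.pi_ne_zero]
    congr 1; push_cast; ring

theorem wq_prod {k : ℕ} (hk : 1 ≤ k) : (∏ q : Fin (2 * k - 1), wq k q) * Real.pi ^ (k ^ 2) = 1 / (2 * k + 1) := by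
  rw [Fin.prod_univ_eq_prod_range (fun q => wq k q)]
  obtain ⟨m, rfl⟩ : ∃ m, k = m + 1 := ⟨k - 1, by omega⟩
  rw [show 2 * (m + 1) - 1 = (m + 1) + m by omega, Finset.prod_range_add, Finset.prod_range_succ']
  have h1 : ∏ q ∈ Finset.range m, wq (m + 1) (q + 1) = ∏ q ∈ Finset.range m, Real.pi ^ ((q:ℤ) - m) := by
    refine Finset.prod_congr rfl fun q hq => ?_
    rw [Finset.mem_range] at hq
    unfold wq
    rw [if_neg (by omega), if_pos (by omega)]
    congr 1; push_cast; ring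
  have h2 : ∏ q ∈ Finset.range m, wq (m + 1) (m + 1 + q) = ∏ q ∈ Finset.range m, Real.pi ^ ((q:ℤ) - m) := by
    refine Finset.prod_congr rfl fun q hq => ?_
    unfold wq
    rw [if_neg (by omega), if_neg (by omega)]
    congr 1; push_cast; ring
  have h3 := pi_prod m m
  rw [h1, h2]
  set A := ∏ q ∈ Finset.range m, Real.pi ^ ((q:ℤ) - m)
  have : A * wq (m + 1) 0 * A * Real.pi ^ ((m + 1) ^ 2) = A ^ 2 * wq (m + 1) 0 * Real.pi ^ ((m + 1) ^ 2) := by ring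
  rw [this, h3]
  unfold wq
  rw [if_pos rfl, ← zpow_natCast Real.pi ((m + 1) ^ 2)]
  have e : Real.pi ^ ((m:ℤ) * (m - 1) - 2 * m * m) * Real.pi ^ (-((m + 1 : ℕ):ℤ)) * Real.pi ^ (((m + 1) ^ 2 : ℕ) : ℤ) = 1 := by
    rw [← zpow_add₀ Real.pi_ne_zero, ← zpow_add₀ Real.pi_ne_zero, ← zpow_zero Real.pi]
    congr 1; push_cast; ring
  rw [← e]; ring

theorem fac_prod (m : ℕ) : (∏ n ∈ Finset.Icc 1 m, (n:ℝ) ^ n) * ∏ d ∈ Finset.range m, (d.factorial : ℝ) = (m.factorial : ℝ) ^ m := by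
  induction m with
  | zero => simp
  | succ m ih =>
    rw [Finset.prod_Icc_succ_top (by omega), Finset.prod_range_succ, Nat.factorial_succ]
    push_cast
    rw [mul_pow, pow_succ (m.factorial : ℝ), ← ih]; ring

theorem const_eq {k : ℕ} (hk : 1 ≤ k) : (∏ r : Fin (2 * k - 1), ((r:ℕ).factorial : ℝ)) / 2 ^ ((2 * k - 1) * (k - 1)) =
    (k:ℝ) / (2 : ℝ) ^ ((k : ℤ) * (2 * (k : ℤ) - 3)) * ((2 * k).factorial : ℝ) ^ (2 * k - 1) / ∏ n ∈ Finset.Icc 1 (2 * k), (n : ℝ) ^ n := by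
  rw [Fin.prod_univ_eq_prod_range (fun r => (r.factorial : ℝ))]
  obtain ⟨m, rfl⟩ : ∃ m, k = m + 1 := ⟨k - 1, by omega⟩
  have h := fac_prod (2 * (m + 1))
  rw [show 2 * (m + 1) - 1 = 2 * m + 1 by omega, show m + 1 - 1 = m by omega]
  rw [show Finset.range (2 * (m + 1)) = Finset.range (2 * m + 1 + 1) by rfl, Finset.prod_range_succ] at h
  set F := ∏ r ∈ Finset.range (2 * m + 1), (r.factorial : ℝ)
  set Q := ∏ n ∈ Finset.Icc 1 (2 * (m + 1)), (n : ℝ) ^ n with hQ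
  have hQ0 : Q ≠ 0 := by
    rw [hQ, Finset.prod_ne_zero_iff]
    intro n hn
    rw [Finset.mem_Icc] at hn
    have : (n:ℝ) ≠ 0 := by norm_cast; omega
    positivity
  have hf : ((2 * (m + 1)).factorial : ℝ) = 2 * (m + 1) * ((2 * m + 1).factorial : ℝ) := by
    rw [show 2 * (m + 1) = 2 * m + 1 + 1 by ring, Nat.factorial_succ]; push_cast; ring
  have hg : ((2 * m + 1).factorial : ℝ) ≠ 0 := by positivity
  have hm : (m:ℝ) + 1 ≠ 0 := by positivity
  have h' : ((2 * (m + 1)).factorial : ℝ) ^ (2 * m + 1) * (2 * (m + 1)) = Q * F := by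
    have : ((2 * (m + 1)).factorial : ℝ) ^ (2 * (m + 1)) = ((2 * (m + 1)).factorial : ℝ) ^ (2 * m + 1) * (2 * (m + 1) * ((2 * m + 1).factorial : ℝ)) := by
      rw [show 2 * (m + 1) = 2 * m + 1 + 1 by ring, pow_succ]
      congr 1
    rw [this] at h
    apply mul_right_cancel₀ hg
    rw [mul_assoc, ← h]; ring
  have hz : (2:ℝ) ^ ((2 * m + 1) * m) = 2 * (2:ℝ) ^ (((m + 1 : ℕ) : ℤ) * (2 * ((m + 1 : ℕ) : ℤ) - 3)) := by
    rw [← zpow_natCast, ← zpow_one_add₀ (by norm_num)]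
    congr 1; push_cast; ring
  rw [hz]
  set Z := (2:ℝ) ^ (((m + 1 : ℕ) : ℤ) * (2 * ((m + 1 : ℕ) : ℤ) - 3)) with hZ
  have hZ0 : Z ≠ 0 := by positivity
  push_cast
  rw [div_mul_eq_mul_div, div_div, div_eq_div_iff (by positivity) (by positivity)]
  linear_combination (-Z) * h'

theorem Ph_pos {k : ℕ} {u : ℝ} (h : 0 < PP k u) : Ph k u = PP k u ^ ((k:ℝ) - 1 / 2) := by
  unfold Ph
  rw [← Real.rpow_natCast, ← Real.rpow_mul h.le]
  congr 1; push_cast; ring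

/-- determinant of the odd Wrońskian matrix `Ω̆_{2k-1}(u)`. -/
theorem wronskian_det_odd (k : ℕ) (hk : 1 ≤ k) (u : ℝ) (hu : u ∈ Set.Ioo (0 : ℝ) 4) :
    Matrix.det
      (Matrix.of fun i j : Fin (2 * k - 1) =>
        iteratedDeriv (i : ℕ) (muS k 1 ((j : ℕ) + 1)) u) =
    ((k : ℝ) / (2 * k + 1) *
        ((-1 : ℝ) ^ ((k - 1) * (k - 2) / 2) / (2 : ℝ) ^ ((k : ℤ) * (2 * (k : ℤ) - 3))) *
        ((2 * k).factorial : ℝ) ^ (2 * k - 1) / ∏ n ∈ Finset.Icc 1 (2 * k), (n : ℝ) ^ n) /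
      (u ^ k * ∏ j ∈ Finset.Icc 1 k, ((2 * (j : ℝ)) ^ 2 - u)) ^ ((k : ℝ) - 1 / 2) := by
  have hs : ∀ j : ℕ, ∃ c : ℝ, j ≤ k → ∀ u ∈ stg k j, Ph k u * Wr (2 * k - 1) (fun q => cl_q k j q) u = c := by
    intro j
    by_cases hj : j ≤ k
    · obtain ⟨c, hc⟩ := stage_const hk hj
      exact ⟨c, fun _ => hc⟩
    · exact ⟨0, fun h => absurd h hj⟩
  choose c hc using hs
  have h1 := thr_all hk c hc
  have h2 := c_inf hk (hc k le_rfl)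
  have hmem : u ∈ stg k 0 := by
    rw [stg_eq, if_pos (by omega)]
    constructor
    · simpa using hu.1
    · have := hu.2; norm_num; linarith
  have h3 := hc 0 (by omega) u hmem
  have hP : 0 < PP k u := by
    unfold PP
    refine mul_pos (pow_pos hu.1 k) (Finset.prod_pos fun j hj => ?_)
    have : (1:ℝ) ≤ j := by exact_mod_cast (Finset.mem_Icc.1 hj).1
    have := hu.2
    nlinarith
  rw [Ph_pos hP] at h3
  have hdet : Matrix.det (Matrix.of fun i j : Fin (2 * k - 1) =>
        iteratedDeriv (i : ℕ) (muS k 1 ((j : ℕ) + 1)) u) =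
      (∏ q : Fin (2 * k - 1), wq k q) * Wr (2 * k - 1) (fun q => cl_q k 0 q) u := by
    unfold Wr
    rw [← Matrix.det_mul_row]
    congr 1
    ext i j
    simp only [Matrix.of_apply]
    rw [mu_eq hk j.2]
    exact iteratedDeriv_const_mul_field _ _
  rw [hdet]
  change _ = _ / PP k u ^ ((k:ℝ) - 1 / 2)
  have hR : 0 < PP k u ^ ((k:ℝ) - 1 / 2) := Real.rpow_pos_of_pos hP _
  rw [eq_div_iff hR.ne']
  have hw := wq_prod hk
  have hce := const_eq hk
  have hck : c k = (-1) ^ ((k-1)*(k-2)/2) * ((∏ r : Fin (2 * k - 1), ((r:ℕ).factorial : ℝ)) / 2 ^ ((2 * k - 1) * (k - 1))) := by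
    rw [← mul_div_assoc, eq_div_iff (by positivity), h2]
  calc _ = (∏ q : Fin (2 * k - 1), wq k q) * (PP k u ^ ((k:ℝ) - 1 / 2) * Wr (2 * k - 1) (fun q => cl_q k 0 q) u) := by ring
    _ = ((∏ q : Fin (2 * k - 1), wq k q) * Real.pi ^ (k ^ 2)) * c k := by rw [h3, h1]; ring
    _ = _ := by rw [hw, hck, hce]; ring
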